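/- (Gap theorem on the infinite cylinder, Corollary 6.2.) For every β > 0 there exists τ > 0 (depending on β) such that the following holds. Let f : ℝ×S¹ → ℝⁿ be a conformal Willmore immersion with conformal factor e^{2u} satisfying sup_{ℝ×S¹} |∇u| < β. If ( ∫_{ℝ×S¹} |A|² dV_g )^{1/2} < τ, then the second fundamental form of f vanishes identically, i.e. A_tt ≡ A_tθ ≡ A_θθ ≡ 0. -/

import Mathlib

noncomputable section

open Real MeasureTheory Set Filter
open scoped InnerProductSpace

/-- Partial derivative in the first variable. -/
def pt {F : Type*} [NormedAddCommGroup F] [NormedSpace ℝ F] (f : ℝ → ℝ → F) (t θ : ℝ) : F :=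
  deriv (fun s => f s θ) t

/-- Partial derivative in the second variable. -/
def pth {F : Type*} [NormedAddCommGroup F] [NormedSpace ℝ F] (f : ℝ → ℝ → F) (t θ : ℝ) : F :=
  deriv (fun s => f t s) θ

variable {n : ℕ}

/-- Mean curvature vector `H = e^{-2u}(∂_t² f + ∂_θ² f)`. -/
def Hmc (f : ℝ → ℝ → EuclideanSpace ℝ (Fin n)) (u : ℝ → ℝ → ℝ) :
    ℝ → ℝ → EuclideanSpace ℝ (Fin n) :=
  fun t θ => Real.exp (-(2 * u t θ)) • (pt (pt f) t θ + pth (pth f) t θ)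

/-- Component `A_tt` of the second fundamental form. -/
def Att (f : ℝ → ℝ → EuclideanSpace ℝ (Fin n)) (u : ℝ → ℝ → ℝ) :
    ℝ → ℝ → EuclideanSpace ℝ (Fin n) :=
  fun t θ => pt (pt f) t θ - pt u t θ • pt f t θ + pth u t θ • pth f t θ

/-- Component `A_tθ` of the second fundamental form. -/
def Atth (f : ℝ → ℝ → EuclideanSpace ℝ (Fin n)) (u : ℝ → ℝ → ℝ) :
    ℝ → ℝ → EuclideanSpace ℝ (Fin n) :=
  fun t θ => pt (pth f) t θ - pth u t θ • pt f t θ - pt u t θ • pth f t θ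

/-- Component `A_θθ` of the second fundamental form. -/
def Athth (f : ℝ → ℝ → EuclideanSpace ℝ (Fin n)) (u : ℝ → ℝ → ℝ) :
    ℝ → ℝ → EuclideanSpace ℝ (Fin n) :=
  fun t θ => pth (pth f) t θ + pt u t θ • pt f t θ - pth u t θ • pth f t θ

/-- `|A|²`, the squared norm of the second fundamental form. -/
def Asq (f : ℝ → ℝ → EuclideanSpace ℝ (Fin n)) (u : ℝ → ℝ → ℝ) : ℝ → ℝ → ℝ :=
  fun t θ => Real.exp (-(4 * u t θ)) *
    (‖Att f u t θ‖ ^ 2 + 2 * ‖Atth f u t θ‖ ^ 2 + ‖Athth f u t θ‖ ^ 2)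

/-- The left-hand side of the Willmore equation in conformal coordinates. -/
def willmoreOp (f : ℝ → ℝ → EuclideanSpace ℝ (Fin n)) (u : ℝ → ℝ → ℝ) :
    ℝ → ℝ → EuclideanSpace ℝ (Fin n) :=
  fun t θ =>
    (2 : ℝ) • (pt (pt (Hmc f u)) t θ + pth (pth (Hmc f u)) t θ)
    + (4 : ℝ) • pt (fun a b => Real.exp (-(2 * u a b)) •
        (⟪Hmc f u a b, Att f u a b⟫_ℝ • pt f a b + ⟪Hmc f u a b, Atth f u a b⟫_ℝ • pth f a b)) t θ
    + (4 : ℝ) • pth (fun a b => Real.exp (-(2 * u a b)) •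
        (⟪Hmc f u a b, Atth f u a b⟫_ℝ • pt f a b + ⟪Hmc f u a b, Athth f u a b⟫_ℝ • pth f a b)) t θ
    - pt (fun a b => ‖Hmc f u a b‖ ^ 2 • pt f a b) t θ
    - pth (fun a b => ‖Hmc f u a b‖ ^ 2 • pth f a b) t θ

/-- A conformal immersion of a cylinder `s × S¹` (in the `t` variable),
with conformal factor `e^{2u}`; maps are `2π`-periodic in the second variable. -/
structure ConfImm (f : ℝ → ℝ → EuclideanSpace ℝ (Fin n)) (u : ℝ → ℝ → ℝ) (s : Set ℝ) :
    Prop where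
  smooth_f : ContDiff ℝ (⊤ : ℕ∞) (fun p : ℝ × ℝ => f p.1 p.2)
  smooth_u : ContDiff ℝ (⊤ : ℕ∞) (fun p : ℝ × ℝ => u p.1 p.2)
  periodic_f : ∀ t θ, f t (θ + 2 * π) = f t θ
  periodic_u : ∀ t θ, u t (θ + 2 * π) = u t θ
  conf_t : ∀ t ∈ s, ∀ θ : ℝ, ‖pt f t θ‖ ^ 2 = Real.exp (2 * u t θ)
  conf_th : ∀ t ∈ s, ∀ θ : ℝ, ‖pth f t θ‖ ^ 2 = Real.exp (2 * u t θ)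
  conf_orth : ∀ t ∈ s, ∀ θ : ℝ, ⟪pt f t θ, pth f t θ⟫_ℝ = 0

/-- A conformal Willmore immersion of a cylinder. -/
structure ConfWillmore (f : ℝ → ℝ → EuclideanSpace ℝ (Fin n)) (u : ℝ → ℝ → ℝ) (s : Set ℝ)
    extends ConfImm f u s : Prop where
  willmore : ∀ t ∈ s, ∀ θ : ℝ, willmoreOp f u t θ = 0

/-- The first residue `τ₁(f,c)(t)`. -/
def tau1 (f : ℝ → ℝ → EuclideanSpace ℝ (Fin n)) (u : ℝ → ℝ → ℝ)
    (c : EuclideanSpace ℝ (Fin n)) (t : ℝ) : ℝ :=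
  ⟪(-2 : ℝ) • (∫ θ in (0 : ℝ)..(2 * π), pt (Hmc f u) t θ)
    - (4 : ℝ) • (∫ θ in (0 : ℝ)..(2 * π), Real.exp (-(2 * u t θ)) •
        (⟪Hmc f u t θ, Att f u t θ⟫_ℝ • pt f t θ + ⟪Hmc f u t θ, Atth f u t θ⟫_ℝ • pth f t θ))
    + ∫ θ in (0 : ℝ)..(2 * π), ‖Hmc f u t θ‖ ^ 2 • pt f t θ, c⟫_ℝ

/-- The second residue `τ₂(f,S)(t)`, for a matrix `S`. -/
def tau2 (f : ℝ → ℝ → EuclideanSpace ℝ (Fin n)) (u : ℝ → ℝ → ℝ)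
    (S : Matrix (Fin n) (Fin n) ℝ) (t : ℝ) : ℝ :=
  2 * (∫ θ in (0 : ℝ)..(2 * π),
        (⟪Hmc f u t θ, pt (fun a b => (Matrix.toEuclideanLin S) (f a b)) t θ⟫_ℝ
          - ⟪pt (Hmc f u) t θ, (Matrix.toEuclideanLin S) (f t θ)⟫_ℝ))
  - 4 * (∫ θ in (0 : ℝ)..(2 * π), Real.exp (-(2 * u t θ)) *
        (⟪Hmc f u t θ, Att f u t θ⟫_ℝ * ⟪pt f t θ, (Matrix.toEuclideanLin S) (f t θ)⟫_ℝ
          + ⟪Hmc f u t θ, Atth f u t θ⟫_ℝ * ⟪pth f t θ, (Matrix.toEuclideanLin S) (f t θ)⟫_ℝ))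
  + ∫ θ in (0 : ℝ)..(2 * π), ‖Hmc f u t θ‖ ^ 2 * ⟪pt f t θ, (Matrix.toEuclideanLin S) (f t θ)⟫_ℝ

/-- Pointwise norm of the gradient of a scalar function on the cylinder. -/
def gradNorm (u : ℝ → ℝ → ℝ) (t θ : ℝ) : ℝ :=
  Real.sqrt ((pt u t θ) ^ 2 + (pth u t θ) ^ 2)

/-- Integral of a density over the piece `[a,b] × S¹` of the cylinder. -/
def cylInt (F : ℝ → ℝ → ℝ) (a b : ℝ) : ℝ :=
  ∫ p in Set.Icc a b ×ˢ Set.Icc (0 : ℝ) (2 * π), F p.1 p.2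

/-- The density `|A|² dV_g` (with respect to `dt dθ`). -/
def Adens (f : ℝ → ℝ → EuclideanSpace ℝ (Fin n)) (u : ℝ → ℝ → ℝ) : ℝ → ℝ → ℝ :=
  fun t θ => Asq f u t θ * Real.exp (2 * u t θ)

/-- The density `|H|² dV_g` (with respect to `dt dθ`). -/
def Hdens (f : ℝ → ℝ → EuclideanSpace ℝ (Fin n)) (u : ℝ → ℝ → ℝ) : ℝ → ℝ → ℝ :=
  fun t θ => ‖Hmc f u t θ‖ ^ 2 * Real.exp (2 * u t θ)

open scoped ContDiff Topology

section Calculus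

variable {F : Type*} [NormedAddCommGroup F] [NormedSpace ℝ F]

/-- Smooth maps on the plane that are `2π`-periodic in the second variable. -/
structure SmoothPer (φ : ℝ → ℝ → F) : Prop where
  smooth : ContDiff ℝ ∞ (fun p : ℝ × ℝ => φ p.1 p.2)
  per : ∀ t θ, φ t (θ + 2 * π) = φ t θ

namespace SmoothPer

variable {φ ψ : ℝ → ℝ → F}

protected theorem continuous (h : SmoothPer φ) : Continuous (fun p : ℝ × ℝ => φ p.1 p.2) :=
  h.smooth.continuous

theorem continuous_right (h : SmoothPer φ) (t : ℝ) : Continuous (φ t) :=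
  h.continuous.comp (Continuous.prodMk_right t)

theorem continuous_left (h : SmoothPer φ) (θ : ℝ) : Continuous (fun t => φ t θ) :=
  h.continuous.comp (Continuous.prodMk_left θ)

theorem hasFDerivAt (h : SmoothPer φ) (p : ℝ × ℝ) :
    HasFDerivAt (fun p : ℝ × ℝ => φ p.1 p.2) (fderiv ℝ (fun p : ℝ × ℝ => φ p.1 p.2) p) p :=
  (h.smooth.differentiable (by simp) p).hasFDerivAt

theorem hasDerivAt_pt' (h : SmoothPer φ) (t θ : ℝ) :
    HasDerivAt (fun s => φ s θ) (fderiv ℝ (fun p : ℝ × ℝ => φ p.1 p.2) (t, θ) (1, 0)) t :=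
  HasFDerivAt.comp_hasDerivAt (f := fun s => (s, θ)) t (h.hasFDerivAt (t, θ))
    ((hasDerivAt_id t).prodMk (hasDerivAt_const t θ))

theorem hasDerivAt_pth' (h : SmoothPer φ) (t θ : ℝ) :
    HasDerivAt (fun s => φ t s) (fderiv ℝ (fun p : ℝ × ℝ => φ p.1 p.2) (t, θ) (0, 1)) θ :=
  (h.hasFDerivAt (t, θ)).comp_hasDerivAt θ ((hasDerivAt_const θ t).prodMk (hasDerivAt_id θ))

theorem pt_eq (h : SmoothPer φ) (t θ : ℝ) :
    _root_.pt φ t θ = fderiv ℝ (fun p : ℝ × ℝ => φ p.1 p.2) (t, θ) (1, 0) :=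
  (h.hasDerivAt_pt' t θ).deriv

theorem pth_eq (h : SmoothPer φ) (t θ : ℝ) :
    _root_.pth φ t θ = fderiv ℝ (fun p : ℝ × ℝ => φ p.1 p.2) (t, θ) (0, 1) :=
  (h.hasDerivAt_pth' t θ).deriv

theorem hasDerivAt_pt (h : SmoothPer φ) (t θ : ℝ) :
    HasDerivAt (fun s => φ s θ) (_root_.pt φ t θ) t := by
  rw [h.pt_eq]; exact h.hasDerivAt_pt' t θ

theorem hasDerivAt_pth (h : SmoothPer φ) (t θ : ℝ) :
    HasDerivAt (fun s => φ t s) (_root_.pth φ t θ) θ := by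
  rw [h.pth_eq]; exact h.hasDerivAt_pth' t θ

protected theorem pt (h : SmoothPer φ) : SmoothPer (_root_.pt φ) where
  smooth := by
    have : (fun p : ℝ × ℝ => _root_.pt φ p.1 p.2)
        = fun p => fderiv ℝ (fun p : ℝ × ℝ => φ p.1 p.2) p (1, 0) := by
      ext p; exact h.pt_eq p.1 p.2
    rw [this]
    exact (h.smooth.fderiv_right (m := ∞) (by simp)).clm_apply contDiff_const
  per t θ := by simp only [_root_.pt, h.per]

protected theorem pth (h : SmoothPer φ) : SmoothPer (_root_.pth φ) where
  smooth := by
    have : (fun p : ℝ × ℝ => _root_.pth φ p.1 p.2)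
        = fun p => fderiv ℝ (fun p : ℝ × ℝ => φ p.1 p.2) p (0, 1) := by
      ext p; exact h.pth_eq p.1 p.2
    rw [this]
    exact (h.smooth.fderiv_right (m := ∞) (by simp)).clm_apply contDiff_const
  per t θ := by
    have : (fun s => φ t s) = fun s => φ t (s + 2 * π) := by ext s; rw [h.per]
    unfold _root_.pth
    conv_rhs => rw [this]
    rw [deriv_comp_add_const (fun s => φ t s) (2 * π) θ]

theorem pt_pth (h : SmoothPer φ) (t θ : ℝ) :
    _root_.pt (_root_.pth φ) t θ = _root_.pth (_root_.pt φ) t θ := by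
  set G := fun p : ℝ × ℝ => φ p.1 p.2
  have hG : ContDiff ℝ ∞ (fderiv ℝ G) := h.smooth.fderiv_right (m := ∞) (by simp)
  have h2 : HasFDerivAt (fderiv ℝ G) (fderiv ℝ (fderiv ℝ G) (t, θ)) (t, θ) :=
    (hG.differentiable (by simp) _).hasFDerivAt
  have e1 : _root_.pt (_root_.pth φ) t θ = fderiv ℝ (fderiv ℝ G) (t, θ) (1, 0) (0, 1) := by
    have : HasDerivAt (fun s => fderiv ℝ G (s, θ)) (fderiv ℝ (fderiv ℝ G) (t, θ) (1, 0)) t :=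
      h2.comp_hasDerivAt t ((hasDerivAt_id t).prodMk (hasDerivAt_const t θ))
    have h3 := this.clm_apply (hasDerivAt_const t ((0, 1) : ℝ × ℝ))
    unfold _root_.pt
    rw [show (fun s => _root_.pth φ s θ) = fun s => fderiv ℝ G (s, θ) (0, 1) from
      funext fun s => h.pth_eq s θ, h3.deriv]
    simp
  have e2 : _root_.pth (_root_.pt φ) t θ = fderiv ℝ (fderiv ℝ G) (t, θ) (0, 1) (1, 0) := by
    have : HasDerivAt (fun s => fderiv ℝ G (t, s)) (fderiv ℝ (fderiv ℝ G) (t, θ) (0, 1)) θ :=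
      h2.comp_hasDerivAt θ ((hasDerivAt_const θ t).prodMk (hasDerivAt_id θ))
    have h3 := this.clm_apply (hasDerivAt_const θ ((1, 0) : ℝ × ℝ))
    unfold _root_.pth
    rw [show (fun s => _root_.pt φ t s) = fun s => fderiv ℝ G (t, s) (1, 0) from
      funext fun s => h.pt_eq t s, h3.deriv]
    simp
  rw [e1, e2]
  exact second_derivative_symmetric (f := G) (f' := fderiv ℝ G) (fun y => h.hasFDerivAt y) h2 _ _

theorem pt_pth_fun (h : SmoothPer φ) : _root_.pt (_root_.pth φ) = _root_.pth (_root_.pt φ) := by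
  ext t θ; exact h.pt_pth t θ

protected theorem add (h : SmoothPer φ) (k : SmoothPer ψ) : SmoothPer (fun t θ => φ t θ + ψ t θ) :=
  ⟨h.smooth.add k.smooth, fun t θ => by simp only [h.per, k.per]⟩

protected theorem sub (h : SmoothPer φ) (k : SmoothPer ψ) : SmoothPer (fun t θ => φ t θ - ψ t θ) :=
  ⟨h.smooth.sub k.smooth, fun t θ => by simp only [h.per, k.per]⟩

protected theorem neg (h : SmoothPer φ) : SmoothPer (fun t θ => -φ t θ) :=
  ⟨h.smooth.neg, fun t θ => by simp only [h.per]⟩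

protected theorem smul {a : ℝ → ℝ → ℝ} (ha : SmoothPer a) (h : SmoothPer φ) :
    SmoothPer (fun t θ => a t θ • φ t θ) :=
  ⟨ha.smooth.smul h.smooth, fun t θ => by simp only [h.per, ha.per]⟩

protected theorem const (c : F) : SmoothPer (fun _ _ => c) := ⟨contDiff_const, fun _ _ => rfl⟩

protected theorem mul {A : Type*} [NormedRing A] [NormedAlgebra ℝ A] {φ ψ : ℝ → ℝ → A}
    (h : SmoothPer φ) (k : SmoothPer ψ) : SmoothPer (fun t θ => φ t θ * ψ t θ) :=
  ⟨h.smooth.mul k.smooth, fun t θ => by simp only [h.per, k.per]⟩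

protected theorem pow {φ : ℝ → ℝ → ℝ} (h : SmoothPer φ) (k : ℕ) : SmoothPer (fun t θ => φ t θ ^ k) :=
  ⟨h.smooth.pow k, fun t θ => by simp only [h.per]⟩

protected theorem comp {G : Type*} [NormedAddCommGroup G] [NormedSpace ℝ G] {g : F → G}
    (hg : ContDiff ℝ ∞ g) (h : SmoothPer φ) : SmoothPer (fun t θ => g (φ t θ)) :=
  ⟨hg.comp h.smooth, fun t θ => by simp only [h.per]⟩

theorem of_left {a : ℝ → F} (ha : ContDiff ℝ ∞ a) : SmoothPer (fun t _ => a t) :=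
  ⟨ha.comp contDiff_fst, fun _ _ => rfl⟩

end SmoothPer

end Calculus

section CircleIntegral

variable {F : Type*} [NormedAddCommGroup F] [NormedSpace ℝ F]

/-- Integral over the circle `{t} × S¹`. -/
def circInt (φ : ℝ → ℝ → F) (t : ℝ) : F := ∫ θ in (0 : ℝ)..(2 * π), φ t θ

theorem circInt_mono {φ ψ : ℝ → ℝ → ℝ} {t : ℝ} (hφ : Continuous (φ t)) (hψ : Continuous (ψ t))
    (h : ∀ θ ∈ Icc 0 (2 * π), φ t θ ≤ ψ t θ) : circInt φ t ≤ circInt ψ t :=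
  intervalIntegral.integral_mono_on (by positivity) (hφ.intervalIntegrable _ _)
    (hψ.intervalIntegrable _ _) h

theorem circInt_nonneg {φ : ℝ → ℝ → ℝ} {t : ℝ} (h : ∀ θ, 0 ≤ φ t θ) : 0 ≤ circInt φ t :=
  intervalIntegral.integral_nonneg (by positivity) fun θ _ => h θ

theorem norm_circInt_le (φ : ℝ → ℝ → F) (t : ℝ) :
    ‖circInt φ t‖ ≤ circInt (fun t θ => ‖φ t θ‖) t :=
  intervalIntegral.norm_integral_le_integral_norm (by positivity)

theorem circInt_const (c : ℝ) (t : ℝ) : circInt (fun _ _ => c) t = 2 * π * c := by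
  simp [circInt]

theorem continuous_circInt {φ : ℝ → ℝ → F} (h : Continuous (fun p : ℝ × ℝ => φ p.1 p.2)) :
    Continuous (circInt φ) :=
  intervalIntegral.continuous_parametric_intervalIntegral_of_continuous' h _ _

theorem circInt_mul_left {𝕜 : Type*} [RCLike 𝕜] (a : ℝ → 𝕜) (φ : ℝ → ℝ → 𝕜) (t : ℝ) :
    circInt (fun t θ => a t * φ t θ) t = a t * circInt φ t :=
  intervalIntegral.integral_const_mul _ _

theorem circInt_add {φ ψ : ℝ → ℝ → F} {t : ℝ} (hφ : Continuous (φ t)) (hψ : Continuous (ψ t)) :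
    circInt (fun t θ => φ t θ + ψ t θ) t = circInt φ t + circInt ψ t :=
  intervalIntegral.integral_add (hφ.intervalIntegrable _ _) (hψ.intervalIntegrable _ _)

theorem circInt_sub {φ ψ : ℝ → ℝ → F} {t : ℝ} (hφ : Continuous (φ t)) (hψ : Continuous (ψ t)) :
    circInt (fun t θ => φ t θ - ψ t θ) t = circInt φ t - circInt ψ t :=
  intervalIntegral.integral_sub (hφ.intervalIntegrable _ _) (hψ.intervalIntegrable _ _)

theorem SmoothPer.circInt_pth [CompleteSpace F] {φ : ℝ → ℝ → F} (h : SmoothPer φ) (t : ℝ) :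
    circInt (_root_.pth φ) t = 0 := by
  unfold circInt
  rw [intervalIntegral.integral_eq_sub_of_hasDerivAt (f := φ t)
    (fun θ _ => h.hasDerivAt_pth t θ) ((h.pth.continuous_right t).intervalIntegrable _ _)]
  have := h.per t 0
  simp only [zero_add] at this
  rw [this, sub_self]

theorem hasDerivAt_intervalIntegral_param {φ φ' : ℝ → ℝ → F} (a b : ℝ)
    (h : Continuous (fun p : ℝ × ℝ => φ p.1 p.2)) (h' : Continuous (fun p : ℝ × ℝ => φ' p.1 p.2))
    (hd : ∀ t θ, HasDerivAt (fun s => φ s θ) (φ' t θ) t) (t : ℝ) :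
    HasDerivAt (fun t => ∫ θ in a..b, φ t θ) (∫ θ in a..b, φ' t θ) t := by
  have hcomp : IsCompact (Icc (t - 1) (t + 1) ×ˢ uIcc a b) := isCompact_Icc.prod isCompact_uIcc
  obtain ⟨M, hM⟩ := hcomp.exists_bound_of_continuousOn h'.continuousOn
  refine (intervalIntegral.hasDerivAt_integral_of_dominated_loc_of_deriv_le
    (F := φ) (F' := φ') (s := Icc (t - 1) (t + 1)) (bound := fun _ => M)
    (Icc_mem_nhds (by linarith) (by linarith)) ?_ ?_ ?_ ?_ ?_ ?_).2
  · exact Eventually.of_forall fun x =>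
      (h.comp (Continuous.prodMk_right x)).aestronglyMeasurable
  · exact (h.comp (Continuous.prodMk_right t)).intervalIntegrable _ _
  · exact (h'.comp (Continuous.prodMk_right t)).aestronglyMeasurable
  · exact Eventually.of_forall fun θ hθ x hx => hM (x, θ) ⟨hx, uIoc_subset_uIcc hθ⟩
  · exact intervalIntegrable_const
  · exact Eventually.of_forall fun θ _ x _ => hd x θ

theorem SmoothPer.hasDerivAt_circInt {φ : ℝ → ℝ → F} (h : SmoothPer φ) (t : ℝ) :
    HasDerivAt (circInt φ) (circInt (_root_.pt φ) t) t :=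
  hasDerivAt_intervalIntegral_param _ _ h.continuous h.pt.continuous h.hasDerivAt_pt t

theorem SmoothPer.contDiff_circInt {φ : ℝ → ℝ → F} (h : SmoothPer φ) :
    ContDiff ℝ ∞ (circInt φ) := by
  refine contDiff_infty.2 fun k => ?_
  induction k generalizing φ with
  | zero => exact contDiff_zero.2 (continuous_circInt h.continuous)
  | succ k ih =>
    rw [show ((k + 1 : ℕ) : WithTop ℕ∞) = (k : WithTop ℕ∞) + 1 by simp, contDiff_succ_iff_deriv]
    refine ⟨fun t => (h.hasDerivAt_circInt t).differentiableAt, by simp, ?_⟩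
    rw [show deriv (circInt φ) = circInt (_root_.pt φ) from
      funext fun t => (h.hasDerivAt_circInt t).deriv]
    exact ih h.pt

/-- Oscillation on a circle is controlled by the integral of the tangential derivative. -/
theorem SmoothPer.norm_sub_le [CompleteSpace F] {φ : ℝ → ℝ → F} (h : SmoothPer φ) (t : ℝ) {x y : ℝ}
    (hx : x ∈ Icc 0 (2 * π)) (hy : y ∈ Icc 0 (2 * π)) :
    ‖φ t x - φ t y‖ ≤ circInt (fun t θ => ‖_root_.pth φ t θ‖) t := by
  have hc := h.pth.continuous_right t
  rw [← intervalIntegral.integral_eq_sub_of_hasDerivAt (f := φ t)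
    (fun θ _ => h.hasDerivAt_pth t θ) (hc.intervalIntegrable _ _)]
  refine intervalIntegral.norm_integral_le_integral_norm_uIoc.trans ?_
  unfold circInt
  rw [intervalIntegral.integral_of_le (by positivity)]
  refine setIntegral_mono_set ?_ (Eventually.of_forall fun _ => norm_nonneg _) ?_
  · exact hc.norm.integrableOn_Ioc
  · refine LE.le.eventuallyLE ?_
    intro z hz
    rw [mem_uIoc] at hz
    rcases hz with hz | hz
    · exact ⟨hy.1.trans_lt hz.1, hz.2.trans hx.2⟩
    · exact ⟨hx.1.trans_lt hz.1, hz.2.trans hy.2⟩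

/-- A map with smooth periodic partial derivatives is smooth. -/
theorem SmoothPer.of_partials {φ φ₁ φ₂ : ℝ → ℝ → F} (h₁ : SmoothPer φ₁) (h₂ : SmoothPer φ₂)
    (d₁ : ∀ t θ, HasDerivAt (fun s => φ s θ) (φ₁ t θ) t)
    (d₂ : ∀ t θ, HasDerivAt (fun s => φ t s) (φ₂ t θ) θ)
    (hp : ∀ t θ, φ t (θ + 2 * π) = φ t θ) : SmoothPer φ := by
  refine ⟨?_, hp⟩
  let g : ℝ × ℝ → ℝ × ℝ →L[ℝ] F := fun p =>
    (ContinuousLinearMap.fst ℝ ℝ ℝ).smulRight (φ₁ p.1 p.2) +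
      (ContinuousLinearMap.snd ℝ ℝ ℝ).smulRight (φ₂ p.1 p.2)
  have hg : ContDiff ℝ ∞ g :=
    (contDiff_const.smulRight h₁.smooth).add (contDiff_const.smulRight h₂.smooth)
  have hd : ∀ p : ℝ × ℝ, HasFDerivAt (fun p : ℝ × ℝ => φ p.1 p.2) (g p) p := by
    intro p
    have := hasStrictFDerivAt_uncurry_coprod (𝕜 := ℝ) (u := p) (f := φ)
      (f₁ := fun t θ => ContinuousLinearMap.toSpanSingleton ℝ (φ₁ t θ))
      (f₂ := fun t θ => ContinuousLinearMap.toSpanSingleton ℝ (φ₂ t θ))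
      (Eventually.of_forall fun v => (d₁ v.1 v.2).hasFDerivAt)
      (Eventually.of_forall fun v => (d₂ v.1 v.2).hasFDerivAt)
      (((ContinuousLinearMap.toSpanSingletonCLE (𝕜 := ℝ) (E := F)).continuous.comp
        h₁.continuous).continuousAt)
      (((ContinuousLinearMap.toSpanSingletonCLE (𝕜 := ℝ) (E := F)).continuous.comp
        h₂.continuous).continuousAt)
    convert this.hasFDerivAt using 1
    · rfl
    · ext
      · simp [g, Function.HasUncurry.uncurry]
      · simp [g, Function.HasUncurry.uncurry]
  refine contDiff_infty_iff_fderiv.2 ⟨fun p => (hd p).differentiableAt, ?_⟩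
  rwa [show fderiv ℝ (fun p : ℝ × ℝ => φ p.1 p.2) = g from funext fun p => (hd p).fderiv]

end CircleIntegral

section CylinderIntegral

/-- Lebesgue measure on the cylinder `ℝ × S¹`, with `S¹ = (0, 2π]`. -/
def cylMeasure : Measure (ℝ × ℝ) := volume.prod (volume.restrict (Ioc 0 (2 * π)))

/-- Integrability over the cylinder. -/
def CylIntegrable (φ : ℝ → ℝ → ℝ) : Prop := Integrable (fun p : ℝ × ℝ => φ p.1 p.2) cylMeasure

/-- Integral over the cylinder. -/
def cylIntegral (φ : ℝ → ℝ → ℝ) : ℝ := ∫ p, φ p.1 p.2 ∂cylMeasure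

/-- Vanishing for large `|t|`. -/
def CompactT (φ : ℝ → ℝ → ℝ) : Prop := ∃ R : ℝ, ∀ t θ, R ≤ |t| → φ t θ = 0

theorem circInt_eq_integral (φ : ℝ → ℝ → ℝ) (t : ℝ) :
    circInt φ t = ∫ θ in Ioc 0 (2 * π), φ t θ :=
  intervalIntegral.integral_of_le (by positivity)

namespace CylIntegrable

variable {φ ψ : ℝ → ℝ → ℝ}

theorem integral_eq (h : CylIntegrable φ) : cylIntegral φ = ∫ t, circInt φ t := by
  simp only [circInt_eq_integral]
  exact integral_prod _ h

theorem integrable_circInt (h : CylIntegrable φ) : Integrable (circInt φ) := by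
  rw [show circInt φ = _ from funext (circInt_eq_integral φ)]
  exact Integrable.integral_prod_left h

protected theorem add (h : CylIntegrable φ) (k : CylIntegrable ψ) :
    CylIntegrable (fun t θ => φ t θ + ψ t θ) := Integrable.add h k

protected theorem sub (h : CylIntegrable φ) (k : CylIntegrable ψ) :
    CylIntegrable (fun t θ => φ t θ - ψ t θ) := Integrable.sub h k

theorem const_mul (h : CylIntegrable φ) (c : ℝ) :
    CylIntegrable (fun t θ => c * φ t θ) := Integrable.const_mul h c

protected theorem abs (h : CylIntegrable φ) : CylIntegrable (fun t θ => |φ t θ|) := Integrable.abs h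

theorem mono (h : CylIntegrable ψ) (hφ : Continuous (fun p : ℝ × ℝ => φ p.1 p.2))
    (hle : ∀ t θ, |φ t θ| ≤ ψ t θ) : CylIntegrable φ :=
  Integrable.mono' h hφ.aestronglyMeasurable (Eventually.of_forall fun p => hle p.1 p.2)

theorem mul_of_sq (hx : CylIntegrable (fun t θ => φ t θ ^ 2))
    (hy : CylIntegrable (fun t θ => ψ t θ ^ 2))
    (cx : Continuous (fun p : ℝ × ℝ => φ p.1 p.2)) (cy : Continuous (fun p : ℝ × ℝ => ψ p.1 p.2)) :
    CylIntegrable (fun t θ => φ t θ * ψ t θ) := by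
  refine (hx.add hy).mono (cx.mul cy) fun t θ => ?_
  rw [abs_le]
  constructor <;> nlinarith [sq_nonneg (φ t θ - ψ t θ), sq_nonneg (φ t θ + ψ t θ)]

end CylIntegrable

variable {φ ψ : ℝ → ℝ → ℝ}

theorem cylIntegral_add (h : CylIntegrable φ) (k : CylIntegrable ψ) :
    cylIntegral (fun t θ => φ t θ + ψ t θ) = cylIntegral φ + cylIntegral ψ := integral_add h k

theorem cylIntegral_sub (h : CylIntegrable φ) (k : CylIntegrable ψ) :
    cylIntegral (fun t θ => φ t θ - ψ t θ) = cylIntegral φ - cylIntegral ψ := integral_sub h k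

theorem cylIntegral_const_mul (c : ℝ) (φ : ℝ → ℝ → ℝ) :
    cylIntegral (fun t θ => c * φ t θ) = c * cylIntegral φ := integral_const_mul _ _

theorem cylIntegral_mono (h : CylIntegrable φ) (k : CylIntegrable ψ)
    (hle : ∀ t θ, φ t θ ≤ ψ t θ) : cylIntegral φ ≤ cylIntegral ψ :=
  integral_mono h k fun p => hle p.1 p.2

theorem cylIntegral_nonneg (h : ∀ t θ, 0 ≤ φ t θ) : 0 ≤ cylIntegral φ :=
  integral_nonneg fun p => h p.1 p.2

theorem cylIntegral_congr (h : ∀ t θ, φ t θ = ψ t θ) : cylIntegral φ = cylIntegral ψ := by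
  rw [show φ = ψ from funext fun t => funext (h t)]

/-- Cauchy–Schwarz on the cylinder. -/
theorem cylIntegral_mul_sq_le (hx : CylIntegrable (fun t θ => φ t θ ^ 2))
    (hy : CylIntegrable (fun t θ => ψ t θ ^ 2))
    (cx : Continuous (fun p : ℝ × ℝ => φ p.1 p.2)) (cy : Continuous (fun p : ℝ × ℝ => ψ p.1 p.2)) :
    cylIntegral (fun t θ => φ t θ * ψ t θ) ^ 2 ≤
      cylIntegral (fun t θ => φ t θ ^ 2) * cylIntegral (fun t θ => ψ t θ ^ 2) := by
  have hxy := hx.mul_of_sq hy cx cy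
  have key : ∀ s : ℝ, 0 ≤ cylIntegral (fun t θ => ψ t θ ^ 2) * (s * s) +
      (2 * cylIntegral (fun t θ => φ t θ * ψ t θ)) * s + cylIntegral (fun t θ => φ t θ ^ 2) := by
    intro s
    have h1 : cylIntegral (fun t θ => (φ t θ ^ 2 + (2 * s) * (φ t θ * ψ t θ)) +
        (s * s) * ψ t θ ^ 2) = _ :=
      cylIntegral_add (hx.add (hxy.const_mul (2 * s))) (hy.const_mul (s * s))
    rw [cylIntegral_add hx (hxy.const_mul (2 * s)), cylIntegral_const_mul,
      cylIntegral_const_mul] at h1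
    have h2 : 0 ≤ cylIntegral (fun t θ => (φ t θ ^ 2 + (2 * s) * (φ t θ * ψ t θ)) +
        (s * s) * ψ t θ ^ 2) :=
      cylIntegral_nonneg fun t θ => by nlinarith [sq_nonneg (φ t θ + s * ψ t θ)]
    rw [h1] at h2
    linarith
  have := discrim_le_zero key
  unfold discrim at this
  nlinarith

theorem cylIntegral_abs_mul_le {A B : ℝ} (hA : 0 ≤ A) (hB : 0 ≤ B)
    (hx : CylIntegrable (fun t θ => φ t θ ^ 2))
    (hy : CylIntegrable (fun t θ => ψ t θ ^ 2))
    (cx : Continuous (fun p : ℝ × ℝ => φ p.1 p.2)) (cy : Continuous (fun p : ℝ × ℝ => ψ p.1 p.2))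
    (hxA : cylIntegral (fun t θ => φ t θ ^ 2) ≤ A ^ 2)
    (hyB : cylIntegral (fun t θ => ψ t θ ^ 2) ≤ B ^ 2) :
    cylIntegral (fun t θ => |φ t θ * ψ t θ|) ≤ A * B := by
  have h := cylIntegral_mul_sq_le (φ := fun t θ => |φ t θ|) (ψ := fun t θ => |ψ t θ|)
    (by simpa only [sq_abs] using hx) (by simpa only [sq_abs] using hy) cx.abs cy.abs
  simp only [sq_abs, ← abs_mul] at h
  refine abs_le_of_sq_le_sq' ?_ (by positivity) |>.2
  calc _ ≤ _ := h
    _ ≤ A ^ 2 * B ^ 2 := by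
      refine mul_le_mul hxA hyB (cylIntegral_nonneg fun _ _ => sq_nonneg _) (by positivity)
    _ = (A * B) ^ 2 := by ring

theorem circInt_mul_sq_le {φ ψ : ℝ → ℝ → ℝ} {t : ℝ} (cx : Continuous (φ t))
    (cy : Continuous (ψ t)) : circInt (fun t θ => φ t θ * ψ t θ) t ^ 2 ≤
      circInt (fun t θ => φ t θ ^ 2) t * circInt (fun t θ => ψ t θ ^ 2) t := by
  have key : ∀ s : ℝ, 0 ≤ circInt (fun t θ => ψ t θ ^ 2) t * (s * s) +
      (2 * circInt (fun t θ => φ t θ * ψ t θ) t) * s + circInt (fun t θ => φ t θ ^ 2) t := by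
    intro s
    have h2 : 0 ≤ circInt (fun t θ => (φ t θ ^ 2 + (2 * s) * (φ t θ * ψ t θ)) +
        (s * s) * ψ t θ ^ 2) t :=
      circInt_nonneg fun θ => by nlinarith [sq_nonneg (φ t θ + s * ψ t θ)]
    rw [circInt_add (by fun_prop) (by fun_prop), circInt_add (by fun_prop) (by fun_prop),
      circInt_mul_left (fun _ => 2 * s) (fun t θ => φ t θ * ψ t θ),
      circInt_mul_left (fun _ => s * s) (fun t θ => ψ t θ ^ 2)] at h2
    linarith
  have := discrim_le_zero key
  unfold discrim at this
  nlinarith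

theorem circInt_sq_le {φ : ℝ → ℝ → ℝ} {t : ℝ} (cx : Continuous (φ t)) :
    circInt φ t ^ 2 ≤ 2 * π * circInt (fun t θ => φ t θ ^ 2) t := by
  have := circInt_mul_sq_le (φ := fun _ _ => 1) continuous_const cx
  simpa [circInt_const] using this

namespace CompactT

theorem cylIntegrable (h : CompactT φ) (hc : Continuous (fun p : ℝ × ℝ => φ p.1 p.2)) :
    CylIntegrable φ := by
  obtain ⟨R, hR⟩ := h
  have hK : IsCompact (Icc (-R) R ×ˢ Icc 0 (2 * π)) := isCompact_Icc.prod isCompact_Icc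
  have h1 : IntegrableOn (fun p : ℝ × ℝ => φ p.1 p.2) (Icc (-R) R ×ˢ Icc 0 (2 * π)) volume :=
    hc.continuousOn.integrableOn_compact hK
  have h2 : IntegrableOn (fun p : ℝ × ℝ => φ p.1 p.2) (univ ×ˢ Ioc 0 (2 * π)) volume := by
    refine (h1.of_forall_sdiff_eq_zero (MeasurableSet.univ.prod measurableSet_Ioc) ?_)
    rintro ⟨t, θ⟩ ⟨⟨-, h3⟩, h4⟩
    refine hR t θ ?_
    by_contra h5
    rw [not_le, abs_lt] at h5
    exact h4 ⟨⟨h5.1.le, h5.2.le⟩, ⟨h3.1.le, h3.2⟩⟩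
  unfold CylIntegrable cylMeasure
  rwa [IntegrableOn, Measure.volume_eq_prod, ← Measure.prod_restrict, Measure.restrict_univ] at h2

theorem mul_left (h : CompactT φ) (ψ : ℝ → ℝ → ℝ) : CompactT (fun t θ => φ t θ * ψ t θ) := by
  obtain ⟨R, hR⟩ := h
  exact ⟨R, fun t θ ht => by simp [hR t θ ht]⟩

theorem mul_right (h : CompactT φ) (ψ : ℝ → ℝ → ℝ) : CompactT (fun t θ => ψ t θ * φ t θ) := by
  obtain ⟨R, hR⟩ := h
  exact ⟨R, fun t θ ht => by simp [hR t θ ht]⟩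

protected theorem add (h : CompactT φ) (k : CompactT ψ) : CompactT (fun t θ => φ t θ + ψ t θ) := by
  obtain ⟨R, hR⟩ := h
  obtain ⟨S, hS⟩ := k
  exact ⟨max R S, fun t θ ht => by
    simp [hR t θ ((le_max_left _ _).trans ht), hS t θ ((le_max_right _ _).trans ht)]⟩

protected theorem sub (h : CompactT φ) (k : CompactT ψ) : CompactT (fun t θ => φ t θ - ψ t θ) := by
  obtain ⟨R, hR⟩ := h
  obtain ⟨S, hS⟩ := k
  exact ⟨max R S, fun t θ ht => by
    simp [hR t θ ((le_max_left _ _).trans ht), hS t θ ((le_max_right _ _).trans ht)]⟩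

protected theorem pow (h : CompactT φ) {k : ℕ} (hk : k ≠ 0) : CompactT (fun t θ => φ t θ ^ k) := by
  obtain ⟨R, hR⟩ := h
  exact ⟨R, fun t θ ht => by simp [hR t θ ht, hk]⟩

protected theorem abs (h : CompactT φ) : CompactT (fun t θ => |φ t θ|) := by
  obtain ⟨R, hR⟩ := h
  exact ⟨R, fun t θ ht => by simp [hR t θ ht]⟩

protected theorem pth (h : CompactT φ) : CompactT (pth φ) := by
  obtain ⟨R, hR⟩ := h
  refine ⟨R, fun t θ ht => ?_⟩
  simp [_root_.pth, hR t _ ht]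

protected theorem pt (h : CompactT φ) : CompactT (pt φ) := by
  obtain ⟨R, hR⟩ := h
  refine ⟨R + 1, fun t θ ht => ?_⟩
  have : (fun s => φ s θ) =ᶠ[𝓝 t] fun _ => 0 := by
    have h1 : ∀ᶠ s in 𝓝 t, R < |s| :=
      continuous_abs.continuousAt.eventually (lt_mem_nhds (by linarith))
    exact h1.mono fun s hs => hR s θ hs.le
  rw [_root_.pt, this.deriv_eq, deriv_const]

end CompactT

theorem SmoothPer.cylIntegral_pth (h : SmoothPer φ) (hc : CompactT φ) :
    cylIntegral (_root_.pth φ) = 0 := by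
  rw [(hc.pth.cylIntegrable h.pth.continuous).integral_eq]
  simp [h.circInt_pth]

theorem integral_eq_zero_of_hasDerivAt_of_eventually {g g' : ℝ → ℝ} {R : ℝ}
    (hg : ∀ t, HasDerivAt g (g' t) t) (hc : Continuous g') (h0 : ∀ t, R ≤ |t| → g t = 0)
    (h0' : ∀ t, R ≤ |t| → g' t = 0) : ∫ t, g' t = 0 := by
  have hs : HasCompactSupport g' := by
    refine HasCompactSupport.of_support_subset_isCompact (isCompact_Icc (a := -R) (b := R)) ?_
    intro t ht
    by_contra h
    refine ht (h0' t ?_)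
    by_contra h5
    rw [not_le, abs_lt] at h5
    exact h ⟨h5.1.le, h5.2.le⟩
  have hs2 : HasCompactSupport g := by
    refine HasCompactSupport.of_support_subset_isCompact (isCompact_Icc (a := -R) (b := R)) ?_
    intro t ht
    by_contra h
    refine ht (h0 t ?_)
    by_contra h5
    rw [not_le, abs_lt] at h5
    exact h ⟨h5.1.le, h5.2.le⟩
  have hgc : Continuous g := continuous_iff_continuousAt.2 fun t => (hg t).continuousAt
  exact integral_eq_zero_of_hasDerivAt_of_integrable hg (hc.integrable_of_hasCompactSupport hs)
    (hgc.integrable_of_hasCompactSupport hs2)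

theorem SmoothPer.cylIntegral_pt (h : SmoothPer φ) (hc : CompactT φ) :
    cylIntegral (_root_.pt φ) = 0 := by
  rw [(hc.pt.cylIntegrable h.pt.continuous).integral_eq]
  obtain ⟨R, hR⟩ := hc
  obtain ⟨S, hS⟩ := CompactT.pt ⟨R, hR⟩
  refine integral_eq_zero_of_hasDerivAt_of_eventually (R := max R S) h.hasDerivAt_circInt
    (continuous_circInt h.pt.continuous) (fun t ht => ?_) (fun t ht => ?_)
  · simp [circInt, hR t _ ((le_max_left _ _).trans ht)]
  · simp [circInt, hS t _ ((le_max_right _ _).trans ht)]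

end CylinderIntegral

section Sobolev

theorem abs_sub_le_integral_abs_deriv {g g' : ℝ → ℝ} (hg : ∀ t, HasDerivAt g (g' t) t)
    (hc : Continuous g') (hi : Integrable g') (s t : ℝ) : |g t - g s| ≤ ∫ r, |g' r| := by
  rw [← intervalIntegral.integral_eq_sub_of_hasDerivAt (fun r _ => hg r)
    (hc.intervalIntegrable _ _)]
  refine (intervalIntegral.norm_integral_le_integral_norm_uIoc (f := g')).trans ?_
  exact setIntegral_le_integral hi.norm (Eventually.of_forall fun _ => norm_nonneg _)

/-- A bound for an integrable function by the `L¹` norm of its derivative. -/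
theorem abs_le_integral_abs_deriv {g g' : ℝ → ℝ} (hg : ∀ t, HasDerivAt g (g' t) t)
    (hc : Continuous g') (hi : Integrable g') (hgi : Integrable g) (t : ℝ) :
    |g t| ≤ ∫ r, |g' r| := by
  by_contra! h
  have hb : ∀ s, |g t| - ∫ r, |g' r| ≤ |g s| := by
    intro s
    have h1 := abs_sub_le_integral_abs_deriv hg hc hi s t
    have h2 := abs_sub_abs_le_abs_sub (g t) (g s)
    linarith
  have h3 : Integrable (fun _ : ℝ => |g t| - ∫ r, |g' r|) := by
    refine Integrable.mono' hgi.norm aestronglyMeasurable_const (Eventually.of_forall fun s => ?_)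
    rw [Real.norm_of_nonneg (by linarith)]
    exact hb s
  rw [integrable_const_iff] at h3
  rcases h3 with h3 | h3
  · linarith
  · exact absurd h3.measure_univ_lt_top (by simp)

variable {k : ℝ → ℝ → ℝ}

theorem SmoothPer.exists_mem_Icc (hk : SmoothPer k) (t θ : ℝ) :
    ∃ x ∈ Icc 0 (2 * π), k t θ = k t x := by
  obtain ⟨x, hx, h⟩ := Function.Periodic.exists_mem_Ico₀ (f := k t) (c := 2 * π)
    (fun x => hk.per t x) (by positivity) θ
  exact ⟨x, ⟨hx.1, hx.2.le⟩, h⟩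

theorem SmoothPer.abs_le_circInt (hk : SmoothPer k) (t θ : ℝ) :
    |k t θ| ≤ circInt (fun t θ => |k t θ| + |pth k t θ|) t := by
  obtain ⟨x, hx, h⟩ := hk.exists_mem_Icc t θ
  have c1 := hk.continuous_right t
  have c2 := hk.pth.continuous_right t
  rw [h, circInt_add c1.abs c2.abs]
  have h1 : circInt (fun _ _ => |k t x|) t ≤
      circInt (fun t θ => |k t θ| + circInt (fun t θ => |pth k t θ|) t) t := by
    refine circInt_mono (by fun_prop) (by fun_prop) fun y hy => ?_
    have h2 := hk.norm_sub_le t hx hy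
    simp only [Real.norm_eq_abs] at h2
    have h3 := abs_sub_abs_le_abs_sub (k t x) (k t y)
    linarith
  rw [circInt_add (ψ := fun t θ => circInt (fun t θ => |pth k t θ|) t) c1.abs (by fun_prop),
    circInt_const] at h1
  have h2 : circInt (fun t θ => circInt (fun t θ => |pth k t θ|) t) t =
    2 * π * circInt (fun t θ => |pth k t θ|) t := by simp [circInt]
  rw [h2] at h1
  have h4 : 0 ≤ circInt (fun t θ => |k t θ|) t := circInt_nonneg fun _ => abs_nonneg _
  have h5 : 1 ≤ 2 * π := by linarith [Real.pi_gt_three]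
  nlinarith

/-- An `L²` bound by `L¹` norms of first derivatives on the cylinder. -/
theorem SmoothPer.cylIntegral_sq_le (hk : SmoothPer k) (hc : CompactT k) :
    cylIntegral (fun t θ => k t θ ^ 2) ≤ cylIntegral (fun t θ => |pt k t θ|) *
      cylIntegral (fun t θ => |k t θ| + |pth k t θ|) := by
  have i1 := hc.pt.abs.cylIntegrable hk.pt.continuous.abs
  have i2 := (hc.abs.add hc.pth.abs).cylIntegrable (hk.continuous.abs.add hk.pth.continuous.abs)
  have b1 : ∀ t θ, |k t θ| ≤ ∫ s, |pt k s θ| := by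
    intro t θ
    obtain ⟨R, hR⟩ := hc
    obtain ⟨S, hS⟩ := CompactT.pt ⟨R, hR⟩
    have hi : Integrable (fun s => pt k s θ) := by
      refine (hk.pt.continuous_left θ).integrable_of_hasCompactSupport ?_
      refine HasCompactSupport.of_support_subset_isCompact (isCompact_Icc (a := -S) (b := S)) ?_
      intro t ht
      by_contra h
      refine ht (hS t θ ?_)
      by_contra h5
      rw [not_le, abs_lt] at h5
      exact h ⟨h5.1.le, h5.2.le⟩
    have := abs_sub_le_integral_abs_deriv (fun s => hk.hasDerivAt_pt s θ)
      (hk.pt.continuous_left θ) hi R t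
    rwa [hR R θ (le_abs_self R), sub_zero] at this
  have b2 := fun t θ => hk.abs_le_circInt t θ
  have i3 := i2.integrable_circInt
  have i4 : Integrable (fun θ => ∫ s, |pt k s θ|) (volume.restrict (Ioc 0 (2 * π))) :=
    Integrable.integral_prod_right i1
  calc cylIntegral (fun t θ => k t θ ^ 2)
      ≤ cylIntegral (fun t θ => circInt (fun t θ => |k t θ| + |pth k t θ|) t *
          ∫ s, |pt k s θ|) := by
        refine cylIntegral_mono ((hc.pow two_ne_zero).cylIntegrable (hk.pow 2).continuous)
          (i3.mul_prod i4) fun t θ => ?_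
        rw [← sq_abs, sq]
        exact mul_le_mul (b2 t θ) (b1 t θ) (abs_nonneg _) ((abs_nonneg _).trans (b2 t θ))
    _ = (∫ t, circInt (fun t θ => |k t θ| + |pth k t θ|) t) *
          ∫ θ in Ioc 0 (2 * π), ∫ s, |pt k s θ| :=
        integral_prod_mul (circInt (fun t θ => |k t θ| + |pth k t θ|)) (fun θ => ∫ s, |pt k s θ|)
    _ = _ := by
        rw [← i2.integral_eq, mul_comm]
        congr 1
        exact (integral_prod_symm _ i1).symm

/-- Smooth cutoff functions with small derivative. -/
theorem exists_cutoff : ∃ B : ℝ, 0 ≤ B ∧ ∀ T : ℝ, 1 ≤ T → ∃ η : ℝ → ℝ, ContDiff ℝ ∞ η ∧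
    (∀ t, 0 ≤ η t ∧ η t ≤ 1) ∧ (∀ t, |t| ≤ T → η t = 1 ∧ deriv η t = 0) ∧
    CompactT (fun t _ => η t) ∧ (∀ t, deriv η t ^ 2 ≤ B / T) ∧
    cylIntegral (fun t _ => deriv η t ^ 2) ≤ B / T := by
  let b : ContDiffBump (0 : ℝ) := ⟨1, 2, one_pos, one_lt_two⟩
  have hb : ContDiff ℝ ∞ b := b.contDiff
  obtain ⟨K, hK⟩ := (hb.continuous_deriv (by simp)).bounded_above_of_compact_support
    b.hasCompactSupport.deriv
  have hK0 : 0 ≤ K := (norm_nonneg _).trans (hK 0)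
  refine ⟨8 * π * K ^ 2, by positivity, fun T hT => ⟨fun t => b (t / T), ?_⟩⟩
  have hT0 : 0 < T := by linarith
  have hη : ContDiff ℝ ∞ (fun t => b (t / T)) := hb.comp (contDiff_id.div_const T)
  have h01 : ∀ t, 0 ≤ b (t / T) ∧ b (t / T) ≤ 1 := fun t => ⟨b.nonneg, b.le_one⟩
  have hz : ∀ t, 2 * T ≤ |t| → b (t / T) = 0 := fun t ht => by
    refine b.zero_of_le_dist ?_
    simp only [b, dist_zero_right, Real.norm_eq_abs, abs_div, abs_of_pos hT0]
    rwa [le_div_iff₀ hT0]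
  have hd : ∀ t, deriv (fun t => b (t / T)) t = deriv b (t / T) * (1 / T) := fun t =>
    HasDerivAt.deriv (HasDerivAt.comp (h₂ := b) (h := fun s => s / T) t
      ((hb.differentiable (by simp)).differentiableAt.hasDerivAt) ((hasDerivAt_id t).div_const T))
  have hdb : ∀ t, deriv (fun t => b (t / T)) t ^ 2 ≤ K ^ 2 / T ^ 2 := fun t => by
    rw [hd, mul_pow, div_pow, one_pow, mul_one_div]
    gcongr ?_ / _
    rw [← sq_abs]
    exact pow_le_pow_left₀ (abs_nonneg _) (hK _) 2
  have hTT : K ^ 2 / T ^ 2 ≤ K ^ 2 / T := by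
    gcongr
    nlinarith
  have hct : CompactT (fun t _ => b (t / T)) := ⟨2 * T, fun t _ ht => hz t ht⟩
  refine ⟨hη, h01, fun t ht => ?_, hct, fun t => ?_, ?_⟩
  · have h1 : b (t / T) = 1 := by
      refine b.one_of_mem_closedBall ?_
      simp only [b, mem_closedBall_zero_iff, Real.norm_eq_abs, abs_div, abs_of_pos hT0]
      rwa [div_le_one hT0]
    refine ⟨h1, IsLocalMax.deriv_eq_zero (Eventually.of_forall fun s => ?_)⟩
    simp only [h1]
    exact (h01 s).2
  · refine ((hdb t).trans hTT).trans ?_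
    gcongr
    nlinarith [Real.pi_gt_three, sq_nonneg K]
  · have hc := hη.continuous_deriv (by simp)
    have hp : pt (fun t _ => b (t / T)) = fun t _ => deriv (fun t => b (t / T)) t := rfl
    have hct2 := hct.pt
    rw [hp] at hct2
    have hi : CylIntegrable (fun t _ => deriv (fun t => b (t / T)) t ^ 2) :=
      (hct2.pow two_ne_zero).cylIntegrable (by fun_prop)
    rw [hi.integral_eq]
    have h1 : ∀ t, circInt (fun t _ => deriv (fun t => b (t / T)) t ^ 2) t ≤
        (Icc (-(2 * T)) (2 * T)).indicator (fun _ => 2 * π * (K ^ 2 / T ^ 2)) t := by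
      intro t
      by_cases ht : t ∈ Icc (-(2 * T)) (2 * T)
      · rw [indicator_of_mem ht]
        simp only [circInt, intervalIntegral.integral_const, sub_zero, smul_eq_mul]
        gcongr
        exact hdb t
      · rw [indicator_of_notMem ht]
        have ht2 : 2 * T < |t| := by
          by_contra! h
          exact ht (abs_le.1 h)
        have : deriv (fun t => b (t / T)) t = 0 := by
          have h2 : (fun t => b (t / T)) =ᶠ[𝓝 t] fun _ => 0 :=
            (continuous_abs.continuousAt.eventually (lt_mem_nhds ht2)).mono fun s hs => hz s hs.le
          rw [h2.deriv_eq, deriv_const]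
        simp [circInt, this]
    have h2 : Integrable ((Icc (-(2 * T)) (2 * T)).indicator
        (fun _ => 2 * π * (K ^ 2 / T ^ 2))) := by
      rw [integrable_indicator_iff measurableSet_Icc]
      exact integrableOn_const (by simp)
    refine (integral_mono hi.integrable_circInt h2 h1).trans ?_
    rw [integral_indicator measurableSet_Icc]
    simp only [integral_const, MeasurableSet.univ, measureReal_restrict_apply, univ_inter,
      Real.volume_real_Icc, smul_eq_mul]
    rw [max_eq_left (by linarith)]
    apply le_of_eq
    field_simp
    ring

/-- Integrability from uniform bounds on truncations. -/
theorem cylIntegrable_of_truncations {φ : ℝ → ℝ → ℝ} {C D : ℝ}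
    (hφ : Continuous (fun p : ℝ × ℝ => φ p.1 p.2)) (h0 : ∀ t θ, 0 ≤ φ t θ)
    (H : ∀ T : ℝ, 1 ≤ T → ∃ ψ : ℝ → ℝ → ℝ, CylIntegrable ψ ∧ (∀ t θ, 0 ≤ ψ t θ) ∧
      (∀ t θ, |t| ≤ T → φ t θ ≤ ψ t θ) ∧ cylIntegral ψ ≤ C + D / T) :
    CylIntegrable φ ∧ cylIntegral φ ≤ C := by
  let S : ℝ → Set (ℝ × ℝ) := fun T => {p | |p.1| ≤ T}
  have hS : ∀ T, MeasurableSet (S T) := fun T =>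
    measurableSet_le (by fun_prop) measurable_const
  have hcov : AECover cylMeasure atTop S :=
    ⟨Eventually.of_forall fun p => eventually_ge_atTop |p.1|, hS⟩
  have hb : ∀ T : ℝ, 1 ≤ T → IntegrableOn (fun p : ℝ × ℝ => φ p.1 p.2) (S T) cylMeasure ∧
      ∫ p in S T, φ p.1 p.2 ∂cylMeasure ≤ C + D / T := by
    intro T hT
    obtain ⟨ψ, i1, p1, l1, b1⟩ := H T hT
    have i2 : IntegrableOn (fun p : ℝ × ℝ => φ p.1 p.2) (S T) cylMeasure := by
      refine Integrable.mono' (Integrable.integrableOn i1) hφ.aestronglyMeasurable ?_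
      refine (ae_restrict_iff' (hS T)).2 (Eventually.of_forall fun p hp => ?_)
      rw [Real.norm_of_nonneg (h0 _ _)]
      exact l1 _ _ hp
    refine ⟨i2, le_trans ?_ b1⟩
    refine (setIntegral_mono_on i2 (Integrable.integrableOn i1) (hS T)
      fun p hp => l1 _ _ hp).trans ?_
    exact setIntegral_le_integral i1 (Eventually.of_forall fun p => p1 _ _)
  have hi : CylIntegrable φ := by
    refine hcov.integrable_of_integral_bounded_of_nonneg_ae (C + |D|) (fun T => ?_)
      (Eventually.of_forall fun p => h0 _ _) ?_
    · exact (hb (max 1 T) (le_max_left _ _)).1.mono_set fun p (hp : |p.1| ≤ T) =>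
        hp.trans (le_max_right _ _)
    · filter_upwards [eventually_ge_atTop 1] with T hT
      refine (hb T hT).2.trans ?_
      have : D / T ≤ |D| := by
        rw [div_le_iff₀ (by linarith)]
        nlinarith [le_abs_self D, abs_nonneg D]
      linarith
  refine ⟨hi, ?_⟩
  have h1 := hcov.integral_tendsto_of_countably_generated hi
  have h2 : Tendsto (fun T : ℝ => C + D / T) atTop (𝓝 (C + 0)) :=
    tendsto_const_nhds.add (tendsto_const_nhds.div_atTop tendsto_id)
  rw [add_zero] at h2
  exact le_of_tendsto_of_tendsto h1 h2
    ((eventually_ge_atTop 1).mono fun T hT => (hb T hT).2)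

end Sobolev

section Dbar

/-- Squared gradient. -/
def gradSq (p : ℝ → ℝ → ℝ) (t θ : ℝ) : ℝ := pt p t θ ^ 2 + pth p t θ ^ 2

/-- `|∂̄(p + iq)|²`, where `∂̄ = ∂_t + i∂_θ`. -/
def dbarSq (p q : ℝ → ℝ → ℝ) (t θ : ℝ) : ℝ :=
  (pt p t θ - pth q t θ) ^ 2 + (pt q t θ + pth p t θ) ^ 2

variable {p q : ℝ → ℝ → ℝ} {ρ : ℝ → ℝ}

protected theorem SmoothPer.gradSq (hp : SmoothPer p) : SmoothPer (gradSq p) :=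
  (hp.pt.pow 2).add (hp.pth.pow 2)

protected theorem SmoothPer.dbarSq (hp : SmoothPer p) (hq : SmoothPer q) :
    SmoothPer (dbarSq p q) :=
  ((hp.pt.sub hq.pth).pow 2).add ((hq.pt.add hp.pth).pow 2)

theorem gradSq_nonneg (t θ : ℝ) : 0 ≤ gradSq p t θ := by unfold gradSq; positivity

theorem dbarSq_nonneg (t θ : ℝ) : 0 ≤ dbarSq p q t θ := by unfold dbarSq; positivity

protected theorem CompactT.gradSq (hp : CompactT p) : CompactT (gradSq p) :=
  (hp.pt.pow two_ne_zero).add (hp.pth.pow two_ne_zero)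

protected theorem CompactT.dbarSq (hp : CompactT p) (hq : CompactT q) : CompactT (dbarSq p q) :=
  ((hp.pt.sub hq.pth).pow two_ne_zero).add ((hq.pt.add hp.pth).pow two_ne_zero)

theorem SmoothPer.pt_mul_left (hρ : Differentiable ℝ ρ) (hp : SmoothPer p) (t θ : ℝ) :
    pt (fun t θ => ρ t * p t θ) t θ = deriv ρ t * p t θ + ρ t * pt p t θ :=
  ((hρ t).hasDerivAt.mul (hp.hasDerivAt_pt t θ)).deriv

theorem SmoothPer.pth_mul_left (hp : SmoothPer p) (t θ : ℝ) :
    pth (fun t θ => ρ t * p t θ) t θ = ρ t * pth p t θ :=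
  ((hp.hasDerivAt_pth t θ).const_mul (ρ t)).deriv

theorem SmoothPer.pt_mul (hp : SmoothPer p) (hq : SmoothPer q) (t θ : ℝ) :
    _root_.pt (fun t θ => p t θ * q t θ) t θ = pt p t θ * q t θ + p t θ * pt q t θ :=
  ((hp.hasDerivAt_pt t θ).mul (hq.hasDerivAt_pt t θ)).deriv

theorem SmoothPer.pth_mul (hp : SmoothPer p) (hq : SmoothPer q) (t θ : ℝ) :
    pth (fun t θ => p t θ * q t θ) t θ = pth p t θ * q t θ + p t θ * pth q t θ :=
  ((hp.hasDerivAt_pth t θ).mul (hq.hasDerivAt_pth t θ)).deriv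

/-- The `L²` pairing of `q` with the tangential derivative of `p` on a circle. -/
theorem abs_circInt_mul_pth_le (hp : SmoothPer p) (hq : SmoothPer q) (t : ℝ) :
    |circInt (fun t θ => q t θ * pth p t θ) t| ≤
      π * circInt (fun t θ => pth q t θ ^ 2 + pth p t θ ^ 2) t := by
  have c1 := hq.continuous_right t
  have c2 := hp.pth.continuous_right t
  have c3 := hq.pth.continuous_right t
  have e1 : circInt (fun t θ => q t θ * pth p t θ) t =
      circInt (fun t θ => (q t θ - q t 0) * pth p t θ) t := by
    have : (fun t θ => (q t θ - q t 0) * pth p t θ) =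
      fun t θ => q t θ * pth p t θ - q t 0 * pth p t θ := by ext; ring
    rw [this, circInt_sub (by fun_prop) (by fun_prop), circInt_mul_left (fun t => q t 0),
      hp.circInt_pth]
    simp
  rw [e1]
  set Q := circInt (fun t θ => |pth q t θ|) t with hQ
  set P := circInt (fun t θ => |pth p t θ|) t with hP
  have h1 : |circInt (fun t θ => (q t θ - q t 0) * pth p t θ) t| ≤ Q * P := by
    refine (norm_circInt_le (F := ℝ) _ t).trans ?_
    have : circInt (fun _ θ => Q * |pth p t θ|) t = Q * P :=
      circInt_mul_left (fun _ => Q) (fun _ θ => |pth p t θ|) t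
    rw [← this]
    refine circInt_mono (by fun_prop) (by fun_prop) fun x hx => ?_
    rw [norm_mul, Real.norm_eq_abs, Real.norm_eq_abs]
    exact mul_le_mul_of_nonneg_right (hq.norm_sub_le t hx ⟨le_rfl, by positivity⟩) (abs_nonneg _)
  have h2 : Q ^ 2 ≤ 2 * π * circInt (fun t θ => pth q t θ ^ 2) t := by
    have := circInt_sq_le (φ := fun t θ => |pth q t θ|) (t := t) c3.abs
    simpa only [sq_abs] using this
  have h3 : P ^ 2 ≤ 2 * π * circInt (fun t θ => pth p t θ ^ 2) t := by
    have := circInt_sq_le (φ := fun t θ => |pth p t θ|) (t := t) c2.abs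
    simpa only [sq_abs] using this
  rw [circInt_add (by fun_prop) (by fun_prop)]
  nlinarith [sq_nonneg (Q - P)]

/-- Weighted `L²` bound of the gradient by `∂̄` for maps vanishing near infinity. -/
theorem cylIntegral_gradSq_le_of_compactT (hp : SmoothPer p) (hq : SmoothPer q)
    (cp : CompactT p) (cq : CompactT q) (hρ : ContDiff ℝ ∞ ρ)
    (hρ' : ∀ t, |deriv ρ t| ≤ ρ t / (4 * π)) :
    cylIntegral (fun t θ => ρ t * (gradSq p t θ + gradSq q t θ)) ≤
      2 * cylIntegral (fun t θ => ρ t * dbarSq p q t θ) := by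
  have hd := hρ.differentiable (by simp)
  have hρs : SmoothPer (fun t _ => ρ t) := SmoothPer.of_left hρ
  have hρ's : SmoothPer (fun t _ => deriv ρ t) := hρs.pt
  have s1 := hq.mul hp.pth
  have s2 := hq.mul hp.pt
  have I1 := (hρs.mul s1).cylIntegral_pt ((cq.mul_left _).mul_right _)
  have I2 := (hρs.mul s2).cylIntegral_pth ((cq.mul_left _).mul_right _)
  have cE : CompactT (fun t θ => deriv ρ t * (q t θ * pth p t θ)) := (cq.mul_left _).mul_right _
  have sE := hρ's.mul s1
  have iE := cE.cylIntegrable sE.continuous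
  have cG := (cp.gradSq.add cq.gradSq).mul_right (fun t _ => ρ t)
  have sG := hρs.mul (hp.gradSq.add hq.gradSq)
  have iG := cG.cylIntegrable sG.continuous
  have cD := (cp.dbarSq cq).mul_right (fun t _ => ρ t)
  have iD := cD.cylIntegrable (hρs.mul (hp.dbarSq hq)).continuous
  have i1 := ((cq.mul_left (pth p)).mul_right (fun t _ => ρ t)).pt.cylIntegrable
    (hρs.mul s1).pt.continuous
  have i2 := ((cq.mul_left (pt p)).mul_right (fun t _ => ρ t)).pth.cylIntegrable
    (hρs.mul s2).pth.continuous
  have key : cylIntegral (fun t θ => ρ t * dbarSq p q t θ) =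
      cylIntegral (fun t θ => ρ t * (gradSq p t θ + gradSq q t θ)) -
        2 * cylIntegral (fun t θ => deriv ρ t * (q t θ * pth p t θ)) := by
    have e : ∀ t θ, ρ t * dbarSq p q t θ = (ρ t * (gradSq p t θ + gradSq q t θ) -
        2 * (deriv ρ t * (q t θ * pth p t θ))) +
        2 * (pt (fun t θ => ρ t * (q t θ * pth p t θ)) t θ -
          pth (fun t θ => ρ t * (q t θ * pt p t θ)) t θ) := by
      intro t θ
      rw [s1.pt_mul_left hd, s2.pth_mul_left, hq.pt_mul hp.pth, hq.pth_mul hp.pt, hp.pt_pth]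
      unfold dbarSq gradSq
      ring
    rw [cylIntegral_congr e, cylIntegral_add (iG.sub (iE.const_mul 2)) ((i1.sub i2).const_mul 2),
      cylIntegral_sub iG (iE.const_mul 2), cylIntegral_const_mul, cylIntegral_const_mul,
      cylIntegral_sub i1 i2, I1, I2]
    ring
  have bE : cylIntegral (fun t θ => deriv ρ t * (q t θ * pth p t θ)) ≤
      1 / 4 * cylIntegral (fun t θ => ρ t * (gradSq p t θ + gradSq q t θ)) := by
    rw [← cylIntegral_const_mul, iE.integral_eq, (iG.const_mul _).integral_eq]
    refine integral_mono iE.integrable_circInt (iG.const_mul _).integrable_circInt fun t => ?_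
    have c1 := hq.continuous_right t
    have c2 := hp.pth.continuous_right t
    have c3 := hq.pth.continuous_right t
    have h1 := abs_circInt_mul_pth_le hp hq t
    set A := circInt (fun t θ => pth q t θ ^ 2 + pth p t θ ^ 2) t with hA
    have hA0 : 0 ≤ A := circInt_nonneg fun θ => by positivity
    have hr := hρ' t
    have hr0 : 0 ≤ ρ t := by
      have := (abs_nonneg _).trans hr
      by_contra! h
      exact absurd this (not_le.2 (div_neg_of_neg_of_pos h (by positivity)))
    calc circInt (fun t θ => deriv ρ t * (q t θ * pth p t θ)) t
        = deriv ρ t * circInt (fun t θ => q t θ * pth p t θ) t :=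
          circInt_mul_left (deriv ρ) (fun t θ => q t θ * pth p t θ) t
      _ ≤ |deriv ρ t * circInt (fun t θ => q t θ * pth p t θ) t| := le_abs_self _
      _ ≤ ρ t / (4 * π) * (π * A) := by
          rw [abs_mul]
          exact mul_le_mul hr h1 (abs_nonneg _) (by positivity)
      _ = 1 / 4 * ρ t * A := by field_simp
      _ = circInt (fun t θ => 1 / 4 * ρ t * (pth q t θ ^ 2 + pth p t θ ^ 2)) t :=
          (circInt_mul_left (fun t => 1 / 4 * ρ t) (fun t θ => pth q t θ ^ 2 + pth p t θ ^ 2) t).symm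
      _ ≤ _ := by
          have c4 := sG.continuous_right t
          refine circInt_mono (by fun_prop) (by fun_prop) fun θ _ => ?_
          rw [mul_assoc]
          refine mul_le_mul_of_nonneg_left (mul_le_mul_of_nonneg_left ?_ hr0) (by norm_num)
          unfold gradSq
          nlinarith [sq_nonneg (pt p t θ), sq_nonneg (pt q t θ)]
  linarith

/-- Weighted global `L²` bound of the gradient by `∂̄`. -/
theorem cylIntegrable_gradSq_of_dbarSq (hp : SmoothPer p) (hq : SmoothPer q)
    (hρ : ContDiff ℝ ∞ ρ) (hρ' : ∀ t, |deriv ρ t| ≤ ρ t / (4 * π)) (hρ0 : ∀ t, 0 ≤ ρ t)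
    (hD : CylIntegrable (fun t θ => ρ t * dbarSq p q t θ)) {M : ℝ} {R : ℝ → ℝ → ℝ}
    (hM : 0 ≤ M) (hR : CylIntegrable R) (hR0 : ∀ t θ, 0 ≤ R t θ)
    (cR : Continuous (fun p : ℝ × ℝ => R p.1 p.2))
    (hb : ∀ t θ, ρ t * (p t θ ^ 2 + q t θ ^ 2) ≤ M + R t θ) :
    CylIntegrable (fun t θ => ρ t * (gradSq p t θ + gradSq q t θ)) ∧
    cylIntegral (fun t θ => ρ t * (gradSq p t θ + gradSq q t θ)) ≤
      4 * cylIntegral (fun t θ => ρ t * dbarSq p q t θ) := by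
  obtain ⟨B, hB, hcut⟩ := exists_cutoff
  have hρs : SmoothPer (fun t _ => ρ t) := SmoothPer.of_left hρ
  refine cylIntegrable_of_truncations (D := 4 * (M * B + B * cylIntegral R))
    (hρs.mul (hp.gradSq.add hq.gradSq)).continuous
    (fun t θ => mul_nonneg (hρ0 t) (add_nonneg (gradSq_nonneg _ _) (gradSq_nonneg _ _)))
    fun T hT => ?_
  obtain ⟨η, hη, h01, h1, ηc, hη', hη'i⟩ := hcut T hT
  have hd := hη.differentiable (by simp)
  have hηs : SmoothPer (fun t _ => η t) := SmoothPer.of_left hη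
  have hp' := hηs.mul hp
  have hq' := hηs.mul hq
  have cp' := ηc.mul_left p
  have cq' := ηc.mul_left q
  have cη' : CompactT (fun t _ => deriv η t) := ηc.pt
  have sη' : SmoothPer (fun t _ => deriv η t) := hηs.pt
  refine ⟨_, ((cp'.gradSq.add cq'.gradSq).mul_right (fun t _ => ρ t)).cylIntegrable
    (hρs.mul (hp'.gradSq.add hq'.gradSq)).continuous,
    (fun t θ => mul_nonneg (hρ0 t) (add_nonneg (gradSq_nonneg _ _) (gradSq_nonneg _ _))),
    fun t θ ht => ?_, ?_⟩
  · obtain ⟨e1, e2⟩ := h1 t ht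
    refine mul_le_mul_of_nonneg_left (le_of_eq ?_) (hρ0 t)
    unfold gradSq
    rw [hp.pt_mul_left hd, hq.pt_mul_left hd, hp.pth_mul_left, hq.pth_mul_left, e1, e2]
    ring
  · refine (cylIntegral_gradSq_le_of_compactT hp' hq' cp' cq' hρ hρ').trans ?_
    have iL := ((cp'.dbarSq cq').mul_right (fun t _ => ρ t)).cylIntegrable
      (hρs.mul (hp'.dbarSq hq')).continuous
    have i1 : CylIntegrable (fun t _ => deriv η t ^ 2) :=
      (cη'.pow two_ne_zero).cylIntegrable (sη'.pow 2).continuous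
    have i2 : CylIntegrable (fun t θ => deriv η t ^ 2 * R t θ) :=
      ((cη'.pow two_ne_zero).mul_left R).cylIntegrable ((sη'.pow 2).continuous.mul cR)
    have b2 : cylIntegral (fun t θ => deriv η t ^ 2 * R t θ) ≤ B / T * cylIntegral R := by
      rw [← cylIntegral_const_mul]
      exact cylIntegral_mono i2 (hR.const_mul _) fun t θ =>
        mul_le_mul_of_nonneg_right (hη' t) (hR0 t θ)
    have b3 : cylIntegral (fun t θ => ρ t *
        dbarSq (fun t θ => η t * p t θ) (fun t θ => η t * q t θ) t θ) ≤
        cylIntegral (fun t θ => 2 * (ρ t * dbarSq p q t θ) +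
          2 * (M * deriv η t ^ 2 + deriv η t ^ 2 * R t θ)) := by
      refine cylIntegral_mono iL ((hD.const_mul 2).add (((i1.const_mul M).add i2).const_mul 2))
        fun t θ => ?_
      unfold dbarSq
      rw [hp.pt_mul_left hd, hq.pt_mul_left hd, hp.pth_mul_left, hq.pth_mul_left]
      set x := pt p t θ - pth q t θ with hx
      set y := pt q t θ + pth p t θ with hy
      have e1 : deriv η t * p t θ + η t * pt p t θ - η t * pth q t θ
        = η t * x + deriv η t * p t θ := by rw [hx]; ring
      have e2 : deriv η t * q t θ + η t * pt q t θ + η t * pth p t θ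
        = η t * y + deriv η t * q t θ := by rw [hy]; ring
      rw [e1, e2]
      have hh : (η t * x + deriv η t * p t θ) ^ 2 + (η t * y + deriv η t * q t θ) ^ 2 ≤
          2 * (x ^ 2 + y ^ 2) + 2 * (deriv η t ^ 2 * (p t θ ^ 2 + q t θ ^ 2)) := by
        have h5 : η t ^ 2 ≤ 1 := pow_le_one₀ (h01 t).1 (h01 t).2
        nlinarith [sq_nonneg (η t * x - deriv η t * p t θ),
          sq_nonneg (η t * y - deriv η t * q t θ), mul_le_mul_of_nonneg_right h5 (sq_nonneg x),
          mul_le_mul_of_nonneg_right h5 (sq_nonneg y)]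
      have h6 := mul_le_mul_of_nonneg_left hh (hρ0 t)
      have h7 := mul_le_mul_of_nonneg_left (hb t θ) (sq_nonneg (deriv η t))
      nlinarith
    rw [cylIntegral_add (hD.const_mul 2) (((i1.const_mul M).add i2).const_mul 2),
      cylIntegral_const_mul, cylIntegral_const_mul, cylIntegral_add (i1.const_mul M) i2,
      cylIntegral_const_mul] at b3
    have b4 := mul_le_mul_of_nonneg_left hη'i hM
    have e : 4 * (M * B + B * cylIntegral R) / T = 4 * (M * (B / T) + B / T * cylIntegral R) := by
      ring
    rw [e]
    linarith

end Dbar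

section Rotation

/-- Real part of `e^{m(t + iθ)} (x + iy)`. -/
def rotRe (m : ℤ) (x y : ℝ → ℝ → ℝ) (t θ : ℝ) : ℝ :=
  exp (m * t) * (cos (m * θ) * x t θ - sin (m * θ) * y t θ)

/-- Imaginary part of `e^{m(t + iθ)} (x + iy)`. -/
def rotIm (m : ℤ) (x y : ℝ → ℝ → ℝ) (t θ : ℝ) : ℝ :=
  exp (m * t) * (sin (m * θ) * x t θ + cos (m * θ) * y t θ)

variable {m : ℤ} {x y : ℝ → ℝ → ℝ}

theorem smoothPer_exp_mul (m : ℤ) : SmoothPer (fun t _ => exp (m * t)) :=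
  SmoothPer.of_left (by fun_prop)

theorem smoothPer_cos_mul (m : ℤ) : SmoothPer (fun _ θ => cos (m * θ)) :=
  ⟨by fun_prop, fun _ θ => by rw [mul_add, Real.cos_add_int_mul_two_pi]⟩

theorem smoothPer_sin_mul (m : ℤ) : SmoothPer (fun _ θ => sin (m * θ)) :=
  ⟨by fun_prop, fun _ θ => by rw [mul_add, Real.sin_add_int_mul_two_pi]⟩

protected theorem SmoothPer.rotRe (m : ℤ) (hx : SmoothPer x) (hy : SmoothPer y) :
    SmoothPer (rotRe m x y) :=
  (smoothPer_exp_mul m).mul (((smoothPer_cos_mul m).mul hx).sub ((smoothPer_sin_mul m).mul hy))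

protected theorem SmoothPer.rotIm (m : ℤ) (hx : SmoothPer x) (hy : SmoothPer y) :
    SmoothPer (rotIm m x y) :=
  (smoothPer_exp_mul m).mul (((smoothPer_sin_mul m).mul hx).add ((smoothPer_cos_mul m).mul hy))

theorem hasDerivAt_exp_mul (m : ℤ) (t : ℝ) :
    HasDerivAt (fun t : ℝ => exp (m * t)) (m * exp (m * t)) t := by
  have := ((hasDerivAt_id t).const_mul (m : ℝ)).exp
  simpa [mul_comm] using this

theorem hasDerivAt_cos_mul (m : ℤ) (t : ℝ) :
    HasDerivAt (fun t : ℝ => cos (m * t)) (-(m * sin (m * t))) t := by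
  have := ((hasDerivAt_id t).const_mul (m : ℝ)).cos
  simpa [mul_comm] using this

theorem hasDerivAt_sin_mul (m : ℤ) (t : ℝ) :
    HasDerivAt (fun t : ℝ => sin (m * t)) (m * cos (m * t)) t := by
  have := ((hasDerivAt_id t).const_mul (m : ℝ)).sin
  simpa [mul_comm] using this

theorem pt_rotRe (hx : SmoothPer x) (hy : SmoothPer y) (t θ : ℝ) :
    pt (rotRe m x y) t θ = m * rotRe m x y t θ + rotRe m (pt x) (pt y) t θ := by
  refine HasDerivAt.deriv (((hasDerivAt_exp_mul m t).mul
    (((hx.hasDerivAt_pt t θ).const_mul _).sub ((hy.hasDerivAt_pt t θ).const_mul _))).congr_deriv ?_)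
  simp only [rotRe, Pi.sub_apply]
  ring

theorem pt_rotIm (hx : SmoothPer x) (hy : SmoothPer y) (t θ : ℝ) :
    pt (rotIm m x y) t θ = m * rotIm m x y t θ + rotIm m (pt x) (pt y) t θ := by
  refine HasDerivAt.deriv (((hasDerivAt_exp_mul m t).mul
    (((hx.hasDerivAt_pt t θ).const_mul _).add ((hy.hasDerivAt_pt t θ).const_mul _))).congr_deriv ?_)
  simp only [rotIm, Pi.add_apply]
  ring

theorem pth_rotRe (hx : SmoothPer x) (hy : SmoothPer y) (t θ : ℝ) :
    pth (rotRe m x y) t θ = -(m * rotIm m x y t θ) + rotRe m (pth x) (pth y) t θ := by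
  refine HasDerivAt.deriv (((((hasDerivAt_cos_mul m θ).mul (hx.hasDerivAt_pth t θ)).sub
    ((hasDerivAt_sin_mul m θ).mul (hy.hasDerivAt_pth t θ))).const_mul _).congr_deriv ?_)
  simp only [rotRe, rotIm]
  ring

theorem pth_rotIm (hx : SmoothPer x) (hy : SmoothPer y) (t θ : ℝ) :
    pth (rotIm m x y) t θ = m * rotRe m x y t θ + rotIm m (pth x) (pth y) t θ := by
  refine HasDerivAt.deriv (((((hasDerivAt_sin_mul m θ).mul (hx.hasDerivAt_pth t θ)).add
    ((hasDerivAt_cos_mul m θ).mul (hy.hasDerivAt_pth t θ))).const_mul _).congr_deriv ?_)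
  simp only [rotRe, rotIm]
  ring

theorem rotRe_sq_add_rotIm_sq (m : ℤ) (x y : ℝ → ℝ → ℝ) (t θ : ℝ) :
    rotRe m x y t θ ^ 2 + rotIm m x y t θ ^ 2 = exp (m * t) ^ 2 * (x t θ ^ 2 + y t θ ^ 2) := by
  unfold rotRe rotIm
  linear_combination exp (m * t) ^ 2 * (x t θ ^ 2 + y t θ ^ 2) * sin_sq_add_cos_sq (m * θ)

/-- The real part of `∂̄ (e^{mz} (x + iy))`. -/
theorem pt_rotRe_sub_pth_rotIm (hx : SmoothPer x) (hy : SmoothPer y) (t θ : ℝ) :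
    pt (rotRe m x y) t θ - pth (rotIm m x y) t θ =
      rotRe m (fun t θ => pt x t θ - pth y t θ) (fun t θ => pt y t θ + pth x t θ) t θ := by
  rw [pt_rotRe hx hy, pth_rotIm hx hy]
  simp only [rotRe, rotIm]
  ring

/-- The imaginary part of `∂̄ (e^{mz} (x + iy))`. -/
theorem pt_rotIm_add_pth_rotRe (hx : SmoothPer x) (hy : SmoothPer y) (t θ : ℝ) :
    pt (rotIm m x y) t θ + pth (rotRe m x y) t θ =
      rotIm m (fun t θ => pt x t θ - pth y t θ) (fun t θ => pt y t θ + pth x t θ) t θ := by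
  rw [pt_rotIm hx hy, pth_rotRe hx hy]
  simp only [rotRe, rotIm]
  ring

theorem dbarSq_rot (hx : SmoothPer x) (hy : SmoothPer y) (t θ : ℝ) :
    dbarSq (rotRe m x y) (rotIm m x y) t θ = exp (m * t) ^ 2 * dbarSq x y t θ := by
  unfold dbarSq
  rw [pt_rotRe_sub_pth_rotIm hx hy, pt_rotIm_add_pth_rotRe hx hy]
  exact rotRe_sq_add_rotIm_sq m _ _ t θ

/-- Inverting the multiplication by `e^{mz}`. -/
theorem rot_inv_re (m : ℤ) (x y : ℝ → ℝ → ℝ) (t θ : ℝ) :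
    x t θ = exp (m * t) * (cos (m * θ) * rotRe (-m) x y t θ - sin (m * θ) * rotIm (-m) x y t θ) := by
  unfold rotRe rotIm
  have h : exp (m * t) * exp (((-m : ℤ) : ℝ) * t) = 1 := by
    rw [← Real.exp_add]; simp
  push_cast at h ⊢
  simp only [neg_mul, Real.cos_neg, Real.sin_neg] at h ⊢
  linear_combination (-x t θ) * h - exp (m * t) * exp (-(m * t)) * x t θ *
    sin_sq_add_cos_sq (m * θ)

theorem rot_inv_im (m : ℤ) (x y : ℝ → ℝ → ℝ) (t θ : ℝ) :
    y t θ = exp (m * t) * (sin (m * θ) * rotRe (-m) x y t θ + cos (m * θ) * rotIm (-m) x y t θ) := by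
  unfold rotRe rotIm
  have h : exp (m * t) * exp (((-m : ℤ) : ℝ) * t) = 1 := by
    rw [← Real.exp_add]; simp
  push_cast at h ⊢
  simp only [neg_mul, Real.cos_neg, Real.sin_neg] at h ⊢
  linear_combination (-y t θ) * h - exp (m * t) * exp (-(m * t)) * y t θ *
    sin_sq_add_cos_sq (m * θ)

end Rotation

section Data

/-- The scalar quantities attached to a conformal Willmore cylinder: `a = ∂_t f`, `b = ∂_θ f`, the
mean curvature `H` and the lower-order part `(Wt, Wθ)` of the conserved Willmore current, together
with an exponential rate `m` and uniform bounds by `K`. -/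
structure GapData (n : ℕ) (K : ℝ) where
  m : ℤ
  a : Fin n → ℝ → ℝ → ℝ
  b : Fin n → ℝ → ℝ → ℝ
  H : Fin n → ℝ → ℝ → ℝ
  Wt : Fin n → ℝ → ℝ → ℝ
  Wθ : Fin n → ℝ → ℝ → ℝ
  u : ℝ → ℝ → ℝ
  γ : ℝ → ℝ
  one_le_K : 1 ≤ K
  smooth_a : ∀ j, SmoothPer (a j)
  smooth_b : ∀ j, SmoothPer (b j)
  smooth_H : ∀ j, SmoothPer (H j)
  smooth_Wt : ∀ j, SmoothPer (Wt j)
  smooth_Wθ : ∀ j, SmoothPer (Wθ j)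
  smooth_u : SmoothPer u
  smooth_γ : ContDiff ℝ ∞ γ
  abs_m_le : |(m : ℝ)| ≤ K
  abs_pt_u_le : ∀ t θ, |pt u t θ| ≤ K
  abs_pth_u_le : ∀ t θ, |pth u t θ| ≤ K
  deriv_γ : ∀ t, |deriv γ t - m| ≤ 1 / (8 * π)
  exp_u_le : ∀ t θ, exp (u t θ) ≤ K * exp (γ t)
  exp_γ_le : ∀ t θ, exp (γ t) ≤ K * exp (u t θ)
  pt_a : ∀ j t θ, pt (a j) t θ + pth (b j) t θ = exp (2 * u t θ) * H j t θ
  pt_b : ∀ j t θ, pt (b j) t θ = pth (a j) t θ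
  sum_a_sq : ∀ t θ, ∑ j, a j t θ ^ 2 = exp (2 * u t θ)
  sum_b_sq : ∀ t θ, ∑ j, b j t θ ^ 2 = exp (2 * u t θ)
  sum_ab : ∀ t θ, ∑ j, a j t θ * b j t θ = 0
  sum_Ha : ∀ t θ, ∑ j, H j t θ * a j t θ = 0
  sum_Hb : ∀ t θ, ∑ j, H j t θ * b j t θ = 0
  circInt_b : ∀ j t, circInt (b j) t = 0
  div_eq : ∀ j t θ, 2 * pt (pt (H j)) t θ + pt (Wt j) t θ +
    (2 * pth (pth (H j)) t θ + pth (Wθ j) t θ) = 0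
  W_le : ∀ j t θ, Wt j t θ ^ 2 + Wθ j t θ ^ 2 ≤ K * exp (-(2 * u t θ)) *
    ((∑ l, H l t θ * pt (a l) t θ) ^ 2 + (∑ l, H l t θ * pth (a l) t θ) ^ 2 +
      (∑ l, H l t θ * pth (b l) t θ) ^ 2)
  W_antisymm : ∀ i j t θ, Wt i t θ * a j t θ + Wθ i t θ * b j t θ =
    Wt j t θ * a i t θ + Wθ j t θ * b i t θ
  integrable_H : ∀ j, CylIntegrable (fun t θ => exp (2 * γ t) * H j t θ ^ 2)

namespace GapData

variable {K : ℝ} (d : GapData n K)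

/-- Real part of `F = e^{-mz} (∂_t f - i ∂_θ f)`. -/
def P (j : Fin n) : ℝ → ℝ → ℝ := rotRe (-d.m) (d.a j) (fun t θ => -d.b j t θ)

/-- Imaginary part of `F = e^{-mz} (∂_t f - i ∂_θ f)`. -/
def Q (j : Fin n) : ℝ → ℝ → ℝ := rotIm (-d.m) (d.a j) (fun t θ => -d.b j t θ)

/-- The squared weighted norm of the mean curvature. -/
def hSq : ℝ := ∑ j, cylIntegral (fun t θ => exp (2 * d.γ t) * d.H j t θ ^ 2)

/-- The weight `e^{-2(γ - mt)}`. -/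
def wF (t : ℝ) : ℝ := exp (-(2 * (d.γ t - d.m * t)))

/-- The weight `e^{2(γ - mt)}`. -/
def wY (t : ℝ) : ℝ := exp (2 * (d.γ t - d.m * t))

theorem smooth_P (j : Fin n) : SmoothPer (d.P j) :=
  (d.smooth_a j).rotRe _ (d.smooth_b j).neg

theorem smooth_Q (j : Fin n) : SmoothPer (d.Q j) :=
  (d.smooth_a j).rotIm _ (d.smooth_b j).neg

theorem contDiff_wF : ContDiff ℝ ∞ d.wF := by
  have := d.smooth_γ
  unfold wF
  fun_prop

theorem contDiff_wY : ContDiff ℝ ∞ d.wY := by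
  have := d.smooth_γ
  unfold wY
  fun_prop

theorem hasDerivAt_γ (t : ℝ) : HasDerivAt d.γ (deriv d.γ t) t :=
  (d.smooth_γ.differentiable (by simp) t).hasDerivAt

theorem wF_pos (t : ℝ) : 0 < d.wF t := Real.exp_pos _

theorem wY_pos (t : ℝ) : 0 < d.wY t := Real.exp_pos _

theorem K_pos (d : GapData n K) : 0 < K := by linarith [d.one_le_K]

theorem wF_mul_wY (t : ℝ) : d.wF t * d.wY t = 1 := by
  unfold wF wY
  rw [← Real.exp_add]
  simp

theorem wF_mul_exp (t : ℝ) : d.wF t * exp (((-d.m : ℤ) : ℝ) * t) ^ 2 = exp (-(2 * d.γ t)) := by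
  unfold wF
  rw [← Real.exp_nat_mul, ← Real.exp_add]
  push_cast
  ring_nf

theorem wY_mul_exp (t : ℝ) : d.wY t * exp (d.m * t) ^ 2 = exp (2 * d.γ t) := by
  unfold wY
  rw [← Real.exp_nat_mul, ← Real.exp_add]
  push_cast
  ring_nf

theorem deriv_wF (t : ℝ) : deriv d.wF t = -(2 * (deriv d.γ t - d.m)) * d.wF t := by
  have h := ((((d.hasDerivAt_γ t).sub ((hasDerivAt_id t).const_mul (d.m : ℝ))).const_mul
    (2 : ℝ)).neg).exp
  refine (h.congr_deriv ?_).deriv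
  simp [wF]
  ring

theorem deriv_wY (t : ℝ) : deriv d.wY t = 2 * (deriv d.γ t - d.m) * d.wY t := by
  have h := ((((d.hasDerivAt_γ t).sub ((hasDerivAt_id t).const_mul (d.m : ℝ))).const_mul
    (2 : ℝ))).exp
  refine (h.congr_deriv ?_).deriv
  simp [wY]
  ring

theorem abs_deriv_wF_le (t : ℝ) : |deriv d.wF t| ≤ d.wF t / (4 * π) := by
  rw [deriv_wF, abs_mul, abs_of_pos (d.wF_pos t), abs_neg, abs_mul, abs_two]
  have := mul_le_mul_of_nonneg_right (d.deriv_γ t) (d.wF_pos t).le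
  have e : d.wF t / (4 * π) = 2 * (1 / (8 * π) * d.wF t) := by field_simp; ring
  rw [e]
  linarith

theorem abs_deriv_wY_le (t : ℝ) : |deriv d.wY t| ≤ d.wY t / (4 * π) := by
  rw [deriv_wY, abs_mul, abs_of_pos (d.wY_pos t), abs_mul, abs_two]
  have := mul_le_mul_of_nonneg_right (d.deriv_γ t) (d.wY_pos t).le
  have e : d.wY t / (4 * π) = 2 * (1 / (8 * π) * d.wY t) := by field_simp; ring
  rw [e]
  linarith

theorem one_div_eight_pi_le : 1 / (8 * π) ≤ 1 / 24 := by
  have := Real.pi_gt_three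
  gcongr
  linarith

theorem abs_deriv_γ_le (t : ℝ) : |deriv d.γ t| ≤ 2 * K := by
  have h1 := d.deriv_γ t
  have h2 := d.abs_m_le
  have h3 := one_div_eight_pi_le
  have h4 := d.one_le_K
  rw [abs_le] at *
  constructor <;> linarith [h1.1, h1.2, h2.1, h2.2]

/-- `e^{4u - 2γ} ≤ K⁴ e^{2γ}`. -/
theorem exp_four_u_le (t θ : ℝ) :
    exp (-(2 * d.γ t)) * exp (2 * d.u t θ) ^ 2 ≤ K ^ 4 * exp (2 * d.γ t) := by
  have h := pow_le_pow_left₀ (Real.exp_pos _).le (d.exp_u_le t θ) 4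
  have e1 : exp (2 * d.u t θ) ^ 2 = exp (d.u t θ) ^ 4 := by
    rw [← Real.exp_nat_mul, ← Real.exp_nat_mul]; congr 1; push_cast; ring
  have e2 : exp (-(2 * d.γ t)) * exp (d.γ t) ^ 4 = exp (2 * d.γ t) := by
    rw [← Real.exp_nat_mul, ← Real.exp_add]; congr 1; push_cast; ring
  rw [e1, ← e2]
  calc _ ≤ exp (-(2 * d.γ t)) * (K * exp (d.γ t)) ^ 4 := by gcongr
    _ = _ := by ring

theorem exp_two_u_le (t θ : ℝ) : exp (2 * d.u t θ) ≤ K ^ 2 * exp (2 * d.γ t) := by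
  have h := pow_le_pow_left₀ (Real.exp_pos _).le (d.exp_u_le t θ) 2
  have e1 : exp (2 * d.u t θ) = exp (d.u t θ) ^ 2 := by
    rw [← Real.exp_nat_mul]; push_cast; ring_nf
  have e2 : exp (2 * d.γ t) = exp (d.γ t) ^ 2 := by
    rw [← Real.exp_nat_mul]; push_cast; ring_nf
  rw [e1, e2, ← mul_pow]
  exact h

theorem exp_two_γ_le (t θ : ℝ) : exp (2 * d.γ t) ≤ K ^ 2 * exp (2 * d.u t θ) := by
  have h := pow_le_pow_left₀ (Real.exp_pos _).le (d.exp_γ_le t θ) 2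
  have e1 : exp (2 * d.u t θ) = exp (d.u t θ) ^ 2 := by
    rw [← Real.exp_nat_mul]; push_cast; ring_nf
  have e2 : exp (2 * d.γ t) = exp (d.γ t) ^ 2 := by
    rw [← Real.exp_nat_mul]; push_cast; ring_nf
  rw [e1, e2, ← mul_pow]
  exact h

theorem a_sq_le (j : Fin n) (t θ : ℝ) : d.a j t θ ^ 2 ≤ exp (2 * d.u t θ) := by
  rw [← d.sum_a_sq]
  exact Finset.single_le_sum (f := fun j => d.a j t θ ^ 2) (fun i _ => sq_nonneg _)
    (Finset.mem_univ j)

theorem b_sq_le (j : Fin n) (t θ : ℝ) : d.b j t θ ^ 2 ≤ exp (2 * d.u t θ) := by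
  rw [← d.sum_b_sq]
  exact Finset.single_le_sum (f := fun j => d.b j t θ ^ 2) (fun i _ => sq_nonneg _)
    (Finset.mem_univ j)

/-- `|F_j|²` is bounded by `e^{2(γ - mt)}`. -/
theorem wF_mul_PQ_le (j : Fin n) (t θ : ℝ) :
    d.wF t * (d.P j t θ ^ 2 + d.Q j t θ ^ 2) ≤ 2 * K ^ 2 := by
  unfold P Q
  rw [rotRe_sq_add_rotIm_sq, ← mul_assoc, wF_mul_exp]
  have h1 := d.a_sq_le j t θ
  have h2 := d.b_sq_le j t θ
  have h3 := d.exp_two_u_le t θ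
  have e : exp (-(2 * d.γ t)) * exp (2 * d.γ t) = 1 := by rw [← Real.exp_add]; simp
  calc _ ≤ exp (-(2 * d.γ t)) * (2 * (K ^ 2 * exp (2 * d.γ t))) := by
        gcongr
        linarith [neg_sq (d.b j t θ)]
    _ = 2 * K ^ 2 * (exp (-(2 * d.γ t)) * exp (2 * d.γ t)) := by ring
    _ = _ := by rw [e, mul_one]

theorem dbar_ab (j : Fin n) (t θ : ℝ) :
    pt (d.a j) t θ - pth (fun t θ => -d.b j t θ) t θ = exp (2 * d.u t θ) * d.H j t θ ∧
      pt (fun t θ => -d.b j t θ) t θ + pth (d.a j) t θ = 0 := by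
  have e1 : pth (fun t θ => -d.b j t θ) t θ = -pth (d.b j) t θ :=
    ((d.smooth_b j).hasDerivAt_pth t θ).neg.deriv
  have e2 : pt (fun t θ => -d.b j t θ) t θ = -pt (d.b j) t θ :=
    ((d.smooth_b j).hasDerivAt_pt t θ).neg.deriv
  rw [e1, e2, ← d.pt_a, d.pt_b]
  constructor <;> ring

/-- The real part of `∂̄F = e^{-mz} e^{2u} H`. -/
theorem dbar_re (j : Fin n) (t θ : ℝ) : pt (d.P j) t θ - pth (d.Q j) t θ =
    rotRe (-d.m) (fun t θ => exp (2 * d.u t θ) * d.H j t θ) (fun _ _ => 0) t θ := by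
  unfold P Q
  rw [pt_rotRe_sub_pth_rotIm (d.smooth_a j) (d.smooth_b j).neg]
  simp only [(d.dbar_ab j _ _).1, (d.dbar_ab j _ _).2]

/-- The imaginary part of `∂̄F = e^{-mz} e^{2u} H`. -/
theorem dbar_im (j : Fin n) (t θ : ℝ) : pt (d.Q j) t θ + pth (d.P j) t θ =
    rotIm (-d.m) (fun t θ => exp (2 * d.u t θ) * d.H j t θ) (fun _ _ => 0) t θ := by
  unfold P Q
  rw [pt_rotIm_add_pth_rotRe (d.smooth_a j) (d.smooth_b j).neg]
  simp only [(d.dbar_ab j _ _).1, (d.dbar_ab j _ _).2]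

theorem wF_mul_dbarSq_le (j : Fin n) (t θ : ℝ) : d.wF t * dbarSq (d.P j) (d.Q j) t θ ≤
    K ^ 4 * (exp (2 * d.γ t) * d.H j t θ ^ 2) := by
  unfold dbarSq
  rw [dbar_re, dbar_im, rotRe_sq_add_rotIm_sq, ← mul_assoc, wF_mul_exp]
  have := mul_le_mul_of_nonneg_right (d.exp_four_u_le t θ) (sq_nonneg (d.H j t θ))
  nlinarith

theorem integral_H_nonneg (j : Fin n) :
    0 ≤ cylIntegral (fun t θ => exp (2 * d.γ t) * d.H j t θ ^ 2) :=
  cylIntegral_nonneg fun _ _ => by positivity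

theorem integral_H_le (j : Fin n) :
    cylIntegral (fun t θ => exp (2 * d.γ t) * d.H j t θ ^ 2) ≤ d.hSq :=
  Finset.single_le_sum (f := fun j => cylIntegral (fun t θ => exp (2 * d.γ t) * d.H j t θ ^ 2))
    (fun i _ => d.integral_H_nonneg i) (Finset.mem_univ j)

theorem hSq_nonneg : 0 ≤ d.hSq := Finset.sum_nonneg fun i _ => d.integral_H_nonneg i

theorem smooth_wF : SmoothPer (fun t _ => d.wF t) := SmoothPer.of_left d.contDiff_wF

theorem smooth_wY : SmoothPer (fun t _ => d.wY t) := SmoothPer.of_left d.contDiff_wY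

theorem smooth_expγ : SmoothPer (fun t _ => exp (2 * d.γ t)) :=
  SmoothPer.of_left (by have := d.smooth_γ; fun_prop)

/-- First-order estimate for `F`. -/
theorem gradF_bound (j : Fin n) :
    CylIntegrable (fun t θ => d.wF t * (gradSq (d.P j) t θ + gradSq (d.Q j) t θ)) ∧
    cylIntegral (fun t θ => d.wF t * (gradSq (d.P j) t θ + gradSq (d.Q j) t θ)) ≤
      4 * K ^ 4 * d.hSq := by
  have hK := d.K_pos
  have hs := d.smooth_wF.mul ((d.smooth_P j).dbarSq (d.smooth_Q j))
  have hD : CylIntegrable (fun t θ => d.wF t * dbarSq (d.P j) (d.Q j) t θ) := by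
    refine ((d.integrable_H j).const_mul (K ^ 4)).mono hs.continuous fun t θ => ?_
    rw [abs_of_nonneg (mul_nonneg (d.wF_pos t).le (dbarSq_nonneg _ _))]
    exact d.wF_mul_dbarSq_le j t θ
  have h := cylIntegrable_gradSq_of_dbarSq (d.smooth_P j) (d.smooth_Q j) d.contDiff_wF
    d.abs_deriv_wF_le (fun t => (d.wF_pos t).le) hD (M := 2 * K ^ 2) (R := fun _ _ => 0)
    (by positivity) (integrable_zero _ _ _) (fun _ _ => le_rfl) continuous_const
    (fun t θ => by simpa using d.wF_mul_PQ_le j t θ)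
  refine ⟨h.1, h.2.trans ?_⟩
  have h2 := cylIntegral_mono hD ((d.integrable_H j).const_mul (K ^ 4)) (d.wF_mul_dbarSq_le j)
  rw [cylIntegral_const_mul] at h2
  have h3 := mul_le_mul_of_nonneg_left (d.integral_H_le j) (by positivity : 0 ≤ K ^ 4)
  linarith

theorem m_ne_zero : d.m ≠ 0 := by
  intro hm
  have hQ : ∀ j t θ, d.Q j t θ = -d.b j t θ := by
    intro j t θ
    simp [Q, rotIm, hm]
  have hi : Integrable (∑ j, circInt
      (fun t θ => d.wF t * (gradSq (d.P j) t θ + gradSq (d.Q j) t θ))) :=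
    integrable_finsetSum' _ fun j _ => (d.gradF_bound j).1.integrable_circInt
  have hle : ∀ t, 1 / K ^ 2 ≤ 2 * π * (∑ j, circInt
      (fun t θ => d.wF t * (gradSq (d.P j) t θ + gradSq (d.Q j) t θ))) t := by
    intro t
    have hbj : ∀ j, d.wF t * d.b j t 0 ^ 2 ≤ 2 * π * circInt
        (fun t θ => d.wF t * (gradSq (d.P j) t θ + gradSq (d.Q j) t θ)) t := by
      intro j
      have sb := d.smooth_b j
      have h1 : |d.b j t 0| ≤ circInt (fun t θ => |pth (d.b j) t θ|) t := by
        have c1 := sb.continuous_right t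
        have h0 := norm_circInt_le (fun t θ => d.b j t 0 - d.b j t θ) t
        rw [circInt_sub (by fun_prop) c1, d.circInt_b, sub_zero] at h0
        have h2 : circInt (fun t θ => ‖d.b j t 0 - d.b j t θ‖) t ≤
            circInt (fun _ _ => circInt (fun t θ => |pth (d.b j) t θ|) t) t :=
          circInt_mono (by fun_prop) (by fun_prop) fun x hx =>
            sb.norm_sub_le t ⟨le_rfl, by positivity⟩ hx
        have h3 : circInt (fun t _ => d.b j t 0) t = 2 * π * d.b j t 0 := by simp [circInt]
        rw [circInt_const] at h2
        rw [h3, norm_mul, Real.norm_of_nonneg (by positivity), Real.norm_eq_abs] at h0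
        exact le_of_mul_le_mul_left (h0.trans h2) (by positivity)
      have h2 := circInt_sq_le (φ := fun t θ => |pth (d.b j) t θ|) (sb.pth.continuous_right t).abs
      have h3 : d.b j t 0 ^ 2 ≤ 2 * π * circInt (fun t θ => pth (d.b j) t θ ^ 2) t := by
        simp only [sq_abs] at h2
        rw [← sq_abs]
        exact (pow_le_pow_left₀ (abs_nonneg _) h1 2).trans h2
      have h4 := mul_le_mul_of_nonneg_left h3 (d.wF_pos t).le
      refine h4.trans ?_
      have e : d.wF t * (2 * π * circInt (fun t θ => pth (d.b j) t θ ^ 2) t) =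
          2 * π * circInt (fun t θ => d.wF t * pth (d.b j) t θ ^ 2) t := by
        rw [circInt_mul_left d.wF (fun t θ => pth (d.b j) t θ ^ 2)]
        ring
      rw [e]
      refine mul_le_mul_of_nonneg_left ?_ (by positivity)
      have c2 := (d.smooth_wF.mul
        ((d.smooth_P j).gradSq.add (d.smooth_Q j).gradSq)).continuous_right t
      have c3 := (d.smooth_wF.mul (sb.pth.pow 2)).continuous_right t
      refine circInt_mono c3 c2 fun θ _ => ?_
      refine mul_le_mul_of_nonneg_left ?_ (d.wF_pos t).le
      have e2 : pth (d.Q j) t θ = -pth (d.b j) t θ := by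
        rw [show d.Q j = fun t θ => -d.b j t θ from funext fun t => funext fun θ => hQ j t θ]
        exact (sb.hasDerivAt_pth t θ).neg.deriv
      have := gradSq_nonneg (p := d.P j) t θ
      rw [gradSq, gradSq, e2]
      rw [gradSq] at this
      nlinarith [sq_nonneg (pt (d.Q j) t θ)]
    have hsum := Finset.sum_le_sum fun j (_ : j ∈ Finset.univ) => hbj j
    rw [← Finset.mul_sum, ← Finset.mul_sum, d.sum_b_sq, ← Finset.sum_apply] at hsum
    refine le_trans ?_ hsum
    have h5 := d.exp_two_γ_le t 0
    have h6 : d.wF t * exp (2 * d.γ t) = 1 := by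
      unfold wF
      rw [← Real.exp_add]
      simp [hm]
    have h7 := mul_le_mul_of_nonneg_left h5 (d.wF_pos t).le
    rw [h6] at h7
    have hK := d.K_pos
    rw [div_le_iff₀ (by positivity)]
    linarith
  have hc : Integrable (fun _ : ℝ => 1 / K ^ 2) := by
    refine Integrable.mono' (hi.const_mul (2 * π)) aestronglyMeasurable_const
      (Eventually.of_forall fun t => ?_)
    rw [Real.norm_of_nonneg (by positivity)]
    exact hle t
  have hK := d.K_pos
  rw [integrable_const_iff] at hc
  rcases hc with h3 | h3
  · exact absurd h3 (by positivity)
  · exact absurd h3.measure_univ_lt_top (by simp)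

end GapData

end Data

section Cutoff

/-- Smooth compactly supported cutoff functions on the line with slope bounded by `√B`. -/
structure IsCutoff (B : ℝ) (η : ℝ → ℝ) : Prop where
  smooth : ContDiff ℝ ∞ η
  nonneg : ∀ t, 0 ≤ η t
  le_one : ∀ t, η t ≤ 1
  compact : CompactT (fun t _ => η t)
  deriv_sq_le : ∀ t, deriv η t ^ 2 ≤ B

variable {B : ℝ} {η : ℝ → ℝ} {φ ψ p q : ℝ → ℝ → ℝ}

theorem IsCutoff.nonneg_B (h : IsCutoff B η) : 0 ≤ B := (sq_nonneg _).trans (h.deriv_sq_le 0)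

theorem IsCutoff.smoothPer (h : IsCutoff B η) : SmoothPer (fun t _ => η t) :=
  SmoothPer.of_left h.smooth

theorem IsCutoff.sq_le_one (h : IsCutoff B η) (t : ℝ) : η t ^ 2 ≤ 1 :=
  pow_le_one₀ (h.nonneg t) (h.le_one t)

theorem IsCutoff.differentiable (h : IsCutoff B η) : Differentiable ℝ η :=
  h.smooth.differentiable (by simp)

theorem cylIntegral_add_abs_le {x₁ x₂ y₁ y₂ k : ℝ → ℝ → ℝ} {a b : ℝ}
    (hk : Continuous (fun p : ℝ × ℝ => k p.1 p.2)) (ck : CompactT k)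
    (h1 : CylIntegrable (fun t θ => x₁ t θ * y₁ t θ)) (h2 : CylIntegrable (fun t θ => x₂ t θ * y₂ t θ))
    (hle : ∀ t θ, k t θ = x₁ t θ * y₁ t θ + x₂ t θ * y₂ t θ)
    (ha : cylIntegral (fun t θ => |x₁ t θ * y₁ t θ|) ≤ a)
    (hb : cylIntegral (fun t θ => |x₂ t θ * y₂ t θ|) ≤ b) :
    cylIntegral (fun t θ => |k t θ|) ≤ a + b := by
  refine (cylIntegral_mono (ck.abs.cylIntegrable hk.abs) (h1.abs.add h2.abs) fun t θ => ?_).trans ?_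
  · rw [hle]; exact abs_add_le _ _
  · rw [cylIntegral_add h1.abs h2.abs]; linarith

/-- A product estimate in the critical dimension. -/
theorem cylIntegral_cutoff_mul_sq_le (hη : IsCutoff B η) (hφ : SmoothPer φ) (hψ : SmoothPer ψ)
    {A S : ℝ} (hA : 0 ≤ A) (hS : 0 ≤ S)
    (iφ : CylIntegrable (fun t θ => φ t θ ^ 2)) (bφ : cylIntegral (fun t θ => φ t θ ^ 2) ≤ A ^ 2)
    (iψ : CylIntegrable (fun t θ => ψ t θ ^ 2)) (bψ : cylIntegral (fun t θ => ψ t θ ^ 2) ≤ A ^ 2)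
    (bx : cylIntegral (fun t θ => (η t * φ t θ) ^ 2) ≤ S ^ 2)
    (bxt : cylIntegral (fun t θ => pt (fun t θ => η t * φ t θ) t θ ^ 2) ≤ S ^ 2)
    (bxθ : cylIntegral (fun t θ => pth (fun t θ => η t * φ t θ) t θ ^ 2) ≤ S ^ 2)
    (bψt : cylIntegral (fun t θ => (η t * pt ψ t θ) ^ 2) ≤ S ^ 2)
    (bψθ : cylIntegral (fun t θ => (η t * pth ψ t θ) ^ 2) ≤ S ^ 2) :
    cylIntegral (fun t θ => (η t * φ t θ * ψ t θ) ^ 2) ≤ 6 * A ^ 2 * S ^ 2 := by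
  have hx : SmoothPer (fun t θ => η t * φ t θ) := hη.smoothPer.mul hφ
  have cx : CompactT (fun t θ => η t * φ t θ) := hη.compact.mul_left φ
  have hk : SmoothPer (fun t θ => η t * φ t θ * ψ t θ) := hx.mul hψ
  have ck : CompactT (fun t θ => η t * φ t θ * ψ t θ) := cx.mul_left ψ
  have hψt : SmoothPer (fun t θ => η t * pt ψ t θ) := hη.smoothPer.mul hψ.pt
  have hψθ : SmoothPer (fun t θ => η t * pth ψ t θ) := hη.smoothPer.mul hψ.pth
  have ix := (cx.pow two_ne_zero).cylIntegrable (hx.pow 2).continuous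
  have ixt := (cx.pt.pow two_ne_zero).cylIntegrable (hx.pt.pow 2).continuous
  have ixθ := (cx.pth.pow two_ne_zero).cylIntegrable (hx.pth.pow 2).continuous
  have iψt := ((hη.compact.mul_left (pt ψ)).pow two_ne_zero).cylIntegrable (hψt.pow 2).continuous
  have iψθ := ((hη.compact.mul_left (pth ψ)).pow two_ne_zero).cylIntegrable (hψθ.pow 2).continuous
  have e1 := cylIntegral_abs_mul_le hS hA ix iψ hx.continuous hψ.continuous bx bψ
  have e2 := cylIntegral_add_abs_le hk.pt.continuous ck.pt
    (ixt.mul_of_sq iψ hx.pt.continuous hψ.continuous)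
    (iφ.mul_of_sq iψt hφ.continuous hψt.continuous)
    (fun t θ => by rw [hx.pt_mul hψ]; ring)
    (cylIntegral_abs_mul_le hS hA ixt iψ hx.pt.continuous hψ.continuous bxt bψ)
    (cylIntegral_abs_mul_le hA hS iφ iψt hφ.continuous hψt.continuous bφ bψt)
  have e3 := cylIntegral_add_abs_le hk.pth.continuous ck.pth
    (ixθ.mul_of_sq iψ hx.pth.continuous hψ.continuous)
    (iφ.mul_of_sq iψθ hφ.continuous hψθ.continuous)
    (fun t θ => by rw [hx.pth_mul hψ]; ring)
    (cylIntegral_abs_mul_le hS hA ixθ iψ hx.pth.continuous hψ.continuous bxθ bψ)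
    (cylIntegral_abs_mul_le hA hS iφ iψθ hφ.continuous hψθ.continuous bφ bψθ)
  refine (hk.cylIntegral_sq_le ck).trans ?_
  rw [cylIntegral_add (ck.abs.cylIntegrable hk.continuous.abs)
    (ck.pth.abs.cylIntegrable hk.pth.continuous.abs)]
  calc _ ≤ (S * A + A * S) * (S * A + (S * A + A * S)) := by
        gcongr
        exact add_nonneg (cylIntegral_nonneg fun _ _ => abs_nonneg _)
          (cylIntegral_nonneg fun _ _ => abs_nonneg _)
    _ = _ := by ring

/-- Localised `L²` estimate for the Cauchy–Riemann operator. -/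
theorem cylIntegral_cutoff_gradSq_le (hη : IsCutoff B η) {ρ : ℝ → ℝ} (hp : SmoothPer p)
    (hq : SmoothPer q) (hρ : ContDiff ℝ ∞ ρ) (hρ' : ∀ t, |deriv ρ t| ≤ ρ t / (4 * π))
    (hρ0 : ∀ t, 0 ≤ ρ t) (hi : CylIntegrable (fun t θ => ρ t * (p t θ ^ 2 + q t θ ^ 2))) :
    cylIntegral (fun t θ => η t ^ 2 * (ρ t * (gradSq p t θ + gradSq q t θ))) ≤
      10 * B * cylIntegral (fun t θ => ρ t * (p t θ ^ 2 + q t θ ^ 2)) +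
      8 * cylIntegral (fun t θ => η t ^ 2 * (ρ t * dbarSq p q t θ)) := by
  have sρ : SmoothPer (fun t _ => ρ t) := SmoothPer.of_left hρ
  have sp : SmoothPer (fun t θ => η t * p t θ) := hη.smoothPer.mul hp
  have sq : SmoothPer (fun t θ => η t * q t θ) := hη.smoothPer.mul hq
  have cp : CompactT (fun t θ => η t * p t θ) := hη.compact.mul_left p
  have cq : CompactT (fun t θ => η t * q t θ) := hη.compact.mul_left q
  have cη2 : CompactT (fun t _ => η t ^ 2) := hη.compact.pow two_ne_zero
  have h := cylIntegral_gradSq_le_of_compactT sp sq cp cq hρ hρ'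
  have i1 : CylIntegrable (fun t θ => ρ t * dbarSq (fun t θ => η t * p t θ)
      (fun t θ => η t * q t θ) t θ) :=
    ((cp.dbarSq cq).mul_right (fun t _ => ρ t)).cylIntegrable (sρ.mul (sp.dbarSq sq)).continuous
  have i2 : CylIntegrable (fun t θ => ρ t * (gradSq (fun t θ => η t * p t θ) t θ +
      gradSq (fun t θ => η t * q t θ) t θ)) :=
    ((cp.gradSq.add cq.gradSq).mul_right (fun t _ => ρ t)).cylIntegrable
      (sρ.mul (sp.gradSq.add sq.gradSq)).continuous
  have i3 : CylIntegrable (fun t θ => η t ^ 2 * (ρ t * dbarSq p q t θ)) :=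
    (cη2.mul_left _).cylIntegrable ((hη.smoothPer.pow 2).mul (sρ.mul (hp.dbarSq hq))).continuous
  have i4 : CylIntegrable (fun t θ => η t ^ 2 * (ρ t * (gradSq p t θ + gradSq q t θ))) :=
    (cη2.mul_left _).cylIntegrable
      ((hη.smoothPer.pow 2).mul (sρ.mul (hp.gradSq.add hq.gradSq))).continuous
  have hd := hη.differentiable
  have b1 := cylIntegral_mono i1 ((hi.const_mul (2 * B)).add (i3.const_mul 2)) fun t θ => by
    have hb := hη.deriv_sq_le t
    have h0 := hρ0 t
    unfold dbarSq
    rw [hp.pt_mul_left hd, hq.pt_mul_left hd, hp.pth_mul_left, hq.pth_mul_left]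
    have : (deriv η t * p t θ + η t * pt p t θ - η t * pth q t θ) ^ 2 +
        (deriv η t * q t θ + η t * pt q t θ + η t * pth p t θ) ^ 2 ≤
        2 * B * (p t θ ^ 2 + q t θ ^ 2) + 2 * (η t ^ 2 * ((pt p t θ - pth q t θ) ^ 2 +
          (pt q t θ + pth p t θ) ^ 2)) := by
      nlinarith [sq_nonneg (deriv η t * p t θ - η t * (pt p t θ - pth q t θ)),
        sq_nonneg (deriv η t * q t θ - η t * (pt q t θ + pth p t θ)),
        mul_le_mul_of_nonneg_right hb (add_nonneg (sq_nonneg (p t θ)) (sq_nonneg (q t θ)))]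
    refine (mul_le_mul_of_nonneg_left this h0).trans (le_of_eq (by ring))
  have b2 := cylIntegral_mono i4 ((hi.const_mul (2 * B)).add (i2.const_mul 2)) fun t θ => by
    have hb := hη.deriv_sq_le t
    have h0 := hρ0 t
    unfold gradSq
    rw [hp.pt_mul_left hd, hq.pt_mul_left hd, hp.pth_mul_left, hq.pth_mul_left]
    have : η t ^ 2 * (pt p t θ ^ 2 + pth p t θ ^ 2 + (pt q t θ ^ 2 + pth q t θ ^ 2)) ≤
        2 * B * (p t θ ^ 2 + q t θ ^ 2) +
        2 * ((deriv η t * p t θ + η t * pt p t θ) ^ 2 + (η t * pth p t θ) ^ 2 +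
          ((deriv η t * q t θ + η t * pt q t θ) ^ 2 + (η t * pth q t θ) ^ 2)) := by
      nlinarith [sq_nonneg (2 * deriv η t * p t θ + η t * pt p t θ),
        sq_nonneg (2 * deriv η t * q t θ + η t * pt q t θ),
        sq_nonneg (η t * pth p t θ), sq_nonneg (η t * pth q t θ),
        mul_le_mul_of_nonneg_right hb (add_nonneg (sq_nonneg (p t θ)) (sq_nonneg (q t θ)))]
    refine le_trans (le_of_eq (by ring)) ((mul_le_mul_of_nonneg_left this h0).trans
      (le_of_eq (by ring)))
  rw [cylIntegral_add (hi.const_mul _) (i3.const_mul _), cylIntegral_const_mul,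
    cylIntegral_const_mul] at b1
  rw [cylIntegral_add (hi.const_mul _) (i2.const_mul _), cylIntegral_const_mul,
    cylIntegral_const_mul] at b2
  linarith

end Cutoff

namespace GapData

variable {K B : ℝ} {η : ℝ → ℝ} (d : GapData n K)

/-- The mean curvature weighted by `e^γ`. -/
def wH (j : Fin n) (t θ : ℝ) : ℝ := exp (d.γ t) * d.H j t θ

/-- The localised weighted Dirichlet energy of the mean curvature. -/
def dirichletH (η : ℝ → ℝ) : ℝ :=
  ∑ j, cylIntegral (fun t θ => η t ^ 2 * (exp (2 * d.γ t) * gradSq (d.H j) t θ))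

theorem exp_γ_sq (t : ℝ) : exp (d.γ t) ^ 2 = exp (2 * d.γ t) := by
  rw [← Real.exp_nat_mul]; push_cast; ring_nf

theorem contDiff_exp_γ : ContDiff ℝ ∞ fun t => exp (d.γ t) := by
  have := d.smooth_γ
  fun_prop

theorem smooth_wH (j : Fin n) : SmoothPer (d.wH j) :=
  (SmoothPer.of_left d.contDiff_exp_γ).mul (d.smooth_H j)

theorem wH_sq (j : Fin n) (t θ : ℝ) : d.wH j t θ ^ 2 = exp (2 * d.γ t) * d.H j t θ ^ 2 := by
  rw [wH, mul_pow, exp_γ_sq]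

theorem integrable_wH_sq (j : Fin n) : CylIntegrable (fun t θ => d.wH j t θ ^ 2) := by
  simpa only [wH_sq] using d.integrable_H j

theorem integral_wH_sq_le (j : Fin n) : cylIntegral (fun t θ => d.wH j t θ ^ 2) ≤ d.hSq := by
  simpa only [wH_sq] using d.integral_H_le j

theorem integrable_cutoff (hη : IsCutoff B η) {φ : ℝ → ℝ → ℝ} (hφ : SmoothPer φ) :
    CylIntegrable (fun t θ => η t ^ 2 * φ t θ) :=
  ((hη.compact.pow two_ne_zero).mul_left _).cylIntegrable ((hη.smoothPer.pow 2).mul hφ).continuous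

theorem integral_gradH_le (j : Fin n) :
    cylIntegral (fun t θ => η t ^ 2 * (exp (2 * d.γ t) * gradSq (d.H j) t θ)) ≤ d.dirichletH η :=
  Finset.single_le_sum (f := fun j => cylIntegral
    (fun t θ => η t ^ 2 * (exp (2 * d.γ t) * gradSq (d.H j) t θ)))
    (fun i _ => cylIntegral_nonneg fun t θ => by have := gradSq_nonneg (p := d.H i) t θ; positivity)
    (Finset.mem_univ j)

theorem dirichletH_nonneg : 0 ≤ d.dirichletH η :=
  Finset.sum_nonneg fun i _ => cylIntegral_nonneg fun t θ => by
    have := gradSq_nonneg (p := d.H i) t θ; positivity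

theorem pt_wH (j : Fin n) (t θ : ℝ) :
    pt (d.wH j) t θ = exp (d.γ t) * (deriv d.γ t * d.H j t θ + pt (d.H j) t θ) := by
  have h := (d.hasDerivAt_γ t).exp.mul ((d.smooth_H j).hasDerivAt_pt t θ)
  refine (h.congr_deriv ?_).deriv
  ring

theorem pth_wH (j : Fin n) (t θ : ℝ) : pth (d.wH j) t θ = exp (d.γ t) * pth (d.H j) t θ :=
  (d.smooth_H j).pth_mul_left t θ

theorem deriv_γ_sq_le (t : ℝ) : deriv d.γ t ^ 2 ≤ 4 * K ^ 2 := by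
  have h := d.abs_deriv_γ_le t
  have hK := d.K_pos
  rw [← sq_abs]
  nlinarith [abs_nonneg (deriv d.γ t)]

/-- Bounds for the localised weighted mean curvature. -/
theorem cutoff_wH_bounds (hη : IsCutoff B η) (j : Fin n) :
    cylIntegral (fun t θ => (η t * d.wH j t θ) ^ 2) ≤
      (1 + 4 * B + 16 * K ^ 2) * d.hSq + 2 * d.dirichletH η ∧
    cylIntegral (fun t θ => pt (fun t θ => η t * d.wH j t θ) t θ ^ 2) ≤
      (1 + 4 * B + 16 * K ^ 2) * d.hSq + 2 * d.dirichletH η ∧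
    cylIntegral (fun t θ => pth (fun t θ => η t * d.wH j t θ) t θ ^ 2) ≤
      (1 + 4 * B + 16 * K ^ 2) * d.hSq + 2 * d.dirichletH η := by
  have hx : SmoothPer (fun t θ => η t * d.wH j t θ) := hη.smoothPer.mul (d.smooth_wH j)
  have cx : CompactT (fun t θ => η t * d.wH j t θ) := hη.compact.mul_left _
  have i1 := d.integrable_H j
  have i2 := integrable_cutoff hη (d.smooth_expγ.mul (d.smooth_H j).gradSq)
  have bH := d.integral_H_le j
  have bG := d.integral_gradH_le (η := η) j
  have hc : 0 ≤ 1 + 4 * B + 16 * K ^ 2 := by have := hη.nonneg_B; positivity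
  have key : ∀ φ : ℝ → ℝ → ℝ, SmoothPer φ → CompactT φ →
      (∀ t θ, φ t θ ^ 2 ≤ (1 + 4 * B + 16 * K ^ 2) * (exp (2 * d.γ t) * d.H j t θ ^ 2) +
        2 * (η t ^ 2 * (exp (2 * d.γ t) * gradSq (d.H j) t θ))) →
      cylIntegral (fun t θ => φ t θ ^ 2) ≤
        (1 + 4 * B + 16 * K ^ 2) * d.hSq + 2 * d.dirichletH η := by
    intro φ hφ cφ hle
    refine (cylIntegral_mono ((cφ.pow two_ne_zero).cylIntegrable (hφ.pow 2).continuous)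
      ((i1.const_mul _).add (i2.const_mul _)) hle).trans ?_
    rw [cylIntegral_add (i1.const_mul _) (i2.const_mul _), cylIntegral_const_mul,
      cylIntegral_const_mul]
    gcongr
  have hB := hη.nonneg_B
  refine ⟨key _ hx cx fun t θ => ?_, key _ hx.pt cx.pt fun t θ => ?_,
    key _ hx.pth cx.pth fun t θ => ?_⟩
  · rw [mul_pow, wH_sq]
    have h0 : 0 ≤ exp (2 * d.γ t) * d.H j t θ ^ 2 := by positivity
    have h1 := gradSq_nonneg (p := d.H j) t θ
    have h2 : 0 ≤ 2 * (η t ^ 2 * (exp (2 * d.γ t) * gradSq (d.H j) t θ)) := by positivity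
    have h3 := mul_le_mul_of_nonneg_right (hη.sq_le_one t) h0
    have h4 : 0 ≤ (4 * B + 16 * K ^ 2) * (exp (2 * d.γ t) * d.H j t θ ^ 2) := by positivity
    linarith
  · rw [(d.smooth_wH j).pt_mul_left hη.differentiable, pt_wH, ← exp_γ_sq, wH, gradSq]
    have h1 := hη.deriv_sq_le t
    have h2 := d.deriv_γ_sq_le t
    have h3 := hη.sq_le_one t
    have h4 : η t ^ 2 * deriv d.γ t ^ 2 ≤ 4 * K ^ 2 := by
      nlinarith [sq_nonneg (deriv d.γ t)]
    have h5 : (deriv η t + η t * deriv d.γ t) ^ 2 ≤ 2 * B + 8 * K ^ 2 := by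
      nlinarith [sq_nonneg (deriv η t - η t * deriv d.γ t)]
    have h6 : ((deriv η t + η t * deriv d.γ t) * d.H j t θ + η t * pt (d.H j) t θ) ^ 2 ≤
        (1 + 4 * B + 16 * K ^ 2) * d.H j t θ ^ 2 +
          2 * (η t ^ 2 * (pt (d.H j) t θ ^ 2 + pth (d.H j) t θ ^ 2)) := by
      nlinarith [sq_nonneg ((deriv η t + η t * deriv d.γ t) * d.H j t θ - η t * pt (d.H j) t θ),
        mul_le_mul_of_nonneg_right h5 (sq_nonneg (d.H j t θ)), sq_nonneg (η t * pth (d.H j) t θ),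
        sq_nonneg (d.H j t θ)]
    calc _ = exp (d.γ t) ^ 2 *
          ((deriv η t + η t * deriv d.γ t) * d.H j t θ + η t * pt (d.H j) t θ) ^ 2 := by ring
      _ ≤ _ := mul_le_mul_of_nonneg_left h6 (sq_nonneg _)
      _ = _ := by ring
  · rw [(d.smooth_wH j).pth_mul_left, pth_wH, ← exp_γ_sq, gradSq]
    have h0 : 0 ≤ (1 + 4 * B + 16 * K ^ 2) * (exp (d.γ t) ^ 2 * d.H j t θ ^ 2) := by positivity
    nlinarith [sq_nonneg (η t * (exp (d.γ t) * pt (d.H j) t θ)),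
      sq_nonneg (η t * (exp (d.γ t) * pth (d.H j) t θ))]

theorem rotRe_sq_le (m : ℤ) (x y : ℝ → ℝ → ℝ) (t θ : ℝ) :
    rotRe m x y t θ ^ 2 ≤ exp (m * t) ^ 2 * (x t θ ^ 2 + y t θ ^ 2) := by
  nlinarith [rotRe_sq_add_rotIm_sq m x y t θ, sq_nonneg (rotIm m x y t θ)]

theorem a_eq (j : Fin n) : d.a j = rotRe d.m (d.P j) (d.Q j) :=
  funext fun t => funext fun θ => rot_inv_re d.m (d.a j) (fun t θ => -d.b j t θ) t θ

theorem neg_b_eq (j : Fin n) : (fun t θ => -d.b j t θ) = rotIm d.m (d.P j) (d.Q j) :=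
  funext fun t => funext fun θ => rot_inv_im d.m (d.a j) (fun t θ => -d.b j t θ) t θ

theorem pt_a_eq (j : Fin n) (t θ : ℝ) : pt (d.a j) t θ =
    d.m * d.a j t θ + rotRe d.m (pt (d.P j)) (pt (d.Q j)) t θ := by
  conv_lhs => rw [a_eq]
  rw [pt_rotRe (d.smooth_P j) (d.smooth_Q j), ← a_eq]

theorem pth_a_eq (j : Fin n) (t θ : ℝ) : pth (d.a j) t θ =
    d.m * d.b j t θ + rotRe d.m (pth (d.P j)) (pth (d.Q j)) t θ := by
  conv_lhs => rw [a_eq]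
  rw [pth_rotRe (d.smooth_P j) (d.smooth_Q j), ← neg_b_eq]
  ring

theorem pth_b_eq (j : Fin n) (t θ : ℝ) : pth (d.b j) t θ =
    -(d.m * d.a j t θ) - rotIm d.m (pth (d.P j)) (pth (d.Q j)) t θ := by
  have e1 : pth (fun t θ => -d.b j t θ) t θ = -pth (d.b j) t θ :=
    ((d.smooth_b j).hasDerivAt_pth t θ).neg.deriv
  have e2 := pth_rotIm (m := d.m) (d.smooth_P j) (d.smooth_Q j) t θ
  rw [← neg_b_eq, e1, ← a_eq] at e2
  linarith

/-- Pointwise bound for the lower-order part of the Willmore current. -/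
theorem W_le_grad (j : Fin n) (t θ : ℝ) :
    exp (2 * d.γ t) * (d.Wt j t θ ^ 2 + d.Wθ j t θ ^ 2) ≤ n * K ^ 3 * ∑ k,
      d.wH k t θ ^ 2 * (d.wF t * (gradSq (d.P k) t θ + gradSq (d.Q k) t θ)) := by
  have hK := d.K_pos
  have s1 : ∑ l, d.H l t θ * pt (d.a l) t θ =
      ∑ l, d.H l t θ * rotRe d.m (pt (d.P l)) (pt (d.Q l)) t θ := by
    have : ∑ l, d.H l t θ * pt (d.a l) t θ = d.m * ∑ l, d.H l t θ * d.a l t θ +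
        ∑ l, d.H l t θ * rotRe d.m (pt (d.P l)) (pt (d.Q l)) t θ := by
      rw [Finset.mul_sum, ← Finset.sum_add_distrib]
      exact Finset.sum_congr rfl fun l _ => by rw [pt_a_eq]; ring
    rw [this, d.sum_Ha, mul_zero, zero_add]
  have s2 : ∑ l, d.H l t θ * pth (d.a l) t θ =
      ∑ l, d.H l t θ * rotRe d.m (pth (d.P l)) (pth (d.Q l)) t θ := by
    have : ∑ l, d.H l t θ * pth (d.a l) t θ = d.m * ∑ l, d.H l t θ * d.b l t θ +
        ∑ l, d.H l t θ * rotRe d.m (pth (d.P l)) (pth (d.Q l)) t θ := by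
      rw [Finset.mul_sum, ← Finset.sum_add_distrib]
      exact Finset.sum_congr rfl fun l _ => by rw [pth_a_eq]; ring
    rw [this, d.sum_Hb, mul_zero, zero_add]
  have s3 : ∑ l, d.H l t θ * pth (d.b l) t θ =
      -∑ l, d.H l t θ * rotIm d.m (pth (d.P l)) (pth (d.Q l)) t θ := by
    have : ∑ l, d.H l t θ * pth (d.b l) t θ = -(d.m * ∑ l, d.H l t θ * d.a l t θ) -
        ∑ l, d.H l t θ * rotIm d.m (pth (d.P l)) (pth (d.Q l)) t θ := by
      rw [Finset.mul_sum, ← Finset.sum_neg_distrib, ← Finset.sum_sub_distrib]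
      exact Finset.sum_congr rfl fun l _ => by rw [pth_b_eq]; ring
    rw [this, d.sum_Ha, mul_zero, neg_zero, zero_sub]
  have cs : ∀ r : Fin n → ℝ, (∑ l, d.H l t θ * r l) ^ 2 ≤ n * ∑ l, (d.H l t θ * r l) ^ 2 := by
    intro r
    simpa using sq_sum_le_card_mul_sum_sq (s := Finset.univ) (f := fun l => d.H l t θ * r l)
  have hsum : (∑ l, d.H l t θ * pt (d.a l) t θ) ^ 2 + (∑ l, d.H l t θ * pth (d.a l) t θ) ^ 2 +
      (∑ l, d.H l t θ * pth (d.b l) t θ) ^ 2 ≤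
      n * ∑ l, d.H l t θ ^ 2 * (exp (d.m * t) ^ 2 * (gradSq (d.P l) t θ + gradSq (d.Q l) t θ)) := by
    rw [s1, s2, s3, neg_sq]
    refine (add_le_add (add_le_add (cs _) (cs _)) (cs _)).trans ?_
    rw [← mul_add, ← mul_add, ← Finset.sum_add_distrib, ← Finset.sum_add_distrib]
    refine mul_le_mul_of_nonneg_left (Finset.sum_le_sum fun l _ => ?_) (Nat.cast_nonneg n)
    have r1 := rotRe_sq_le d.m (pt (d.P l)) (pt (d.Q l)) t θ
    have r2 := rotRe_sq_add_rotIm_sq d.m (pth (d.P l)) (pth (d.Q l)) t θ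
    rw [mul_pow, mul_pow, mul_pow, ← mul_add, ← mul_add]
    refine mul_le_mul_of_nonneg_left ?_ (sq_nonneg _)
    unfold gradSq
    linarith
  have hu : exp (-(2 * d.u t θ)) ≤ K ^ 2 * exp (-(2 * d.γ t)) := by
    have := d.exp_two_γ_le t θ
    rw [Real.exp_neg, Real.exp_neg, ← div_eq_mul_inv, inv_eq_one_div, div_le_div_iff₀
      (Real.exp_pos _) (Real.exp_pos _)]
    linarith
  have hww : exp (d.m * t) ^ 2 = exp (2 * d.γ t) * d.wF t := by
    rw [← wY_mul_exp]
    linear_combination (-(exp (d.m * t)) ^ 2) * d.wF_mul_wY t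
  have he : exp (2 * d.γ t) * exp (-(2 * d.γ t)) = 1 := by rw [← Real.exp_add]; simp
  have hS : 0 ≤ ∑ l, d.H l t θ ^ 2 *
      (exp (d.m * t) ^ 2 * (gradSq (d.P l) t θ + gradSq (d.Q l) t θ)) :=
    Finset.sum_nonneg fun l _ => by
      have h1 := gradSq_nonneg (p := d.P l) t θ
      have h2 := gradSq_nonneg (p := d.Q l) t θ
      positivity
  calc _ ≤ exp (2 * d.γ t) * (K * (K ^ 2 * exp (-(2 * d.γ t))) *
        (n * ∑ l, d.H l t θ ^ 2 *
          (exp (d.m * t) ^ 2 * (gradSq (d.P l) t θ + gradSq (d.Q l) t θ)))) := by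
        refine mul_le_mul_of_nonneg_left ((d.W_le j t θ).trans ?_) (Real.exp_pos _).le
        gcongr
    _ = n * K ^ 3 * ((exp (2 * d.γ t) * exp (-(2 * d.γ t))) * ∑ l, d.H l t θ ^ 2 *
          (exp (d.m * t) ^ 2 * (gradSq (d.P l) t θ + gradSq (d.Q l) t θ))) := by ring
    _ = _ := by
      rw [he, one_mul, hww]
      congr 1
      refine Finset.sum_congr rfl fun l _ => ?_
      rw [wH_sq]
      ring

end GapData

namespace GapData

variable {K B : ℝ} {η : ℝ → ℝ} (d : GapData n K)

/-- Caccioppoli inequality for the Willmore equation. -/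
theorem caccioppoli_H (hη : IsCutoff B η) (j : Fin n) :
    cylIntegral (fun t θ => η t ^ 2 * (exp (2 * d.γ t) * gradSq (d.H j) t θ)) ≤
      3 / 2 * cylIntegral (fun t θ => η t ^ 2 *
        (exp (2 * d.γ t) * (d.Wt j t θ ^ 2 + d.Wθ j t θ ^ 2))) +
      9 * (2 * B + 8 * K ^ 2) * d.hSq := by
  have sH := d.smooth_H j
  have sW := d.smooth_Wt j
  have sW' := d.smooth_Wθ j
  have sV : SmoothPer (fun t θ => 2 * pt (d.H j) t θ + d.Wt j t θ) :=
    ((SmoothPer.const 2).mul sH.pt).add sW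
  have sV' : SmoothPer (fun t θ => 2 * pth (d.H j) t θ + d.Wθ j t θ) :=
    ((SmoothPer.const 2).mul sH.pth).add sW'
  have sζ : SmoothPer (fun t _ => η t ^ 2 * exp (2 * d.γ t)) := (hη.smoothPer.pow 2).mul d.smooth_expγ
  have cζ : CompactT (fun t _ => η t ^ 2 * exp (2 * d.γ t)) :=
    (hη.compact.pow two_ne_zero).mul_left (fun t _ => exp (2 * d.γ t))
  have s1 := sζ.mul (sH.mul sV)
  have s2 := sζ.mul (sH.mul sV')
  have c1 := cζ.mul_left (fun t θ => d.H j t θ * (2 * pt (d.H j) t θ + d.Wt j t θ))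
  have c2 := cζ.mul_left (fun t θ => d.H j t θ * (2 * pth (d.H j) t θ + d.Wθ j t θ))
  have i1 := c1.pt.cylIntegrable s1.pt.continuous
  have i2 := c2.pth.cylIntegrable s2.pth.continuous
  have iG := integrable_cutoff hη (d.smooth_expγ.mul sH.gradSq)
  have iW := integrable_cutoff hη (d.smooth_expγ.mul ((sW.pow 2).add (sW'.pow 2)))
  have iH := d.integrable_H j
  have hζ : ∀ t, HasDerivAt (fun t => η t ^ 2 * exp (2 * d.γ t))
      (2 * η t * (deriv η t + η t * deriv d.γ t) * exp (2 * d.γ t)) t := fun t => by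
    have := (((hη.differentiable t).hasDerivAt).pow 2).mul (((d.hasDerivAt_γ t).const_mul 2).exp)
    refine this.congr_deriv ?_
    simp
    ring
  have key := cylIntegral_mono iG ((i1.add i2).add ((iW.const_mul (3 / 2)).add
      (iH.const_mul (9 * (2 * B + 8 * K ^ 2))))) fun t θ => by
    have e1 : pt (fun t θ => η t ^ 2 * exp (2 * d.γ t) *
        (d.H j t θ * (2 * pt (d.H j) t θ + d.Wt j t θ))) t θ =
        2 * η t * (deriv η t + η t * deriv d.γ t) * exp (2 * d.γ t) *
          (d.H j t θ * (2 * pt (d.H j) t θ + d.Wt j t θ)) + η t ^ 2 * exp (2 * d.γ t) *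
          (pt (d.H j) t θ * (2 * pt (d.H j) t θ + d.Wt j t θ) + d.H j t θ *
            (2 * pt (pt (d.H j)) t θ + pt (d.Wt j) t θ)) :=
      ((hζ t).mul ((sH.hasDerivAt_pt t θ).mul (((sH.pt.hasDerivAt_pt t θ).const_mul 2).add
        (sW.hasDerivAt_pt t θ)))).deriv
    have e2 : pth (fun t θ => η t ^ 2 * exp (2 * d.γ t) *
        (d.H j t θ * (2 * pth (d.H j) t θ + d.Wθ j t θ))) t θ =
        η t ^ 2 * exp (2 * d.γ t) *
          (pth (d.H j) t θ * (2 * pth (d.H j) t θ + d.Wθ j t θ) + d.H j t θ *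
            (2 * pth (pth (d.H j)) t θ + pth (d.Wθ j) t θ)) :=
      (((sH.hasDerivAt_pth t θ).mul (((sH.pth.hasDerivAt_pth t θ).const_mul 2).add
        (sW'.hasDerivAt_pth t θ))).const_mul _).deriv
    rw [e1, e2]
    have hdiv := d.div_eq j t θ
    have h1 := hη.deriv_sq_le t
    have h2 := d.deriv_γ_sq_le t
    have h3 := hη.sq_le_one t
    have h4 : η t ^ 2 * deriv d.γ t ^ 2 ≤ 4 * K ^ 2 := by
      nlinarith [sq_nonneg (deriv d.γ t)]
    have h5 : (deriv η t + η t * deriv d.γ t) ^ 2 ≤ 2 * B + 8 * K ^ 2 := by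
      nlinarith [sq_nonneg (deriv η t - η t * deriv d.γ t)]
    unfold gradSq
    generalize d.H j t θ = H at *
    generalize pt (d.H j) t θ = Ht at *
    generalize pth (d.H j) t θ = Hθ at *
    generalize d.Wt j t θ = W at *
    generalize d.Wθ j t θ = W' at *
    generalize deriv η t + η t * deriv d.γ t = k at *
    generalize η t = e at *
    have h6 := mul_le_mul_of_nonneg_right h5 (sq_nonneg H)
    have h7 : e ^ 2 * (Ht ^ 2 + Hθ ^ 2) ≤ 2 * e * k * (H * (2 * Ht + W)) +
        e ^ 2 * (Ht * (2 * Ht + W) + Hθ * (2 * Hθ + W')) +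
        3 / 2 * (e ^ 2 * (W ^ 2 + W' ^ 2)) + 9 * (2 * B + 8 * K ^ 2) * H ^ 2 := by
      nlinarith [sq_nonneg (e * Ht + 4 * (k * H)), sq_nonneg (e * W + k * H),
        sq_nonneg (e * Ht + e * W), sq_nonneg (e * Hθ + e * W'), sq_nonneg (e * W'),
        sq_nonneg (e * Hθ)]
    have h8 := mul_le_mul_of_nonneg_left h7 (Real.exp_pos (2 * d.γ t)).le
    linear_combination h8 - e ^ 2 * exp (2 * d.γ t) * H * hdiv
  rw [cylIntegral_add (i1.add i2) ((iW.const_mul _).add (iH.const_mul _)),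
    cylIntegral_add (iW.const_mul _) (iH.const_mul _), cylIntegral_add i1 i2,
    s1.cylIntegral_pt c1, s2.cylIntegral_pth c2, cylIntegral_const_mul,
    cylIntegral_const_mul] at key
  have hB := hη.nonneg_B
  have := mul_le_mul_of_nonneg_left (d.integral_H_le j)
    (by positivity : 0 ≤ 9 * (2 * B + 8 * K ^ 2))
  linarith

/-- The right-hand side `e^{2u} H` of the Cauchy–Riemann equation. -/
def uH (j : Fin n) (t θ : ℝ) : ℝ := exp (2 * d.u t θ) * d.H j t θ

theorem smooth_uH (j : Fin n) : SmoothPer (d.uH j) :=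
  (d.smooth_u.comp (g := fun x => exp (2 * x)) (by fun_prop)).mul (d.smooth_H j)

theorem uH_bounds (j : Fin n) (t θ : ℝ) :
    exp (-(2 * d.γ t)) * d.uH j t θ ^ 2 ≤ K ^ 4 * (exp (2 * d.γ t) * d.H j t θ ^ 2) ∧
    exp (-(2 * d.γ t)) * pt (d.uH j) t θ ^ 2 ≤
      K ^ 4 * (exp (2 * d.γ t) * (8 * K ^ 2 * d.H j t θ ^ 2 + 2 * gradSq (d.H j) t θ)) ∧
    exp (-(2 * d.γ t)) * pth (d.uH j) t θ ^ 2 ≤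
      K ^ 4 * (exp (2 * d.γ t) * (8 * K ^ 2 * d.H j t θ ^ 2 + 2 * gradSq (d.H j) t θ)) := by
  have hK := d.K_pos
  have h0 := d.exp_four_u_le t θ
  have e1 : pt (d.uH j) t θ =
      exp (2 * d.u t θ) * (2 * pt d.u t θ * d.H j t θ + pt (d.H j) t θ) := by
    refine HasDerivAt.deriv ((((d.smooth_u.hasDerivAt_pt t θ).const_mul 2).exp.mul
      ((d.smooth_H j).hasDerivAt_pt t θ)).congr_deriv ?_)
    ring
  have e2 : pth (d.uH j) t θ =
      exp (2 * d.u t θ) * (2 * pth d.u t θ * d.H j t θ + pth (d.H j) t θ) := by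
    refine HasDerivAt.deriv ((((d.smooth_u.hasDerivAt_pth t θ).const_mul 2).exp.mul
      ((d.smooth_H j).hasDerivAt_pth t θ)).congr_deriv ?_)
    ring
  have u1 := sq_le_sq' (abs_le.1 (d.abs_pt_u_le t θ)).1 (abs_le.1 (d.abs_pt_u_le t θ)).2
  have u2 := sq_le_sq' (abs_le.1 (d.abs_pth_u_le t θ)).1 (abs_le.1 (d.abs_pth_u_le t θ)).2
  have aux : ∀ x y : ℝ, x ^ 2 ≤ y → exp (-(2 * d.γ t)) * (exp (2 * d.u t θ) * x) ^ 2 ≤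
      K ^ 4 * (exp (2 * d.γ t) * y) := by
    intro x y hxy
    calc _ = (exp (-(2 * d.γ t)) * exp (2 * d.u t θ) ^ 2) * x ^ 2 := by ring
      _ ≤ (K ^ 4 * exp (2 * d.γ t)) * y := by gcongr
      _ = _ := by ring
  refine ⟨aux _ _ le_rfl, ?_, ?_⟩
  · rw [e1]
    refine aux _ _ ?_
    unfold gradSq
    nlinarith [sq_nonneg (2 * pt d.u t θ * d.H j t θ - pt (d.H j) t θ),
      mul_le_mul_of_nonneg_right u1 (sq_nonneg (d.H j t θ)), sq_nonneg (pth (d.H j) t θ)]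
  · rw [e2]
    refine aux _ _ ?_
    unfold gradSq
    nlinarith [sq_nonneg (2 * pth d.u t θ * d.H j t θ - pth (d.H j) t θ),
      mul_le_mul_of_nonneg_right u2 (sq_nonneg (d.H j t θ)), sq_nonneg (pt (d.H j) t θ)]

theorem dbar_re_fun (j : Fin n) : (fun t θ => pt (d.P j) t θ - pth (d.Q j) t θ) =
    rotRe (-d.m) (d.uH j) (fun _ _ => 0) :=
  funext fun t => funext fun θ => d.dbar_re j t θ

theorem dbar_im_fun (j : Fin n) : (fun t θ => pt (d.Q j) t θ + pth (d.P j) t θ) =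
    rotIm (-d.m) (d.uH j) (fun _ _ => 0) :=
  funext fun t => funext fun θ => d.dbar_im j t θ

theorem wF_mul_dbarSq_deriv_le (j : Fin n) (t θ : ℝ) :
    d.wF t * dbarSq (pt (d.P j)) (pt (d.Q j)) t θ ≤
      K ^ 4 * (exp (2 * d.γ t) * (18 * K ^ 2 * d.H j t θ ^ 2 + 4 * gradSq (d.H j) t θ)) ∧
    d.wF t * dbarSq (pth (d.P j)) (pth (d.Q j)) t θ ≤
      K ^ 4 * (exp (2 * d.γ t) * (18 * K ^ 2 * d.H j t θ ^ 2 + 4 * gradSq (d.H j) t θ)) := by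
  have sP := d.smooth_P j
  have sQ := d.smooth_Q j
  have sU := d.smooth_uH j
  have s0 : SmoothPer (fun _ _ => (0 : ℝ)) := SmoothPer.const 0
  obtain ⟨b0, b1, b2⟩ := d.uH_bounds j t θ
  have hm : ((-d.m : ℤ) : ℝ) ^ 2 ≤ K ^ 2 := by
    push_cast
    rw [neg_sq]
    exact sq_le_sq' (abs_le.1 d.abs_m_le).1 (abs_le.1 d.abs_m_le).2
  have hw := d.wF_mul_exp t
  have hK := d.K_pos
  have z1 : pt (fun _ _ => (0 : ℝ)) t θ = 0 := by simp [pt]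
  have z2 : pth (fun _ _ => (0 : ℝ)) t θ = 0 := by simp [pth]
  have fin : ∀ D y : ℝ, D ≤ 2 * (((-d.m : ℤ) : ℝ) ^ 2 * (exp (((-d.m : ℤ) : ℝ) * t) ^ 2 *
      d.uH j t θ ^ 2)) + 2 * (exp (((-d.m : ℤ) : ℝ) * t) ^ 2 * y ^ 2) →
      exp (-(2 * d.γ t)) * y ^ 2 ≤
        K ^ 4 * (exp (2 * d.γ t) * (8 * K ^ 2 * d.H j t θ ^ 2 + 2 * gradSq (d.H j) t θ)) →
      d.wF t * D ≤
        K ^ 4 * (exp (2 * d.γ t) * (18 * K ^ 2 * d.H j t θ ^ 2 + 4 * gradSq (d.H j) t θ)) := by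
    intro D y hD hy
    calc d.wF t * D ≤ d.wF t * _ := mul_le_mul_of_nonneg_left hD (d.wF_pos t).le
      _ = 2 * (((-d.m : ℤ) : ℝ) ^ 2 * (exp (-(2 * d.γ t)) * d.uH j t θ ^ 2)) +
          2 * (exp (-(2 * d.γ t)) * y ^ 2) := by rw [← hw]; ring
      _ ≤ 2 * (K ^ 2 * (K ^ 4 * (exp (2 * d.γ t) * d.H j t θ ^ 2))) +
          2 * (K ^ 4 * (exp (2 * d.γ t) *
            (8 * K ^ 2 * d.H j t θ ^ 2 + 2 * gradSq (d.H j) t θ))) := by gcongr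
      _ = _ := by ring
  have par : ∀ x y z w : ℝ, (x + y) ^ 2 + (z + w) ^ 2 ≤
      2 * (x ^ 2 + z ^ 2) + 2 * (y ^ 2 + w ^ 2) := fun x y z w => by
    nlinarith [sq_nonneg (x - y), sq_nonneg (z - w)]
  have sq0 := rotRe_sq_add_rotIm_sq (-d.m) (d.uH j) (fun _ _ => 0) t θ
  constructor
  · refine fin _ (pt (d.uH j) t θ) ?_ b1
    have e1 : pt (pt (d.P j)) t θ - pth (pt (d.Q j)) t θ =
        ((-d.m : ℤ) : ℝ) * rotRe (-d.m) (d.uH j) (fun _ _ => 0) t θ +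
          rotRe (-d.m) (pt (d.uH j)) (pt fun _ _ => 0) t θ := by
      rw [← pt_rotRe sU s0, ← dbar_re_fun, ← sQ.pt_pth]
      exact ((sP.pt.hasDerivAt_pt t θ).sub (sQ.pth.hasDerivAt_pt t θ)).deriv.symm
    have e2 : pt (pt (d.Q j)) t θ + pth (pt (d.P j)) t θ =
        ((-d.m : ℤ) : ℝ) * rotIm (-d.m) (d.uH j) (fun _ _ => 0) t θ +
          rotIm (-d.m) (pt (d.uH j)) (pt fun _ _ => 0) t θ := by
      rw [← pt_rotIm sU s0, ← dbar_im_fun, ← sP.pt_pth]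
      exact ((sQ.pt.hasDerivAt_pt t θ).add (sP.pth.hasDerivAt_pt t θ)).deriv.symm
    have sq1 := rotRe_sq_add_rotIm_sq (-d.m) (pt (d.uH j)) (pt fun _ _ => 0) t θ
    unfold dbarSq
    rw [e1, e2]
    refine (par _ _ _ _).trans (le_of_eq ?_)
    rw [sq1, z1]
    linear_combination 2 * ((-d.m : ℤ) : ℝ) ^ 2 * sq0
  · refine fin _ (pth (d.uH j) t θ) ?_ b2
    have e1 : pt (pth (d.P j)) t θ - pth (pth (d.Q j)) t θ =
        -(((-d.m : ℤ) : ℝ) * rotIm (-d.m) (d.uH j) (fun _ _ => 0) t θ) +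
          rotRe (-d.m) (pth (d.uH j)) (pth fun _ _ => 0) t θ := by
      rw [← pth_rotRe sU s0, ← dbar_re_fun, sP.pt_pth]
      exact ((sP.pt.hasDerivAt_pth t θ).sub (sQ.pth.hasDerivAt_pth t θ)).deriv.symm
    have e2 : pt (pth (d.Q j)) t θ + pth (pth (d.P j)) t θ =
        ((-d.m : ℤ) : ℝ) * rotRe (-d.m) (d.uH j) (fun _ _ => 0) t θ +
          rotIm (-d.m) (pth (d.uH j)) (pth fun _ _ => 0) t θ := by
      rw [← pth_rotIm sU s0, ← dbar_im_fun, sQ.pt_pth]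
      exact ((sQ.pt.hasDerivAt_pth t θ).add (sP.pth.hasDerivAt_pth t θ)).deriv.symm
    have sq1 := rotRe_sq_add_rotIm_sq (-d.m) (pth (d.uH j)) (pth fun _ _ => 0) t θ
    unfold dbarSq
    rw [e1, e2]
    refine (par _ _ _ _).trans (le_of_eq ?_)
    rw [sq1, z2]
    linear_combination 2 * ((-d.m : ℤ) : ℝ) ^ 2 * sq0

end GapData

theorem CylIntegrable.sum {ι : Type*} {s : Finset ι} {φ : ι → ℝ → ℝ → ℝ}
    (h : ∀ i ∈ s, CylIntegrable (φ i)) : CylIntegrable (fun t θ => ∑ i ∈ s, φ i t θ) :=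
  integrable_finsetSum s h

theorem cylIntegral_sum {ι : Type*} {s : Finset ι} {φ : ι → ℝ → ℝ → ℝ}
    (h : ∀ i ∈ s, CylIntegrable (φ i)) :
    cylIntegral (fun t θ => ∑ i ∈ s, φ i t θ) = ∑ i ∈ s, cylIntegral (φ i) :=
  integral_finsetSum s h

namespace GapData

variable {K B : ℝ} {η : ℝ → ℝ} (d : GapData n K)

theorem second_order_bound (hη : IsCutoff B η) (j : Fin n) {p q : ℝ → ℝ → ℝ} (hp : SmoothPer p)
    (hq : SmoothPer q) (hpq : ∀ t θ, p t θ ^ 2 + q t θ ^ 2 ≤ gradSq (d.P j) t θ + gradSq (d.Q j) t θ)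
    (hD : ∀ t θ, d.wF t * dbarSq p q t θ ≤
      K ^ 4 * (exp (2 * d.γ t) * (18 * K ^ 2 * d.H j t θ ^ 2 + 4 * gradSq (d.H j) t θ))) :
    CylIntegrable (fun t θ => d.wF t * (p t θ ^ 2 + q t θ ^ 2)) ∧
    cylIntegral (fun t θ => d.wF t * (p t θ ^ 2 + q t θ ^ 2)) ≤ 4 * K ^ 4 * d.hSq ∧
    cylIntegral (fun t θ => η t ^ 2 * (d.wF t * (gradSq p t θ + gradSq q t θ))) ≤
      (40 * B * K ^ 4 + 144 * K ^ 6) * d.hSq + 32 * K ^ 4 * d.dirichletH η := by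
  have hK := d.K_pos
  have hB := hη.nonneg_B
  obtain ⟨g1, g2⟩ := d.gradF_bound j
  have hle : ∀ t θ, d.wF t * (p t θ ^ 2 + q t θ ^ 2) ≤
      d.wF t * (gradSq (d.P j) t θ + gradSq (d.Q j) t θ) :=
    fun t θ => mul_le_mul_of_nonneg_left (hpq t θ) (d.wF_pos t).le
  have i1 : CylIntegrable (fun t θ => d.wF t * (p t θ ^ 2 + q t θ ^ 2)) := by
    refine g1.mono (d.smooth_wF.mul ((hp.pow 2).add (hq.pow 2))).continuous fun t θ => ?_
    rw [abs_of_nonneg (mul_nonneg (d.wF_pos t).le (by positivity))]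
    exact hle t θ
  have b1 := (cylIntegral_mono i1 g1 hle).trans g2
  refine ⟨i1, b1, ?_⟩
  have h := cylIntegral_cutoff_gradSq_le hη hp hq d.contDiff_wF d.abs_deriv_wF_le
    (fun t => (d.wF_pos t).le) i1
  have i2 := integrable_cutoff hη (d.smooth_wF.mul (hp.dbarSq hq))
  have i3 := integrable_cutoff hη (d.smooth_expγ.mul (d.smooth_H j).gradSq)
  have b2 := cylIntegral_mono i2 (((d.integrable_H j).const_mul (18 * K ^ 6)).add
      (i3.const_mul (4 * K ^ 4))) fun t θ => by
    have h1 := mul_le_mul_of_nonneg_left (hD t θ) (sq_nonneg (η t))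
    have h2 : 0 ≤ 18 * K ^ 6 * (exp (2 * d.γ t) * d.H j t θ ^ 2) := by positivity
    have h3 := mul_le_mul_of_nonneg_right (hη.sq_le_one t) h2
    calc _ ≤ _ := h1
      _ = η t ^ 2 * (18 * K ^ 6 * (exp (2 * d.γ t) * d.H j t θ ^ 2)) +
          4 * K ^ 4 * (η t ^ 2 * (exp (2 * d.γ t) * gradSq (d.H j) t θ)) := by ring
      _ ≤ _ := by linarith
  rw [cylIntegral_add ((d.integrable_H j).const_mul _) (i3.const_mul _), cylIntegral_const_mul,
    cylIntegral_const_mul] at b2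
  have e1 := mul_le_mul_of_nonneg_left (d.integral_H_le j) (by positivity : 0 ≤ 18 * K ^ 6)
  have e2 := mul_le_mul_of_nonneg_left (d.integral_gradH_le (η := η) j)
    (by positivity : 0 ≤ 4 * K ^ 4)
  have e3 := mul_le_mul_of_nonneg_left b1 (by positivity : 0 ≤ 10 * B)
  linarith

/-- The constant in the localised first-order bounds. -/
def cS (K B : ℝ) : ℝ := 3 + 4 * B + 16 * K ^ 2 + 72 * K ^ 4 + 80 * B * K ^ 4 + 288 * K ^ 6

theorem integral_product_le (hη : IsCutoff B η) (k : Fin n) {r : ℝ → ℝ → ℝ} (hr : SmoothPer r)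
    (i1 : CylIntegrable (fun t θ => d.wF t * r t θ ^ 2))
    (b1 : cylIntegral (fun t θ => d.wF t * r t θ ^ 2) ≤ 4 * K ^ 4 * d.hSq)
    (b2 : cylIntegral (fun t θ => η t ^ 2 * (d.wF t * gradSq r t θ)) ≤
      (40 * B * K ^ 4 + 144 * K ^ 6) * d.hSq + 32 * K ^ 4 * d.dirichletH η) :
    cylIntegral (fun t θ => η t ^ 2 * (d.wH k t θ ^ 2 * (d.wF t * r t θ ^ 2))) ≤
      24 * K ^ 4 * cS K B * (d.hSq * (d.hSq + d.dirichletH η)) := by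
  have hK := d.K_pos
  have hB := hη.nonneg_B
  have hh := d.hSq_nonneg
  have hX := d.dirichletH_nonneg (η := η)
  have hw : ∀ t, exp (-(d.γ t - d.m * t)) ^ 2 = d.wF t := fun t => by
    rw [wF, ← Real.exp_nat_mul]; push_cast; ring_nf
  have se : SmoothPer (fun t _ => exp (-(d.γ t - d.m * t))) :=
    SmoothPer.of_left (by have := d.smooth_γ; fun_prop)
  have sψ : SmoothPer (fun t θ => exp (-(d.γ t - d.m * t)) * r t θ) := se.mul hr
  have e0 : ∀ t θ, (exp (-(d.γ t - d.m * t)) * r t θ) ^ 2 = d.wF t * r t θ ^ 2 := fun t θ => by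
    rw [mul_pow, hw]
  have i2 := integrable_cutoff hη (d.smooth_wF.mul hr.gradSq)
  have hder : ∀ t, HasDerivAt (fun t => exp (-(d.γ t - d.m * t)))
      (exp (-(d.γ t - d.m * t)) * (-(deriv d.γ t - d.m))) t := fun t => by
    have h := ((d.hasDerivAt_γ t).sub ((hasDerivAt_id t).const_mul (d.m : ℝ))).neg.exp
    exact h.congr_deriv (by simp)
  have hm1 : ∀ t, (deriv d.γ t - d.m) ^ 2 ≤ 1 := fun t => by
    have h1 := d.deriv_γ t
    have h2 := one_div_eight_pi_le
    have h3 := abs_le.1 (h1.trans (h2.trans (by norm_num : (1 : ℝ) / 24 ≤ 1)))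
    nlinarith
  have c1 : 0 ≤ cS K B := by unfold cS; positivity
  have hS0 : 0 ≤ cS K B * (d.hSq + d.dirichletH η) := by positivity
  have hA0 : 0 ≤ 4 * K ^ 4 * d.hSq := by positivity
  have hAh : d.hSq ≤ 4 * K ^ 4 * d.hSq := by
    have : 1 ≤ K ^ 4 := one_le_pow₀ d.one_le_K
    nlinarith
  have bnd : ∀ φ : ℝ → ℝ → ℝ, SmoothPer φ → CompactT φ →
      (∀ t θ, φ t θ ^ 2 ≤ 2 * (d.wF t * r t θ ^ 2) + 2 * (η t ^ 2 * (d.wF t * gradSq r t θ))) →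
      cylIntegral (fun t θ => φ t θ ^ 2) ≤ cS K B * (d.hSq + d.dirichletH η) := by
    intro φ hφ cφ hle
    have h := cylIntegral_mono ((cφ.pow two_ne_zero).cylIntegrable (hφ.pow 2).continuous)
      ((i1.const_mul 2).add (i2.const_mul 2)) hle
    rw [cylIntegral_add (i1.const_mul 2) (i2.const_mul 2), cylIntegral_const_mul,
      cylIntegral_const_mul] at h
    refine h.trans ((by linarith : _ ≤ 2 * (4 * K ^ 4 * d.hSq) + 2 *
      ((40 * B * K ^ 4 + 144 * K ^ 6) * d.hSq + 32 * K ^ 4 * d.dirichletH η)).trans ?_)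
    have e : cS K B * (d.hSq + d.dirichletH η) - (2 * (4 * K ^ 4 * d.hSq) + 2 *
        ((40 * B * K ^ 4 + 144 * K ^ 6) * d.hSq + 32 * K ^ 4 * d.dirichletH η)) =
        (3 + 4 * B + 16 * K ^ 2 + 64 * K ^ 4) * d.hSq + (3 + 4 * B + 16 * K ^ 2 + 8 * K ^ 4 +
          80 * B * K ^ 4 + 288 * K ^ 6) * d.dirichletH η := by unfold cS; ring
    have : 0 ≤ (3 + 4 * B + 16 * K ^ 2 + 64 * K ^ 4) * d.hSq + (3 + 4 * B + 16 * K ^ 2 + 8 * K ^ 4 +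
          80 * B * K ^ 4 + 288 * K ^ 6) * d.dirichletH η := by positivity
    linarith
  have hx : (1 + 4 * B + 16 * K ^ 2) * d.hSq + 2 * d.dirichletH η ≤
      cS K B * (d.hSq + d.dirichletH η) := by
    have e : cS K B * (d.hSq + d.dirichletH η) -
        ((1 + 4 * B + 16 * K ^ 2) * d.hSq + 2 * d.dirichletH η) =
        (2 + 72 * K ^ 4 + 80 * B * K ^ 4 + 288 * K ^ 6) * d.hSq + (1 + 4 * B + 16 * K ^ 2 +
          72 * K ^ 4 + 80 * B * K ^ 4 + 288 * K ^ 6) * d.dirichletH η := by unfold cS; ring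
    have : 0 ≤ (2 + 72 * K ^ 4 + 80 * B * K ^ 4 + 288 * K ^ 6) * d.hSq + (1 + 4 * B + 16 * K ^ 2 +
          72 * K ^ 4 + 80 * B * K ^ 4 + 288 * K ^ 6) * d.dirichletH η := by positivity
    linarith
  obtain ⟨x1, x2, x3⟩ := d.cutoff_wH_bounds hη k
  have sA := Real.sq_sqrt hA0
  have sS := Real.sq_sqrt hS0
  have main := cylIntegral_cutoff_mul_sq_le hη (d.smooth_wH k) sψ
    (Real.sqrt_nonneg (4 * K ^ 4 * d.hSq)) (Real.sqrt_nonneg (cS K B * (d.hSq + d.dirichletH η)))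
    (d.integrable_wH_sq k) (by rw [sA]; exact (d.integral_wH_sq_le k).trans hAh)
    (by simpa only [e0] using i1) (by simpa only [e0, sA] using b1)
    (by rw [sS]; exact x1.trans hx) (by rw [sS]; exact x2.trans hx) (by rw [sS]; exact x3.trans hx)
    (by
      rw [sS]
      refine bnd _ (hη.smoothPer.mul sψ.pt) (hη.compact.mul_left _) fun t θ => ?_
      have e : pt (fun t θ => exp (-(d.γ t - d.m * t)) * r t θ) t θ = exp (-(d.γ t - d.m * t)) *
          (-((deriv d.γ t - d.m) * r t θ) + pt r t θ) := by
        refine (((hder t).mul (hr.hasDerivAt_pt t θ)).congr_deriv ?_).deriv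
        ring
      have h1 : η t ^ 2 * (-((deriv d.γ t - d.m) * r t θ) + pt r t θ) ^ 2 ≤
          2 * r t θ ^ 2 + 2 * (η t ^ 2 * gradSq r t θ) := by
        have h2 : η t ^ 2 * (deriv d.γ t - d.m) ^ 2 ≤ 1 :=
          mul_le_one₀ (hη.sq_le_one t) (sq_nonneg _) (hm1 t)
        unfold gradSq
        nlinarith [sq_nonneg (η t * ((deriv d.γ t - d.m) * r t θ + pt r t θ)),
          mul_le_mul_of_nonneg_right h2 (sq_nonneg (r t θ)), sq_nonneg (η t * pth r t θ)]
      rw [e, mul_pow, mul_pow, hw]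
      calc _ = d.wF t * (η t ^ 2 * (-((deriv d.γ t - d.m) * r t θ) + pt r t θ) ^ 2) := by ring
        _ ≤ _ := mul_le_mul_of_nonneg_left h1 (d.wF_pos t).le
        _ = _ := by ring)
    (by
      rw [sS]
      refine bnd _ (hη.smoothPer.mul sψ.pth) (hη.compact.mul_left _) fun t θ => ?_
      have e : pth (fun t θ => exp (-(d.γ t - d.m * t)) * r t θ) t θ =
          exp (-(d.γ t - d.m * t)) * pth r t θ := ((hr.hasDerivAt_pth t θ).const_mul _).deriv
      rw [e, mul_pow, mul_pow, hw]
      have h1 := d.wF_pos t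
      have h2 : 0 ≤ d.wF t * r t θ ^ 2 := by positivity
      have h3 : 0 ≤ η t ^ 2 * (d.wF t * pt r t θ ^ 2) := by positivity
      have h4 : 0 ≤ η t ^ 2 * (d.wF t * pth r t θ ^ 2) := by positivity
      unfold gradSq
      linarith)
  rw [sA, sS] at main
  refine le_trans (le_of_eq (cylIntegral_congr fun t θ => ?_)) (main.trans (le_of_eq (by ring)))
  rw [← e0]
  ring

end GapData

namespace GapData

variable {K B : ℝ} {η : ℝ → ℝ} (d : GapData n K)

theorem integral_product_pair_le (hη : IsCutoff B η) (j k : Fin n) {p q : ℝ → ℝ → ℝ}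
    (hp : SmoothPer p) (hq : SmoothPer q)
    (hpq : ∀ t θ, p t θ ^ 2 + q t θ ^ 2 ≤ gradSq (d.P j) t θ + gradSq (d.Q j) t θ)
    (hD : ∀ t θ, d.wF t * dbarSq p q t θ ≤
      K ^ 4 * (exp (2 * d.γ t) * (18 * K ^ 2 * d.H j t θ ^ 2 + 4 * gradSq (d.H j) t θ))) :
    cylIntegral (fun t θ => η t ^ 2 * (d.wH k t θ ^ 2 * (d.wF t * (p t θ ^ 2 + q t θ ^ 2)))) ≤
      48 * K ^ 4 * cS K B * (d.hSq * (d.hSq + d.dirichletH η)) := by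
  obtain ⟨i1, b1, b2⟩ := d.second_order_bound hη j hp hq hpq hD
  have aux : ∀ r : ℝ → ℝ → ℝ, SmoothPer r →
      (∀ t θ, r t θ ^ 2 ≤ p t θ ^ 2 + q t θ ^ 2) →
      (∀ t θ, gradSq r t θ ≤ gradSq p t θ + gradSq q t θ) →
      cylIntegral (fun t θ => η t ^ 2 * (d.wH k t θ ^ 2 * (d.wF t * r t θ ^ 2))) ≤
        24 * K ^ 4 * cS K B * (d.hSq * (d.hSq + d.dirichletH η)) := by
    intro r hr h1 h2
    have hle : ∀ t θ, d.wF t * r t θ ^ 2 ≤ d.wF t * (p t θ ^ 2 + q t θ ^ 2) :=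
      fun t θ => mul_le_mul_of_nonneg_left (h1 t θ) (d.wF_pos t).le
    have j1 : CylIntegrable (fun t θ => d.wF t * r t θ ^ 2) :=
      i1.mono (d.smooth_wF.mul (hr.pow 2)).continuous fun t θ => by
        rw [abs_of_nonneg (mul_nonneg (d.wF_pos t).le (sq_nonneg _))]
        exact hle t θ
    refine d.integral_product_le hη k hr j1 ((cylIntegral_mono j1 i1 hle).trans b1) ?_
    refine (cylIntegral_mono (integrable_cutoff hη (d.smooth_wF.mul hr.gradSq))
      (integrable_cutoff hη (d.smooth_wF.mul (hp.gradSq.add hq.gradSq))) fun t θ => ?_).trans b2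
    exact mul_le_mul_of_nonneg_left (mul_le_mul_of_nonneg_left (h2 t θ) (d.wF_pos t).le)
      (sq_nonneg _)
  have a1 := aux p hp (fun t θ => le_add_of_nonneg_right (sq_nonneg _))
    fun t θ => le_add_of_nonneg_right (gradSq_nonneg t θ)
  have a2 := aux q hq (fun t θ => le_add_of_nonneg_left (sq_nonneg _))
    fun t θ => le_add_of_nonneg_left (gradSq_nonneg t θ)
  have hi : ∀ r, SmoothPer r →
      CylIntegrable (fun t θ => η t ^ 2 * (d.wH k t θ ^ 2 * (d.wF t * r t θ ^ 2))) := fun r hr =>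
    integrable_cutoff hη (((d.smooth_wH k).pow 2).mul (d.smooth_wF.mul (hr.pow 2)))
  have e := cylIntegral_add (hi p hp) (hi q hq)
  refine le_trans (le_of_eq ?_) ((e.trans_le (add_le_add a1 a2)).trans (le_of_eq (by ring)))
  exact cylIntegral_congr fun t θ => by ring

theorem integral_gradF_product_le (hη : IsCutoff B η) (k : Fin n) :
    cylIntegral (fun t θ => η t ^ 2 * (d.wH k t θ ^ 2 *
      (d.wF t * (gradSq (d.P k) t θ + gradSq (d.Q k) t θ)))) ≤
      96 * K ^ 4 * cS K B * (d.hSq * (d.hSq + d.dirichletH η)) := by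
  have sP := d.smooth_P k
  have sQ := d.smooth_Q k
  have a1 := d.integral_product_pair_le hη k k sP.pt sQ.pt
    (fun t θ => by
      unfold gradSq
      nlinarith [sq_nonneg (pth (d.P k) t θ), sq_nonneg (pth (d.Q k) t θ)]) fun t θ => (d.wF_mul_dbarSq_deriv_le k t θ).1
  have a2 := d.integral_product_pair_le hη k k sP.pth sQ.pth
    (fun t θ => by
      unfold gradSq
      nlinarith [sq_nonneg (pt (d.P k) t θ), sq_nonneg (pt (d.Q k) t θ)]) fun t θ => (d.wF_mul_dbarSq_deriv_le k t θ).2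
  have hi : ∀ p q, SmoothPer p → SmoothPer q → CylIntegrable (fun t θ => η t ^ 2 *
      (d.wH k t θ ^ 2 * (d.wF t * (p t θ ^ 2 + q t θ ^ 2)))) := fun p q hp hq =>
    integrable_cutoff hη (((d.smooth_wH k).pow 2).mul (d.smooth_wF.mul ((hp.pow 2).add (hq.pow 2))))
  have e := cylIntegral_add (hi _ _ sP.pt sQ.pt) (hi _ _ sP.pth sQ.pth)
  refine le_trans (le_of_eq ?_) ((e.trans_le (add_le_add a1 a2)).trans (le_of_eq (by ring)))
  exact cylIntegral_congr fun t θ => by unfold gradSq; ring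

/-- The constant in the bound of the quadratic terms of the Willmore equation. -/
def cW (n : ℕ) (K B : ℝ) : ℝ := 96 * n ^ 2 * K ^ 7 * cS K B

theorem integral_cutoff_W_le (hη : IsCutoff B η) (j : Fin n) :
    cylIntegral (fun t θ => η t ^ 2 * (exp (2 * d.γ t) * (d.Wt j t θ ^ 2 + d.Wθ j t θ ^ 2))) ≤
      cW n K B * (d.hSq * (d.hSq + d.dirichletH η)) := by
  have hK := d.K_pos
  have hi : ∀ k ∈ Finset.univ, CylIntegrable (fun t θ => η t ^ 2 * (d.wH k t θ ^ 2 *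
      (d.wF t * (gradSq (d.P k) t θ + gradSq (d.Q k) t θ)))) := fun k _ =>
    integrable_cutoff hη (((d.smooth_wH k).pow 2).mul
      (d.smooth_wF.mul ((d.smooth_P k).gradSq.add (d.smooth_Q k).gradSq)))
  have h := cylIntegral_mono (integrable_cutoff hη (d.smooth_expγ.mul
    (((d.smooth_Wt j).pow 2).add ((d.smooth_Wθ j).pow 2)))) ((CylIntegrable.sum hi).const_mul
      (n * K ^ 3)) fun t θ => by
        rw [← Finset.mul_sum]
        have := mul_le_mul_of_nonneg_left (d.W_le_grad j t θ) (sq_nonneg (η t))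
        linarith
  rw [cylIntegral_const_mul, cylIntegral_sum hi] at h
  refine h.trans ?_
  have h2 := Finset.sum_le_sum fun k (_ : k ∈ Finset.univ) => d.integral_gradF_product_le hη k
  rw [Finset.sum_const, Finset.card_univ, Fintype.card_fin, nsmul_eq_mul] at h2
  refine (mul_le_mul_of_nonneg_left h2 (by positivity)).trans (le_of_eq ?_)
  unfold cW
  ring

/-- The constant in the global bound for the gradient of the mean curvature. -/
def cX (n : ℕ) (K B : ℝ) : ℝ := 1 + 18 * n * (2 * B + 8 * K ^ 2)

theorem dirichletH_le (hη : IsCutoff B η) (hs : 3 * n * cW n K B * d.hSq ≤ 1) :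
    d.dirichletH η ≤ cX n K B * d.hSq := by
  have h := Finset.sum_le_sum fun j (_ : j ∈ Finset.univ) => (d.caccioppoli_H hη j).trans
    (add_le_add_left (mul_le_mul_of_nonneg_left (d.integral_cutoff_W_le hη j)
      (by norm_num : (0 : ℝ) ≤ 3 / 2)) _)
  rw [Finset.sum_const, Finset.card_univ, Fintype.card_fin, nsmul_eq_mul] at h
  change d.dirichletH η ≤ _ at h
  have h1 := mul_le_mul_of_nonneg_right hs
    (add_nonneg d.hSq_nonneg (d.dirichletH_nonneg (η := η)))
  unfold cX
  linarith

theorem exists_isCutoff : ∃ B : ℝ, 0 ≤ B ∧ ∀ T : ℝ, 1 ≤ T →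
    ∃ η : ℝ → ℝ, IsCutoff B η ∧ ∀ t, |t| ≤ T → η t = 1 := by
  obtain ⟨B, hB, h⟩ := exists_cutoff
  refine ⟨B, hB, fun T hT => ?_⟩
  obtain ⟨η, h1, h2, h3, h4, h5, -⟩ := h T hT
  exact ⟨η, ⟨h1, fun t => (h2 t).1, fun t => (h2 t).2, h4, fun t => (h5 t).trans
    (div_le_self hB hT)⟩, fun t ht => (h3 t ht).1⟩

theorem integral_le_of_cutoff {C : ℝ} {φ : ℝ → ℝ → ℝ} (hφ : SmoothPer φ) (h0 : ∀ t θ, 0 ≤ φ t θ)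
    (hB : ∀ T : ℝ, 1 ≤ T → ∃ η : ℝ → ℝ, IsCutoff B η ∧ ∀ t, |t| ≤ T → η t = 1)
    (H : ∀ η, IsCutoff B η → cylIntegral (fun t θ => η t ^ 2 * φ t θ) ≤ C) :
    CylIntegrable φ ∧ cylIntegral φ ≤ C := by
  refine cylIntegrable_of_truncations (D := 0) hφ.continuous h0 fun T hT => ?_
  obtain ⟨η, h1, h2⟩ := hB T hT
  refine ⟨fun t θ => η t ^ 2 * φ t θ, integrable_cutoff h1 hφ,
    fun t θ => mul_nonneg (sq_nonneg _) (h0 t θ), fun t θ ht => by simp [h2 t ht], ?_⟩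
  simpa using H η h1

theorem exists_small_bound (n : ℕ) (K : ℝ) (hK : 1 ≤ K) : ∃ ε > 0, ∃ C ≥ 1, ∀ d : GapData n K, d.hSq ≤ ε →
    ∀ j, (CylIntegrable (fun t θ => exp (2 * d.γ t) * gradSq (d.H j) t θ) ∧
      cylIntegral (fun t θ => exp (2 * d.γ t) * gradSq (d.H j) t θ) ≤ C * d.hSq) ∧
      (CylIntegrable (fun t θ => exp (2 * d.γ t) * (d.Wt j t θ ^ 2 + d.Wθ j t θ ^ 2)) ∧
      cylIntegral (fun t θ => exp (2 * d.γ t) * (d.Wt j t θ ^ 2 + d.Wθ j t θ ^ 2)) ≤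
        C * d.hSq ^ 2) := by
  obtain ⟨B, hB, hcut⟩ := exists_isCutoff
  have hK0 : 0 < K := by linarith
  have hS : 0 ≤ cS K B := by unfold cS; positivity
  have hW : 0 ≤ cW n K B := by unfold cW; positivity
  have hX : 1 ≤ cX n K B := by
    have : 0 ≤ 18 * n * (2 * B + 8 * K ^ 2) := by positivity
    unfold cX; linarith
  refine ⟨1 / (3 * n * cW n K B + 1), by positivity, cX n K B + cW n K B * (1 + cX n K B),
    le_add_of_le_of_nonneg hX (by positivity), fun d hd j => ?_⟩
  have hh := d.hSq_nonneg
  have hs : 3 * n * cW n K B * d.hSq ≤ 1 := by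
    rw [le_div_iff₀ (by positivity)] at hd
    linarith
  constructor
  · refine integral_le_of_cutoff (d.smooth_expγ.mul (d.smooth_H j).gradSq)
      (fun t θ => mul_nonneg (exp_pos _).le (gradSq_nonneg t θ)) hcut fun η hη => ?_
    refine (d.integral_gradH_le j).trans ((d.dirichletH_le hη hs).trans ?_)
    exact mul_le_mul_of_nonneg_right (le_add_of_nonneg_right (by positivity)) hh
  · refine integral_le_of_cutoff (d.smooth_expγ.mul (((d.smooth_Wt j).pow 2).add
      ((d.smooth_Wθ j).pow 2))) (fun t θ => by positivity) hcut fun η hη => ?_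
    refine (d.integral_cutoff_W_le hη j).trans ?_
    have h1 := mul_le_mul_of_nonneg_left (add_le_add_right (d.dirichletH_le hη hs) d.hSq)
      (mul_nonneg hW hh)
    have h2 : 0 ≤ cX n K B * d.hSq ^ 2 := by positivity
    linarith

end GapData

section Primitive

variable {k V W φ : ℝ → ℝ → ℝ}

/-- A function with vanishing circle means is bounded by the `L¹` norm of its tangential
derivative. -/
theorem SmoothPer.abs_le_circInt_abs_pth (hk : SmoothPer k) {t : ℝ} (h0 : circInt k t = 0) (θ : ℝ) :
    |k t θ| ≤ circInt (fun t θ => |pth k t θ|) t := by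
  obtain ⟨x, hx, h⟩ := hk.exists_mem_Icc t θ
  have c1 := hk.continuous_right t
  have hπ := Real.pi_pos
  have h1 : circInt (fun t θ => k t x - k t θ) t = 2 * π * k t x := by
    rw [circInt_sub (φ := fun t _ => k t x) continuous_const c1, h0]
    simp [circInt]
  have h2 := norm_circInt_le (fun t θ => k t x - k t θ) t
  have h3 : circInt (fun t θ => ‖k t x - k t θ‖) t ≤
      circInt (fun _ _ => circInt (fun t θ => |pth k t θ|) t) t :=
    circInt_mono (by fun_prop) continuous_const fun y hy => hk.norm_sub_le t hx hy
  rw [h1, Real.norm_eq_abs, abs_mul, abs_of_pos (by positivity)] at h2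
  rw [circInt_const] at h3
  rw [h]
  exact le_of_mul_le_mul_left (h2.trans h3) (by positivity)

/-- A divergence-free field with vanishing flux has a periodic stream function. -/
theorem SmoothPer.exists_stream (hV : SmoothPer V) (hW : SmoothPer W) (h0 : ∀ t, circInt V t = 0)
    (hdiv : ∀ t θ, pt V t θ + pth W t θ = 0) :
    ∃ L : ℝ → ℝ → ℝ, SmoothPer L ∧ (∀ t θ, pth L t θ = V t θ) ∧
      (∀ t θ, pt L t θ = circInt W t / (2 * π) - W t θ) ∧ ∀ t, circInt L t = 0 := by
  have hπ := Real.pi_pos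
  let P : ℝ → ℝ → ℝ := fun t θ => ∫ s in (0 : ℝ)..θ, V t s
  have hVint : ∀ t, ∀ a b : ℝ, IntervalIntegrable (V t) volume a b := fun t a b =>
    (hV.continuous_right t).intervalIntegrable _ _
  have d2 : ∀ t θ, HasDerivAt (fun s => P t s) (V t θ) θ := fun t θ =>
    intervalIntegral.integral_hasDerivAt_right (hVint t _ _)
      ((hV.continuous_right t).stronglyMeasurableAtFilter _ _) (hV.continuous_right t).continuousAt
  have d1 : ∀ t θ, HasDerivAt (fun s => P s θ) (W t 0 - W t θ) t := fun t θ => by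
    refine (hasDerivAt_intervalIntegral_param 0 θ hV.continuous hV.pt.continuous
      hV.hasDerivAt_pt t).congr_deriv ?_
    have e : ∀ s, pt V t s = -pth W t s := fun s => by linarith [hdiv t s]
    simp only [e]
    rw [intervalIntegral.integral_neg, intervalIntegral.integral_eq_sub_of_hasDerivAt
      (fun s _ => hW.hasDerivAt_pth t s) ((hW.pth.continuous_right t).intervalIntegrable _ _)]
    ring
  have hp : ∀ t θ, P t (θ + 2 * π) = P t θ := fun t θ => by
    have h1 := intervalIntegral.integral_add_adjacent_intervals (hVint t 0 θ) (hVint t θ (θ + 2 * π))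
    have h2 := Function.Periodic.intervalIntegral_add_eq (f := V t) (T := 2 * π)
      (fun x => hV.per t x) θ 0
    have h3 : ∫ s in (0 : ℝ)..(0 + 2 * π), V t s = 0 := by rw [zero_add]; exact h0 t
    change ∫ s in (0 : ℝ)..(θ + 2 * π), V t s = ∫ s in (0 : ℝ)..θ, V t s
    rw [← h1, h2, h3, add_zero]
  have sW0 : SmoothPer (fun t _ => W t 0) := ⟨(hW.smooth.comp
    (contDiff_fst.prodMk contDiff_const : ContDiff ℝ ∞ fun p : ℝ × ℝ => (p.1, (0 : ℝ)))), fun _ _ => rfl⟩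
  have sP : SmoothPer P := SmoothPer.of_partials (sW0.sub hW) hV d1 d2 hp
  have sM : SmoothPer (fun t _ => (1 / (2 * π)) * circInt P t) :=
    (SmoothPer.const _).mul (SmoothPer.of_left sP.contDiff_circInt)
  refine ⟨fun t θ => P t θ - (1 / (2 * π)) * circInt P t, sP.sub sM, fun t θ =>
    ((d2 t θ).sub_const _).deriv, fun t θ => ?_, fun t => ?_⟩
  · refine (((d1 t θ).sub ((sP.hasDerivAt_circInt t).const_mul (1 / (2 * π)))).congr_deriv ?_).deriv
    have e : pt P t = fun θ => W t 0 - W t θ := funext fun θ => (d1 t θ).deriv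
    have e2 : circInt (pt P) t = circInt (fun t θ => W t 0 - W t θ) t := by
      unfold circInt; rw [e]
    rw [e2, circInt_sub (φ := fun t _ => W t 0) continuous_const (hW.continuous_right t)]
    have e3 : circInt (fun t _ => W t 0) t = 2 * π * W t 0 := by simp [circInt]
    rw [e3]
    field_simp
    ring
  · rw [circInt_sub (sP.continuous_right t) (sM.continuous_right t)]
    have e3 : circInt (fun t _ => 1 / (2 * π) * circInt P t) t =
      2 * π * (1 / (2 * π) * circInt P t) := by simp [circInt]; ring
    rw [e3]
    field_simp
    ring

theorem SmoothPer.eq_zero_of_cylIntegral_eq_zero (hφ : SmoothPer φ) (h0 : ∀ t θ, 0 ≤ φ t θ)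
    (hi : CylIntegrable φ) (h : cylIntegral φ = 0) (t θ : ℝ) : φ t θ = 0 := by
  rw [hi.integral_eq, integral_eq_zero_iff_of_nonneg (fun t => circInt_nonneg (h0 t))
    hi.integrable_circInt] at h
  have h1 : circInt φ = fun _ => 0 :=
    ((continuous_circInt hφ.continuous).ae_eq_iff_eq volume continuous_const).1 h
  obtain ⟨x, hx, e⟩ := hφ.exists_mem_Icc t θ
  by_contra hne
  rw [e] at hne
  have h2 := intervalIntegral.integral_pos (a := 0) (b := 2 * π) (f := φ t) (by positivity)
    (hφ.continuous_right t).continuousOn (fun y _ => h0 t y)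
    ⟨x, hx, lt_of_le_of_ne (h0 t x) (Ne.symm hne)⟩
  have h3 := congrFun h1 t
  unfold circInt at h3
  linarith

theorem not_integrable_of_monotone {g : ℝ → ℝ} (h0 : ∀ t, 0 < g t) (hg : Monotone g) :
    ¬ Integrable g := fun hi => by
  have h1 : IntegrableOn (fun _ : ℝ => g 0) (Ici 0) := by
    refine Integrable.mono' hi.integrableOn aestronglyMeasurable_const ?_
    filter_upwards [ae_restrict_mem measurableSet_Ici] with t ht
    rw [Real.norm_of_nonneg (h0 0).le]
    exact hg ht
  rw [integrableOn_const_iff] at h1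
  rcases h1 with h1 | h1
  · exact (h0 0).ne' (enorm_eq_zero.1 h1)
  · simp at h1

theorem not_integrable_of_antitone {g : ℝ → ℝ} (h0 : ∀ t, 0 < g t) (hg : Antitone g) :
    ¬ Integrable g := fun hi =>
  not_integrable_of_monotone (g := fun t => g (-t)) (fun t => h0 (-t))
    (fun _ _ h => hg (neg_le_neg h)) hi.comp_neg

end Primitive

namespace GapData

variable {K : ℝ} (d : GapData n K)

theorem not_integrable_exp : ¬ Integrable (fun t => exp (2 * d.γ t)) := by
  have hd : Differentiable ℝ d.γ := d.smooth_γ.differentiable (by simp)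
  have h := fun t => abs_le.1 ((d.deriv_γ t).trans one_div_eight_pi_le)
  rcases lt_or_gt_of_ne d.m_ne_zero with hm | hm
  · have hm' : (d.m : ℝ) ≤ -1 := by exact_mod_cast Int.le_sub_one_of_lt hm
    have := antitone_of_deriv_nonpos hd fun t => by linarith [(h t).2]
    exact not_integrable_of_antitone (fun t => exp_pos _) fun s t hst =>
      exp_le_exp.2 (by linarith [this hst])
  · have hm' : (1 : ℝ) ≤ d.m := by exact_mod_cast hm
    have := monotone_of_deriv_nonneg hd fun t => by linarith [(h t).1]
    exact not_integrable_of_monotone (fun t => exp_pos _) fun s t hst =>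
      exp_le_exp.2 (by linarith [this hst])

theorem smooth_Vt (j : Fin n) : SmoothPer (fun t θ => 2 * pt (d.H j) t θ + d.Wt j t θ) :=
  ((SmoothPer.const 2).mul (d.smooth_H j).pt).add (d.smooth_Wt j)

theorem smooth_Vθ (j : Fin n) : SmoothPer (fun t θ => 2 * pth (d.H j) t θ + d.Wθ j t θ) :=
  ((SmoothPer.const 2).mul (d.smooth_H j).pth).add (d.smooth_Wθ j)

theorem div_V (j : Fin n) (t θ : ℝ) : pt (fun t θ => 2 * pt (d.H j) t θ + d.Wt j t θ) t θ +
    pth (fun t θ => 2 * pth (d.H j) t θ + d.Wθ j t θ) t θ = 0 := by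
  have e1 : pt (fun t θ => 2 * pt (d.H j) t θ + d.Wt j t θ) t θ =
      2 * pt (pt (d.H j)) t θ + pt (d.Wt j) t θ :=
    ((((d.smooth_H j).pt.hasDerivAt_pt t θ).const_mul 2).add
      ((d.smooth_Wt j).hasDerivAt_pt t θ)).deriv
  have e2 : pth (fun t θ => 2 * pth (d.H j) t θ + d.Wθ j t θ) t θ =
      2 * pth (pth (d.H j)) t θ + pth (d.Wθ j) t θ :=
    ((((d.smooth_H j).pth.hasDerivAt_pth t θ).const_mul 2).add
      ((d.smooth_Wθ j).hasDerivAt_pth t θ)).deriv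
  rw [e1, e2]
  exact d.div_eq j t θ

theorem circInt_eq_of_pt {φ : ℝ → ℝ → ℝ} (hφ : SmoothPer φ) (h : ∀ t, circInt (pt φ) t = 0) (s t : ℝ) :
    circInt φ s = circInt φ t :=
  is_const_of_deriv_eq_zero (fun t => (hφ.hasDerivAt_circInt t).differentiableAt)
    (fun t => (hφ.hasDerivAt_circInt t).deriv.trans (h t)) s t

/-- The flux of the Willmore current vanishes. -/
theorem circInt_Vt (j : Fin n)
    (hi : CylIntegrable (fun t θ => exp (2 * d.γ t) *
      (2 * pt (d.H j) t θ + d.Wt j t θ) ^ 2)) (t : ℝ) :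
    circInt (fun t θ => 2 * pt (d.H j) t θ + d.Wt j t θ) t = 0 := by
  have sV := d.smooth_Vt j
  have hc := circInt_eq_of_pt sV fun t => by
    have e : ∀ θ, pt (fun t θ => 2 * pt (d.H j) t θ + d.Wt j t θ) t θ =
      (-1) * pth (fun t θ => 2 * pth (d.H j) t θ + d.Wθ j t θ) t θ := fun θ => by
        linarith [d.div_V j t θ]
    have e2 := circInt_mul_left (fun _ => (-1 : ℝ))
      (pth (fun t θ => 2 * pth (d.H j) t θ + d.Wθ j t θ)) t
    rw [(d.smooth_Vθ j).circInt_pth, mul_zero] at e2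
    unfold circInt at e2 ⊢
    simp only [e]
    exact e2
  by_contra hne
  set c := circInt (fun t θ => 2 * pt (d.H j) t θ + d.Wt j t θ) t with hcdef
  refine d.not_integrable_exp ?_
  have hcγ : Continuous d.γ := d.smooth_γ.continuous
  refine Integrable.mono' (hi.integrable_circInt.const_mul (2 * π / c ^ 2))
    (by fun_prop : Continuous fun t => exp (2 * d.γ t)).aestronglyMeasurable
    (Eventually.of_forall fun s => ?_)
  rw [Real.norm_of_nonneg (exp_pos _).le,
    circInt_mul_left (fun t => exp (2 * d.γ t)) (fun t θ => (2 * pt (d.H j) t θ + d.Wt j t θ) ^ 2)]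
  have h1 := circInt_sq_le (φ := fun t θ => 2 * pt (d.H j) t θ + d.Wt j t θ)
    (sV.continuous_right s)
  rw [hc s t, ← hcdef] at h1
  have hc2 : 0 < c ^ 2 := by positivity
  rw [div_mul_eq_mul_div, le_div_iff₀ hc2]
  have := mul_le_mul_of_nonneg_left h1 (exp_pos (2 * d.γ s)).le
  linarith

end GapData

theorem CylIntegrable.of_le_circInt {φ ψ : ℝ → ℝ → ℝ} (hψ : CylIntegrable ψ)
    (hφ : Continuous (fun p : ℝ × ℝ => φ p.1 p.2))
    (h : ∀ t θ, |φ t θ| ≤ circInt ψ t) :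
    CylIntegrable φ ∧ cylIntegral φ ≤ 2 * π * cylIntegral ψ := by
  have h1 : CylIntegrable (fun t _ => circInt ψ t) := hψ.integrable_circInt.comp_fst _
  have h2 := h1.mono hφ h
  refine ⟨h2, (cylIntegral_mono h2 h1 fun t θ => (le_abs_self _).trans (h t θ)).trans (le_of_eq ?_)⟩
  rw [h1.integral_eq, hψ.integral_eq, ← integral_const_mul]
  simp [circInt]

namespace GapData

variable {K C : ℝ}

/-- Stream functions `L` of the Willmore current, normalised by vanishing circle means, with bounds
for `Y = e^{mz} (H + iL/2)`. -/
structure Stream (d : GapData n K) (C : ℝ) (L : Fin n → ℝ → ℝ → ℝ) : Prop where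
  smooth : ∀ j, SmoothPer (L j)
  pth_eq : ∀ j t θ, pth (L j) t θ = 2 * pt (d.H j) t θ + d.Wt j t θ
  pt_eq : ∀ j t θ, pt (L j) t θ =
    circInt (d.Wθ j) t / (2 * π) - (2 * pth (d.H j) t θ + d.Wθ j t θ)
  integrable_HL : ∀ j, CylIntegrable
    (fun t θ => exp (2 * d.γ t) * (d.H j t θ ^ 2 + (L j t θ / 2) ^ 2))
  integral_HL_le : ∀ j, cylIntegral
    (fun t θ => exp (2 * d.γ t) * (d.H j t θ ^ 2 + (L j t θ / 2) ^ 2)) ≤ C * d.hSq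
  integrable_gradY : ∀ j, CylIntegrable (fun t θ => d.wY t *
    (gradSq (rotRe d.m (d.H j) (fun t θ => L j t θ / 2)) t θ +
      gradSq (rotIm d.m (d.H j) (fun t θ => L j t θ / 2)) t θ))
  integral_gradY_le : ∀ j, cylIntegral (fun t θ => d.wY t *
    (gradSq (rotRe d.m (d.H j) (fun t θ => L j t θ / 2)) t θ +
      gradSq (rotIm d.m (d.H j) (fun t θ => L j t θ / 2)) t θ)) ≤ C * d.hSq ^ 2

theorem exists_stream_component (d : GapData n K) {C : ℝ} (hC : 1 ≤ C) (hs : d.hSq ≤ 1) (j : Fin n)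
    (i1 : CylIntegrable (fun t θ => exp (2 * d.γ t) * gradSq (d.H j) t θ))
    (b1 : cylIntegral (fun t θ => exp (2 * d.γ t) * gradSq (d.H j) t θ) ≤ C * d.hSq)
    (i2 : CylIntegrable (fun t θ => exp (2 * d.γ t) * (d.Wt j t θ ^ 2 + d.Wθ j t θ ^ 2)))
    (b2 : cylIntegral (fun t θ => exp (2 * d.γ t) * (d.Wt j t θ ^ 2 + d.Wθ j t θ ^ 2)) ≤
        C * d.hSq ^ 2) :
    ∃ L : ℝ → ℝ → ℝ, SmoothPer L ∧ (∀ t θ, pth L t θ = 2 * pt (d.H j) t θ + d.Wt j t θ) ∧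
      (∀ t θ, pt L t θ = circInt (d.Wθ j) t / (2 * π) - (2 * pth (d.H j) t θ + d.Wθ j t θ)) ∧
      (CylIntegrable (fun t θ => exp (2 * d.γ t) * (d.H j t θ ^ 2 + (L t θ / 2) ^ 2)) ∧
      cylIntegral (fun t θ => exp (2 * d.γ t) * (d.H j t θ ^ 2 + (L t θ / 2) ^ 2)) ≤
        200 * C * d.hSq) ∧
      (CylIntegrable (fun t θ => d.wY t * (gradSq (rotRe d.m (d.H j) (fun t θ => L t θ / 2)) t θ +
        gradSq (rotIm d.m (d.H j) (fun t θ => L t θ / 2)) t θ)) ∧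
      cylIntegral (fun t θ => d.wY t * (gradSq (rotRe d.m (d.H j) (fun t θ => L t θ / 2)) t θ +
        gradSq (rotIm d.m (d.H j) (fun t θ => L t θ / 2)) t θ)) ≤ 200 * C * d.hSq ^ 2) := by
  have hh := d.hSq_nonneg
  have hπ := Real.pi_pos
  have sH := d.smooth_H j
  have sV := d.smooth_Vt j
  have sW := d.smooth_Wt j
  have sW' := d.smooth_Wθ j
  have hleV : ∀ t θ, exp (2 * d.γ t) * (2 * pt (d.H j) t θ + d.Wt j t θ) ^ 2 ≤
      8 * (exp (2 * d.γ t) * gradSq (d.H j) t θ) +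
        2 * (exp (2 * d.γ t) * (d.Wt j t θ ^ 2 + d.Wθ j t θ ^ 2)) := fun t θ => by
    have h1 : (2 * pt (d.H j) t θ + d.Wt j t θ) ^ 2 ≤
        8 * gradSq (d.H j) t θ + 2 * (d.Wt j t θ ^ 2 + d.Wθ j t θ ^ 2) := by
      unfold gradSq
      nlinarith [sq_nonneg (2 * pt (d.H j) t θ - d.Wt j t θ), sq_nonneg (pth (d.H j) t θ),
        sq_nonneg (d.Wθ j t θ)]
    have := mul_le_mul_of_nonneg_left h1 (exp_pos (2 * d.γ t)).le
    linarith
  have iV : CylIntegrable (fun t θ => exp (2 * d.γ t) *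
      (2 * pt (d.H j) t θ + d.Wt j t θ) ^ 2) :=
    ((i1.const_mul 8).add (i2.const_mul 2)).mono (d.smooth_expγ.mul (sV.pow 2)).continuous
      fun t θ => by rw [abs_of_nonneg (by positivity)]; exact hleV t θ
  have bV := cylIntegral_mono iV ((i1.const_mul 8).add (i2.const_mul 2)) hleV
  rw [cylIntegral_add (i1.const_mul 8) (i2.const_mul 2), cylIntegral_const_mul,
    cylIntegral_const_mul] at bV
  have bV' : cylIntegral (fun t θ => exp (2 * d.γ t) *
      (2 * pt (d.H j) t θ + d.Wt j t θ) ^ 2) ≤ 10 * C * d.hSq := by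
    have : C * d.hSq ^ 2 ≤ C * d.hSq := by
      have : d.hSq ^ 2 ≤ d.hSq := by nlinarith
      nlinarith
    linarith
  obtain ⟨L, sL, L1, L2, L3⟩ := SmoothPer.exists_stream sV (d.smooth_Vθ j)
    (d.circInt_Vt j iV) (d.div_V j)
  have eW : ∀ t, circInt (fun t θ => 2 * pth (d.H j) t θ + d.Wθ j t θ) t = circInt (d.Wθ j) t := by
    intro t
    rw [circInt_add (φ := fun t θ => 2 * pth (d.H j) t θ)
      (((SmoothPer.const 2).mul sH.pth).continuous_right t) (sW'.continuous_right t),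
      circInt_mul_left (fun _ => 2), sH.circInt_pth]
    ring
  simp only [eW] at L2
  have sL2 : SmoothPer (fun t θ => L t θ / 2) := by
    simpa only [div_eq_mul_inv] using sL.mul (SmoothPer.const (2⁻¹ : ℝ))
  have hL : ∀ t θ, exp (2 * d.γ t) * L t θ ^ 2 ≤ circInt (fun t θ => 2 * π * (exp (2 * d.γ t) *
      (2 * pt (d.H j) t θ + d.Wt j t θ) ^ 2)) t := fun t θ => by
    have h1 := sL.abs_le_circInt_abs_pth (L3 t) θ
    have e1 : circInt (fun t θ => |pth L t θ|) t =
        circInt (fun t θ => |2 * pt (d.H j) t θ + d.Wt j t θ|) t := by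
      simp only [circInt, L1]
    have h2 := circInt_sq_le (φ := fun t θ => |2 * pt (d.H j) t θ + d.Wt j t θ|)
      (sV.continuous_right t).abs
    simp only [sq_abs] at h2
    have h3 : L t θ ^ 2 ≤ circInt (fun t θ => |2 * pt (d.H j) t θ + d.Wt j t θ|) t ^ 2 := by
      rw [← sq_abs, ← e1]
      exact pow_le_pow_left₀ (abs_nonneg _) h1 2
    rw [circInt_mul_left (fun _ => 2 * π), circInt_mul_left (fun t => exp (2 * d.γ t))
      (fun t θ => (2 * pt (d.H j) t θ + d.Wt j t θ) ^ 2)]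
    have := mul_le_mul_of_nonneg_left (h3.trans h2) (exp_pos (2 * d.γ t)).le
    linarith
  obtain ⟨iL, bL⟩ := (iV.const_mul (2 * π)).of_le_circInt
    (φ := fun t θ => exp (2 * d.γ t) * L t θ ^ 2) (d.smooth_expγ.mul (sL.pow 2)).continuous
    fun t θ => by rw [abs_of_nonneg (by positivity)]; exact hL t θ
  rw [cylIntegral_const_mul] at bL
  have hπ2 : π ^ 2 < 10 := by nlinarith [Real.pi_lt_d2, Real.pi_pos]
  have hV0 : 0 ≤ cylIntegral (fun t θ => exp (2 * d.γ t) *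
      (2 * pt (d.H j) t θ + d.Wt j t θ) ^ 2) := cylIntegral_nonneg fun t θ => by positivity
  have bL' : cylIntegral (fun t θ => exp (2 * d.γ t) * L t θ ^ 2) ≤ 400 * C * d.hSq := by
    have : 4 * π ^ 2 * cylIntegral (fun t θ => exp (2 * d.γ t) *
      (2 * pt (d.H j) t θ + d.Wt j t θ) ^ 2) ≤ 40 * (10 * C * d.hSq) :=
      mul_le_mul (by linarith) bV' hV0 (by norm_num)
    linarith
  have hHL : ∀ t θ, exp (2 * d.γ t) * d.H j t θ ^ 2 + 1 / 4 * (exp (2 * d.γ t) * L t θ ^ 2) =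
      exp (2 * d.γ t) * (d.H j t θ ^ 2 + (L t θ / 2) ^ 2) := fun t θ => by ring
  have iHL : CylIntegrable (fun t θ => exp (2 * d.γ t) * (d.H j t θ ^ 2 + (L t θ / 2) ^ 2)) := by
    simpa only [hHL] using (d.integrable_H j).add (iL.const_mul (1 / 4))
  refine ⟨L, sL, L1, L2, ⟨iHL, ?_⟩, ?_⟩
  · have h := cylIntegral_add (d.integrable_H j) (iL.const_mul (1 / 4))
    rw [cylIntegral_const_mul] at h
    simp only [hHL] at h
    rw [h]
    have := d.integral_H_le j
    nlinarith
  · have sR := sH.rotRe d.m sL2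
    have sI := sH.rotIm d.m sL2
    have sWbar : SmoothPer (fun t _ => circInt (d.Wθ j) t / (2 * π)) := SmoothPer.of_left
      (sW'.contDiff_circInt.div_const _)
    have iW' : CylIntegrable (fun t θ => exp (2 * d.γ t) * d.Wθ j t θ ^ 2) :=
      i2.mono (d.smooth_expγ.mul (sW'.pow 2)).continuous fun t θ => by
        rw [abs_of_nonneg (by positivity)]
        exact mul_le_mul_of_nonneg_left (le_add_of_nonneg_left (sq_nonneg _)) (exp_pos _).le
    have bW' := cylIntegral_mono iW' i2 fun t θ =>
      mul_le_mul_of_nonneg_left (le_add_of_nonneg_left (sq_nonneg (d.Wt j t θ))) (exp_pos _).le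
    obtain ⟨iB, bB⟩ := (iW'.const_mul (1 / (2 * π))).of_le_circInt
      (φ := fun t _ => exp (2 * d.γ t) * (circInt (d.Wθ j) t / (2 * π)) ^ 2)
      (d.smooth_expγ.mul (sWbar.pow 2)).continuous fun t θ => by
        have h1 := circInt_sq_le (sW'.continuous_right t)
        rw [abs_of_nonneg (by positivity), circInt_mul_left (fun _ => 1 / (2 * π)),
          circInt_mul_left (fun t => exp (2 * d.γ t)) (fun t θ => d.Wθ j t θ ^ 2), div_pow]
        have h2 : circInt (d.Wθ j) t ^ 2 / (2 * π) ^ 2 ≤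
            1 / (2 * π) * circInt (fun t θ => d.Wθ j t θ ^ 2) t := by
          rw [div_le_iff₀ (by positivity)]
          refine h1.trans (le_of_eq ?_)
          field_simp
        have := mul_le_mul_of_nonneg_left h2 (exp_pos (2 * d.γ t)).le
        linarith
    rw [cylIntegral_const_mul] at bB
    have bB' : cylIntegral (fun t θ => exp (2 * d.γ t) * (circInt (d.Wθ j) t / (2 * π)) ^ 2) ≤
        C * d.hSq ^ 2 := by
      refine bB.trans ((le_of_eq ?_).trans (bW'.trans b2))
      field_simp
    have eD : ∀ t θ, d.wY t * dbarSq (rotRe d.m (d.H j) fun t θ => L t θ / 2)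
        (rotIm d.m (d.H j) fun t θ => L t θ / 2) t θ = exp (2 * d.γ t) *
          ((d.Wt j t θ / 2) ^ 2 + ((circInt (d.Wθ j) t / (2 * π) - d.Wθ j t θ) / 2) ^ 2) := by
      intro t θ
      have e1 : pt (fun t θ => L t θ / 2) t θ = pt L t θ / 2 :=
        ((sL.hasDerivAt_pt t θ).div_const 2).deriv
      have e2 : pth (fun t θ => L t θ / 2) t θ = pth L t θ / 2 :=
        ((sL.hasDerivAt_pth t θ).div_const 2).deriv
      rw [dbarSq_rot sH sL2, ← mul_assoc, d.wY_mul_exp]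
      unfold dbarSq
      rw [e1, e2, L1, L2]
      ring
    have hleD : ∀ t θ, d.wY t * dbarSq (rotRe d.m (d.H j) fun t θ => L t θ / 2)
        (rotIm d.m (d.H j) fun t θ => L t θ / 2) t θ ≤
          exp (2 * d.γ t) * (d.Wt j t θ ^ 2 + d.Wθ j t θ ^ 2) +
          exp (2 * d.γ t) * (circInt (d.Wθ j) t / (2 * π)) ^ 2 := by
      intro t θ
      rw [eD, ← mul_add]
      refine mul_le_mul_of_nonneg_left ?_ (exp_pos _).le
      nlinarith [sq_nonneg (circInt (d.Wθ j) t / (2 * π) + d.Wθ j t θ), sq_nonneg (d.Wt j t θ),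
        sq_nonneg (circInt (d.Wθ j) t / (2 * π)), sq_nonneg (d.Wθ j t θ)]
    have iD : CylIntegrable (fun t θ => d.wY t * dbarSq (rotRe d.m (d.H j) fun t θ => L t θ / 2)
        (rotIm d.m (d.H j) fun t θ => L t θ / 2) t θ) := by
      refine (i2.add iB).mono (d.smooth_wY.mul (sR.dbarSq sI)).continuous fun t θ => ?_
      rw [abs_of_nonneg (mul_nonneg (d.wY_pos t).le (dbarSq_nonneg _ _))]
      exact hleD t θ
    have bD := cylIntegral_mono iD (i2.add iB) hleD
    rw [cylIntegral_add i2 iB] at bD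
    obtain ⟨g1, g2⟩ := cylIntegrable_gradSq_of_dbarSq sR sI d.contDiff_wY d.abs_deriv_wY_le
      (fun t => (d.wY_pos t).le) iD le_rfl iHL (fun t θ => by positivity)
      (d.smooth_expγ.mul ((sH.pow 2).add (sL2.pow 2))).continuous fun t θ => by
        rw [rotRe_sq_add_rotIm_sq, ← mul_assoc, d.wY_mul_exp, zero_add]
    refine ⟨g1, g2.trans ?_⟩
    have : 0 ≤ C * d.hSq ^ 2 := by positivity
    linarith

theorem exists_stream (n : ℕ) (K : ℝ) (hK : 1 ≤ K) : ∃ ε > 0, ∃ C ≥ 1, ∀ d : GapData n K,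
    d.hSq ≤ ε → ∃ L, d.Stream C L := by
  obtain ⟨ε, hε, C, hC, h⟩ := exists_small_bound n K hK
  refine ⟨min ε 1, by positivity, 200 * C, by linarith, fun d hd => ?_⟩
  have h1 := h d (hd.trans (min_le_left _ _))
  choose L s1 s2 s3 s4 s5 using fun j => d.exists_stream_component hC (hd.trans (min_le_right _ _)) j
    (h1 j).1.1 (h1 j).1.2 (h1 j).2.1 (h1 j).2.2
  exact ⟨L, s1, s2, s3, fun j => (s4 j).1, fun j => (s4 j).2, fun j => (s5 j).1, fun j => (s5 j).2⟩

end GapData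

theorem rotRe_mul_rotRe_neg (m : ℤ) (x y x' y' : ℝ → ℝ → ℝ) (t θ : ℝ) :
    rotRe m x y t θ * rotRe (-m) x' y' t θ - rotIm m x y t θ * rotIm (-m) x' y' t θ =
      x t θ * x' t θ - y t θ * y' t θ := by
  unfold rotRe rotIm
  have h : exp (m * t) * exp (((-m : ℤ) : ℝ) * t) = 1 := by
    rw [← Real.exp_add]; simp
  have h2 := Real.sin_sq_add_cos_sq (m * θ)
  push_cast at h ⊢
  simp only [neg_mul, Real.cos_neg, Real.sin_neg] at h ⊢
  calc _ = exp (m * t) * exp (-(m * t)) * (sin (m * θ) ^ 2 + cos (m * θ) ^ 2) *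
        (x t θ * x' t θ - y t θ * y' t θ) := by ring
    _ = _ := by rw [h, h2]; ring

namespace GapData

variable {K C : ℝ} {d : GapData n K} {L : Fin n → ℝ → ℝ → ℝ}

/-- The real part of `Y = e^{mz} (H + iL/2)`. -/
def yR (d : GapData n K) (L : Fin n → ℝ → ℝ → ℝ) (j : Fin n) : ℝ → ℝ → ℝ :=
  rotRe d.m (d.H j) (fun t θ => L j t θ / 2)

/-- The imaginary part of `Y = e^{mz} (H + iL/2)`. -/
def yI (d : GapData n K) (L : Fin n → ℝ → ℝ → ℝ) (j : Fin n) : ℝ → ℝ → ℝ :=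
  rotIm d.m (d.H j) (fun t θ => L j t θ / 2)

/-- The antisymmetric part of `Re (Y ⊗ F)`. -/
def wedge (d : GapData n K) (L : Fin n → ℝ → ℝ → ℝ) (i j : Fin n) (t θ : ℝ) : ℝ :=
  (d.H i t θ * d.a j t θ + L i t θ / 2 * d.b j t θ) -
    (d.H j t θ * d.a i t θ + L j t θ / 2 * d.b i t θ)

theorem wedge_eq (i j : Fin n) (t θ : ℝ) : d.wedge L i j t θ =
    (d.yR L i t θ * d.P j t θ - d.yI L i t θ * d.Q j t θ) -
      (d.yR L j t θ * d.P i t θ - d.yI L j t θ * d.Q i t θ) := by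
  unfold yR yI P Q
  rw [rotRe_mul_rotRe_neg, rotRe_mul_rotRe_neg]
  unfold wedge
  ring

theorem sum_H_sq_le_wedge (t θ : ℝ) :
    exp (2 * d.u t θ) * ∑ j, d.H j t θ ^ 2 ≤ ∑ i, ∑ j, d.wedge L i j t θ ^ 2 := by
  have h0 : 0 ≤ ∑ i, ∑ j, (d.wedge L i j t θ - d.H i t θ * d.a j t θ) ^ 2 :=
    Finset.sum_nonneg fun i _ => Finset.sum_nonneg fun j _ => sq_nonneg _
  have e1 : ∀ i j, (d.wedge L i j t θ - d.H i t θ * d.a j t θ) ^ 2 = d.wedge L i j t θ ^ 2 -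
      (d.H i t θ ^ 2 * d.a j t θ ^ 2 + (d.H i t θ * L i t θ) * (d.a j t θ * d.b j t θ) -
        2 * ((d.H i t θ * d.a i t θ) * (d.H j t θ * d.a j t θ)) -
        (d.H i t θ * d.b i t θ) * (L j t θ * d.a j t θ)) := fun i j => by
    unfold wedge; ring
  simp only [e1, Finset.sum_sub_distrib, Finset.sum_add_distrib, ← Finset.mul_sum,
    ← Finset.sum_mul, d.sum_a_sq, d.sum_ab, d.sum_Ha, d.sum_Hb] at h0
  linarith

namespace Stream

theorem smooth_half (s : d.Stream C L) (j : Fin n) : SmoothPer (fun t θ => L j t θ / 2) := by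
  simpa only [div_eq_mul_inv] using (s.smooth j).mul (SmoothPer.const (2⁻¹ : ℝ))

theorem smooth_yR (s : d.Stream C L) (j : Fin n) : SmoothPer (d.yR L j) := (d.smooth_H j).rotRe _ (s.smooth_half j)

theorem smooth_yI (s : d.Stream C L) (j : Fin n) : SmoothPer (d.yI L j) := (d.smooth_H j).rotIm _ (s.smooth_half j)

theorem smooth_wedge (s : d.Stream C L) (i j : Fin n) : SmoothPer (d.wedge L i j) :=
  (((d.smooth_H i).mul (d.smooth_a j)).add ((s.smooth_half i).mul (d.smooth_b j))).sub
    (((d.smooth_H j).mul (d.smooth_a i)).add ((s.smooth_half j).mul (d.smooth_b i)))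

theorem pt_wedge (s : d.Stream C L) (i j : Fin n) (t θ : ℝ) : pt (d.wedge L i j) t θ =
    pth (fun t θ => (L i t θ / 2 * d.a j t θ - d.H i t θ * d.b j t θ) -
      (L j t θ / 2 * d.a i t θ - d.H j t θ * d.b i t θ)) t θ +
    (circInt (d.Wθ i) t / (4 * π) * d.b j t θ - circInt (d.Wθ j) t / (4 * π) * d.b i t θ) := by
  have aux : ∀ i j, HasDerivAt (fun r => d.H i r θ * d.a j r θ + L i r θ / 2 * d.b j r θ)
      (pt (d.H i) t θ * d.a j t θ + d.H i t θ * pt (d.a j) t θ +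
        (pt (L i) t θ / 2 * d.b j t θ + L i t θ / 2 * pt (d.b j) t θ)) t := fun i j =>
    (((d.smooth_H i).hasDerivAt_pt t θ).mul ((d.smooth_a j).hasDerivAt_pt t θ)).add
      ((((s.smooth i).hasDerivAt_pt t θ).div_const 2).mul ((d.smooth_b j).hasDerivAt_pt t θ))
  have aux2 : ∀ i j, HasDerivAt (fun r => L i t r / 2 * d.a j t r - d.H i t r * d.b j t r)
      ((pth (L i) t θ / 2 * d.a j t θ + L i t θ / 2 * pth (d.a j) t θ) -
        (pth (d.H i) t θ * d.b j t θ + d.H i t θ * pth (d.b j) t θ)) θ := fun i j =>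
    ((((s.smooth i).hasDerivAt_pth t θ).div_const 2).mul ((d.smooth_a j).hasDerivAt_pth t θ)).sub
      (((d.smooth_H i).hasDerivAt_pth t θ).mul ((d.smooth_b j).hasDerivAt_pth t θ))
  have e1 : pt (d.wedge L i j) t θ = _ := ((aux i j).sub (aux j i)).deriv
  have e2 : pth (fun t θ => (L i t θ / 2 * d.a j t θ - d.H i t θ * d.b j t θ) -
      (L j t θ / 2 * d.a i t θ - d.H j t θ * d.b i t θ)) t θ = _ :=
    ((aux2 i j).sub (aux2 j i)).deriv
  have hw := d.W_antisymm i j t θ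
  have ha : ∀ j, pt (d.a j) t θ = exp (2 * d.u t θ) * d.H j t θ - pth (d.b j) t θ := fun j => by
    linarith [d.pt_a j t θ]
  have hc : ∀ j, circInt (d.Wθ j) t / (4 * π) = circInt (d.Wθ j) t / (2 * π) / 2 := fun j => by
    rw [div_div]; ring_nf
  rw [e1, e2, s.pth_eq, s.pth_eq, s.pt_eq, s.pt_eq, d.pt_b, d.pt_b, ha, ha, hc, hc]
  linear_combination (-1 / 2) * hw

theorem circInt_pt_wedge (s : d.Stream C L) (i j : Fin n) (t : ℝ) : circInt (pt (d.wedge L i j)) t = 0 := by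
  have sB := fun i j => ((s.smooth_half i).mul (d.smooth_a j)).sub ((d.smooth_H i).mul (d.smooth_b j))
  have sP := (sB i j).sub (sB j i)
  have h1 := sP.circInt_pth t
  have c := fun j => (d.smooth_b j).continuous_right t
  have h2 := circInt_add (t := t) (φ := pth (fun t θ => (L i t θ / 2 * d.a j t θ - d.H i t θ * d.b j t θ) -
      (L j t θ / 2 * d.a i t θ - d.H j t θ * d.b i t θ)))
    (ψ := fun t θ => circInt (d.Wθ i) t / (4 * π) * d.b j t θ -
      circInt (d.Wθ j) t / (4 * π) * d.b i t θ) (sP.pth.continuous_right t)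
    (((c j).const_mul _).sub ((c i).const_mul _))
  rw [circInt_sub ((c j).const_mul _) ((c i).const_mul _),
    circInt_mul_left (fun t => circInt (d.Wθ i) t / (4 * π)),
    circInt_mul_left (fun t => circInt (d.Wθ j) t / (4 * π)), d.circInt_b, d.circInt_b, h1] at h2
  have e : circInt (pt (d.wedge L i j)) t = _ :=
    congrArg (fun φ => circInt φ t) (funext fun t => funext fun θ => s.pt_wedge i j t θ)
  rw [e, h2]
  ring

theorem integrable_wedge_sq (s : d.Stream C L) (i j : Fin n) : CylIntegrable (fun t θ => d.wedge L i j t θ ^ 2) := by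
  refine (((s.integrable_HL i).add (s.integrable_HL j)).const_mul (4 * K ^ 2)).mono
    ((s.smooth_wedge i j).pow 2).continuous fun t θ => ?_
  rw [abs_of_nonneg (sq_nonneg _)]
  have h : ∀ i j, (d.H i t θ * d.a j t θ) ^ 2 + (L i t θ / 2 * d.b j t θ) ^ 2 ≤
      K ^ 2 * (exp (2 * d.γ t) * (d.H i t θ ^ 2 + (L i t θ / 2) ^ 2)) := fun i j => by
    have h1 := mul_le_mul_of_nonneg_left ((d.a_sq_le j t θ).trans (d.exp_two_u_le t θ))
      (sq_nonneg (d.H i t θ))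
    have h2 := mul_le_mul_of_nonneg_left ((d.b_sq_le j t θ).trans (d.exp_two_u_le t θ))
      (sq_nonneg (L i t θ / 2))
    linarith
  have h1 := h i j
  have h2 := h j i
  unfold wedge
  have : ∀ x y z w : ℝ, (x + y - (z + w)) ^ 2 ≤ 4 * (x ^ 2 + y ^ 2 + (z ^ 2 + w ^ 2)) := by
    intro x y z w
    nlinarith [sq_nonneg (x - y), sq_nonneg (z - w), sq_nonneg (x + z), sq_nonneg (x + w),
      sq_nonneg (y + z), sq_nonneg (y + w)]
  refine (this _ _ _ _).trans ?_
  linarith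

theorem circInt_wedge (s : d.Stream C L) (i j : Fin n) (t : ℝ) : circInt (d.wedge L i j) t = 0 := by
  have sk := s.smooth_wedge i j
  have hc := circInt_eq_of_pt sk (s.circInt_pt_wedge i j)
  have hi : Integrable (fun _ : ℝ => circInt (d.wedge L i j) t ^ 2) := by
    refine Integrable.mono' ((s.integrable_wedge_sq i j).integrable_circInt.const_mul (2 * π))
      aestronglyMeasurable_const (Eventually.of_forall fun r => ?_)
    rw [Real.norm_of_nonneg (sq_nonneg _), hc t r]
    exact circInt_sq_le (sk.continuous_right r)
  rw [integrable_const_iff] at hi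
  rcases hi with hi | hi
  · exact pow_eq_zero_iff two_ne_zero |>.1 hi
  · exact absurd hi.measure_univ_lt_top (by simp)

end Stream

end GapData

namespace GapData

variable {K C : ℝ} {L : Fin n → ℝ → ℝ → ℝ}

theorem circInt_wY_mul_sq_le (d : GapData n K) {y : ℝ → ℝ → ℝ} (hy : SmoothPer y)
    (i1 : CylIntegrable (fun t θ => d.wY t * y t θ ^ 2))
    (i2 : CylIntegrable (fun t θ => d.wY t * gradSq y t θ)) (t : ℝ) :
    circInt (fun t θ => d.wY t * y t θ ^ 2) t ≤
      2 * cylIntegral (fun t θ => d.wY t * y t θ ^ 2) +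
        cylIntegral (fun t θ => d.wY t * gradSq y t θ) := by
  have s1 : SmoothPer (fun t θ => d.wY t * y t θ ^ 2) := d.smooth_wY.mul (hy.pow 2)
  have hle : ∀ t θ, |pt (fun t θ => d.wY t * y t θ ^ 2) t θ| ≤
      2 * (d.wY t * y t θ ^ 2) + d.wY t * gradSq y t θ := fun t θ => by
    have e : pt (fun t θ => d.wY t * y t θ ^ 2) t θ =
        deriv d.wY t * y t θ ^ 2 + d.wY t * (2 * y t θ * pt y t θ) := by
      rw [(hy.pow 2).pt_mul_left (d.contDiff_wY.differentiable (by simp))]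
      congr 2
      refine (((hy.hasDerivAt_pt t θ).pow 2).congr_deriv ?_).deriv
      ring
    rw [e]
    have h1 := d.abs_deriv_wY_le t
    have hp := d.wY_pos t
    have h2 : d.wY t / (4 * π) ≤ d.wY t :=
      div_le_self hp.le (by linarith [Real.pi_gt_three])
    have h3 : |2 * y t θ * pt y t θ| ≤ y t θ ^ 2 + gradSq y t θ := by
      unfold gradSq
      rw [abs_le]
      constructor <;> nlinarith [sq_nonneg (y t θ - pt y t θ), sq_nonneg (y t θ + pt y t θ),
        sq_nonneg (pth y t θ)]
    calc _ ≤ |deriv d.wY t| * y t θ ^ 2 + d.wY t * |2 * y t θ * pt y t θ| := by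
          refine (abs_add_le _ _).trans (le_of_eq ?_)
          rw [abs_mul, abs_mul, abs_of_pos hp, abs_of_nonneg (sq_nonneg (y t θ))]
      _ ≤ d.wY t * y t θ ^ 2 + d.wY t * (y t θ ^ 2 + gradSq y t θ) := by
          gcongr
          exact h1.trans h2
      _ = _ := by ring
  have i3 := (i1.const_mul 2).add i2
  have i4 : CylIntegrable (pt (fun t θ => d.wY t * y t θ ^ 2)) := i3.mono s1.pt.continuous hle
  have h := abs_le_integral_abs_deriv s1.hasDerivAt_circInt (continuous_circInt s1.pt.continuous)
    i4.integrable_circInt i1.integrable_circInt t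
  refine (le_abs_self _).trans (h.trans ?_)
  rw [← cylIntegral_const_mul, ← cylIntegral_add (i1.const_mul 2) i2, i3.integral_eq]
  have sg : SmoothPer (fun t θ => d.wY t * gradSq y t θ) := d.smooth_wY.mul hy.gradSq
  refine integral_mono i4.integrable_circInt.abs i3.integrable_circInt fun r => ?_
  refine (norm_circInt_le _ r).trans (circInt_mono (s1.pt.continuous_right r).norm ?_
    fun θ _ => hle r θ)
  exact ((s1.continuous_right r).const_mul 2).add (sg.continuous_right r)

theorem circInt_abs_pth_mul_sq_le (d : GapData n K) {y p : ℝ → ℝ → ℝ} {S t : ℝ}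
    (hy : SmoothPer y) (hp : SmoothPer p) (hpK : ∀ θ, d.wF t * p t θ ^ 2 ≤ 2 * K ^ 2)
    (hS : circInt (fun t θ => d.wY t * y t θ ^ 2) t ≤ S) :
    circInt (fun t θ => |pth (fun t θ => y t θ * p t θ) t θ|) t ^ 2 ≤
      2 * (4 * π * K ^ 2 * circInt (fun t θ => d.wY t * gradSq y t θ) t +
        S * circInt (fun t θ => d.wF t * gradSq p t θ) t) := by
  have cy := hy.continuous_right t
  have cy' := hy.pth.continuous_right t
  have cp := hp.continuous_right t
  have cp' := hp.pth.continuous_right t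
  have hw := d.wF_mul_wY t
  have hF := d.wF_pos t
  have hY := d.wY_pos t
  have m1 : circInt (fun t θ => d.wY t * pth y t θ ^ 2) t ≤
      circInt (fun t θ => d.wY t * gradSq y t θ) t := by
    refine circInt_mono (by fun_prop) ((d.smooth_wY.mul hy.gradSq).continuous_right t) fun θ _ => ?_
    exact mul_le_mul_of_nonneg_left (le_add_of_nonneg_left (sq_nonneg _)) hY.le
  have m2 : circInt (fun t θ => d.wF t * pth p t θ ^ 2) t ≤
      circInt (fun t θ => d.wF t * gradSq p t θ) t := by
    refine circInt_mono (by fun_prop) ((d.smooth_wF.mul hp.gradSq).continuous_right t) fun θ _ => ?_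
    exact mul_le_mul_of_nonneg_left (le_add_of_nonneg_left (sq_nonneg _)) hF.le
  have m3 : circInt (fun t θ => d.wF t * p t θ ^ 2) t ≤ 4 * π * K ^ 2 := by
    have := circInt_mono (φ := fun t θ => d.wF t * p t θ ^ 2) (ψ := fun _ _ => 2 * K ^ 2) (t := t)
      (by fun_prop) (by fun_prop) fun θ _ => hpK θ
    rw [circInt_const] at this
    linarith
  have q1 := circInt_mul_sq_le (φ := fun t θ => |pth y t θ|) (ψ := fun t θ => |p t θ|)
    cy'.abs cp.abs
  have q2 := circInt_mul_sq_le (φ := fun t θ => |y t θ|) (ψ := fun t θ => |pth p t θ|)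
    cy.abs cp'.abs
  simp only [sq_abs] at q1 q2
  have r1 : circInt (fun t θ => pth y t θ ^ 2) t * circInt (fun t θ => p t θ ^ 2) t ≤
      circInt (fun t θ => d.wY t * gradSq y t θ) t * (4 * π * K ^ 2) := by
    calc _ = circInt (fun t θ => d.wY t * pth y t θ ^ 2) t *
        circInt (fun t θ => d.wF t * p t θ ^ 2) t := by
          rw [circInt_mul_left d.wY (fun t θ => pth y t θ ^ 2),
            circInt_mul_left d.wF (fun t θ => p t θ ^ 2)]
          linear_combination -(circInt (fun t θ => pth y t θ ^ 2) t *
            circInt (fun t θ => p t θ ^ 2) t) * hw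
      _ ≤ _ := mul_le_mul m1 m3 (circInt_nonneg fun θ => by positivity)
          (circInt_nonneg fun θ => mul_nonneg hY.le (gradSq_nonneg _ _))
  have r2 : circInt (fun t θ => y t θ ^ 2) t * circInt (fun t θ => pth p t θ ^ 2) t ≤
      S * circInt (fun t θ => d.wF t * gradSq p t θ) t := by
    calc _ = circInt (fun t θ => d.wY t * y t θ ^ 2) t *
        circInt (fun t θ => d.wF t * pth p t θ ^ 2) t := by
          rw [circInt_mul_left d.wY (fun t θ => y t θ ^ 2),
            circInt_mul_left d.wF (fun t θ => pth p t θ ^ 2)]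
          linear_combination -(circInt (fun t θ => y t θ ^ 2) t *
            circInt (fun t θ => pth p t θ ^ 2) t) * hw
      _ ≤ _ := mul_le_mul hS m2 (circInt_nonneg fun θ => by positivity)
          ((circInt_nonneg fun θ => by positivity).trans hS)
  have h0 : circInt (fun t θ => |pth (fun t θ => y t θ * p t θ) t θ|) t ≤
      circInt (fun t θ => |pth y t θ| * |p t θ|) t + circInt (fun t θ => |y t θ| * |pth p t θ|) t := by
    rw [← circInt_add (cy'.abs.mul cp.abs) (cy.abs.mul cp'.abs)]
    refine circInt_mono ((hy.mul hp).pth.continuous_right t).abs (by fun_prop) fun θ _ => ?_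
    rw [SmoothPer.pth_mul hy hp, ← abs_mul, ← abs_mul]
    exact abs_add_le _ _
  have h1 := pow_le_pow_left₀ (circInt_nonneg fun θ => abs_nonneg _) h0 2
  refine h1.trans ?_
  nlinarith [sq_nonneg (circInt (fun t θ => |pth y t θ| * |p t θ|) t -
    circInt (fun t θ => |y t θ| * |pth p t θ|) t)]

end GapData

namespace GapData

variable {K C : ℝ} {d : GapData n K} {L : Fin n → ℝ → ℝ → ℝ}

/-- The density controlling the wedge product of `Y` and `F`. -/
def wedgeDensity (d : GapData n K) (L : Fin n → ℝ → ℝ → ℝ) (S : ℝ) (j : Fin n) (t θ : ℝ) : ℝ :=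
  4 * π * K ^ 2 * (d.wY t * (gradSq (d.yR L j) t θ + gradSq (d.yI L j) t θ)) +
    S * (d.wF t * (gradSq (d.P j) t θ + gradSq (d.Q j) t θ))

namespace Stream

theorem circInt_y_le (s : d.Stream C L) (hs : d.hSq ≤ 1) (hC : 0 ≤ C) (j : Fin n) (t : ℝ) :
    circInt (fun t θ => d.wY t * d.yR L j t θ ^ 2) t ≤ 3 * C * d.hSq ∧
      circInt (fun t θ => d.wY t * d.yI L j t θ ^ 2) t ≤ 3 * C * d.hSq := by
  have hh := d.hSq_nonneg
  have key : ∀ y : ℝ → ℝ → ℝ, SmoothPer y →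
      (∀ t θ, y t θ ^ 2 ≤ d.yR L j t θ ^ 2 + d.yI L j t θ ^ 2) →
      (∀ t θ, gradSq y t θ ≤ gradSq (d.yR L j) t θ + gradSq (d.yI L j) t θ) →
      circInt (fun t θ => d.wY t * y t θ ^ 2) t ≤ 3 * C * d.hSq := fun y hy h1 h2 => by
    have l1 : ∀ t θ, d.wY t * y t θ ^ 2 ≤
        exp (2 * d.γ t) * (d.H j t θ ^ 2 + (L j t θ / 2) ^ 2) := fun t θ => by
      have h := mul_le_mul_of_nonneg_left (h1 t θ) (d.wY_pos t).le
      rwa [yR, yI, rotRe_sq_add_rotIm_sq, ← mul_assoc, d.wY_mul_exp] at h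
    have l2 : ∀ t θ, d.wY t * gradSq y t θ ≤
        d.wY t * (gradSq (d.yR L j) t θ + gradSq (d.yI L j) t θ) := fun t θ =>
      mul_le_mul_of_nonneg_left (h2 t θ) (d.wY_pos t).le
    have i1 : CylIntegrable (fun t θ => d.wY t * y t θ ^ 2) :=
      (s.integrable_HL j).mono (d.smooth_wY.mul (hy.pow 2)).continuous fun t θ => by
        rw [abs_of_nonneg (mul_nonneg (d.wY_pos t).le (sq_nonneg _))]
        exact l1 t θ
    have i2 : CylIntegrable (fun t θ => d.wY t * gradSq y t θ) :=
      (s.integrable_gradY j).mono (d.smooth_wY.mul hy.gradSq).continuous fun t θ => by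
        rw [abs_of_nonneg (mul_nonneg (d.wY_pos t).le (gradSq_nonneg _ _))]
        exact l2 t θ
    have b1 := (cylIntegral_mono i1 (s.integrable_HL j) l1).trans (s.integral_HL_le j)
    have b2 := (cylIntegral_mono i2 (s.integrable_gradY j) l2).trans (s.integral_gradY_le j)
    have h := d.circInt_wY_mul_sq_le hy i1 i2 t
    have h3 : C * d.hSq ^ 2 ≤ C * d.hSq := by
      rw [sq]
      exact mul_le_mul_of_nonneg_left (mul_le_of_le_one_left hh hs) hC
    linarith
  exact ⟨key _ (s.smooth_yR j) (fun t θ => le_add_of_nonneg_right (sq_nonneg _))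
      fun t θ => le_add_of_nonneg_right (gradSq_nonneg _ _),
    key _ (s.smooth_yI j) (fun t θ => le_add_of_nonneg_left (sq_nonneg _))
      fun t θ => le_add_of_nonneg_left (gradSq_nonneg _ _)⟩

theorem wedge_sq_le (s : d.Stream C L) (hs : d.hSq ≤ 1) (hC : 0 ≤ C) (i j : Fin n) (t θ : ℝ) :
    d.wedge L i j t θ ^ 2 ≤ circInt (fun t θ => 8 * (d.wedgeDensity L (3 * C * d.hSq) i t θ +
      d.wedgeDensity L (3 * C * d.hSq) j t θ)) t := by
  set S := 3 * C * d.hSq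
  have sR := s.smooth_yR
  have sI := s.smooth_yI
  have sP := d.smooth_P
  have sQ := d.smooth_Q
  have hP : ∀ j θ, d.wF t * d.P j t θ ^ 2 ≤ 2 * K ^ 2 := fun j θ =>
    (mul_le_mul_of_nonneg_left (le_add_of_nonneg_right (sq_nonneg _)) (d.wF_pos t).le).trans
      (d.wF_mul_PQ_le j t θ)
  have hQ : ∀ j θ, d.wF t * d.Q j t θ ^ 2 ≤ 2 * K ^ 2 := fun j θ =>
    (mul_le_mul_of_nonneg_left (le_add_of_nonneg_left (sq_nonneg _)) (d.wF_pos t).le).trans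
      (d.wF_mul_PQ_le j t θ)
  have b1 := d.circInt_abs_pth_mul_sq_le (sR i) (sP j) (hP j) (s.circInt_y_le hs hC i t).1
  have b2 := d.circInt_abs_pth_mul_sq_le (sI i) (sQ j) (hQ j) (s.circInt_y_le hs hC i t).2
  have b3 := d.circInt_abs_pth_mul_sq_le (sR j) (sP i) (hP i) (s.circInt_y_le hs hC j t).1
  have b4 := d.circInt_abs_pth_mul_sq_le (sI j) (sQ i) (hQ i) (s.circInt_y_le hs hC j t).2
  have c1 := ((sR i).mul (sP j)).pth.continuous_right t
  have c2 := ((sI i).mul (sQ j)).pth.continuous_right t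
  have c3 := ((sR j).mul (sP i)).pth.continuous_right t
  have c4 := ((sI j).mul (sQ i)).pth.continuous_right t
  have h0 := (s.smooth_wedge i j).abs_le_circInt_abs_pth (s.circInt_wedge i j t) θ
  have hle : circInt (fun t θ => |pth (d.wedge L i j) t θ|) t ≤
      (circInt (fun t θ => |pth (fun t θ => d.yR L i t θ * d.P j t θ) t θ|) t +
        circInt (fun t θ => |pth (fun t θ => d.yI L i t θ * d.Q j t θ) t θ|) t) +
      (circInt (fun t θ => |pth (fun t θ => d.yR L j t θ * d.P i t θ) t θ|) t +
        circInt (fun t θ => |pth (fun t θ => d.yI L j t θ * d.Q i t θ) t θ|) t) := by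
    rw [← circInt_add c1.abs c2.abs, ← circInt_add c3.abs c4.abs,
      ← circInt_add (c1.abs.add c2.abs) (c3.abs.add c4.abs)]
    refine circInt_mono ((s.smooth_wedge i j).pth.continuous_right t).abs
      ((c1.abs.add c2.abs).add (c3.abs.add c4.abs)) fun x _ => ?_
    have e : pth (d.wedge L i j) t x = _ :=
      congrArg (fun φ => pth φ t x) (funext fun t => funext fun θ => d.wedge_eq (L := L) i j t θ)
    have e2 := (((((sR i).mul (sP j)).hasDerivAt_pth t x).sub
      (((sI i).mul (sQ j)).hasDerivAt_pth t x)).sub ((((sR j).mul (sP i)).hasDerivAt_pth t x).sub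
      (((sI j).mul (sQ i)).hasDerivAt_pth t x))).deriv
    rw [e]
    refine (congrArg abs e2).trans_le ?_
    exact (abs_sub _ _).trans (add_le_add (abs_sub _ _) (abs_sub _ _))
  have h1 := pow_le_pow_left₀ (abs_nonneg _) (h0.trans hle) 2
  rw [sq_abs] at h1
  have four : ∀ x y z w : ℝ, (x + y + (z + w)) ^ 2 ≤ 4 * (x ^ 2 + y ^ 2 + (z ^ 2 + w ^ 2)) := by
    intro x y z w
    nlinarith [sq_nonneg (x - y), sq_nonneg (z - w), sq_nonneg (x - z), sq_nonneg (x - w),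
      sq_nonneg (y - z), sq_nonneg (y - w)]
  refine (h1.trans (four _ _ _ _)).trans ?_
  have cY : ∀ {y : ℝ → ℝ → ℝ}, SmoothPer y → Continuous fun θ => d.wY t * gradSq y t θ :=
    fun hy => (d.smooth_wY.mul hy.gradSq).continuous_right t
  have cF : ∀ {y : ℝ → ℝ → ℝ}, SmoothPer y → Continuous fun θ => d.wF t * gradSq y t θ :=
    fun hy => (d.smooth_wF.mul hy.gradSq).continuous_right t
  have ed : ∀ j, d.wedgeDensity L S j = fun t θ =>
      4 * π * K ^ 2 * (d.wY t * gradSq (d.yR L j) t θ + d.wY t * gradSq (d.yI L j) t θ) +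
        S * (d.wF t * gradSq (d.P j) t θ + d.wF t * gradSq (d.Q j) t θ) := fun j => by
    funext t θ
    unfold wedgeDensity
    ring
  have hd : ∀ j, circInt (d.wedgeDensity L S j) t = 4 * π * K ^ 2 *
      (circInt (fun t θ => d.wY t * gradSq (d.yR L j) t θ) t +
        circInt (fun t θ => d.wY t * gradSq (d.yI L j) t θ) t) +
      S * (circInt (fun t θ => d.wF t * gradSq (d.P j) t θ) t +
        circInt (fun t θ => d.wF t * gradSq (d.Q j) t θ) t) := fun j => by
    rw [ed, ← circInt_add (cY (sR j)) (cY (sI j)), ← circInt_add (cF (sP j)) (cF (sQ j)),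
      ← circInt_mul_left (fun _ => 4 * π * K ^ 2), ← circInt_mul_left (fun _ => S),
      ← circInt_add]
    · exact ((cY (sR j)).add (cY (sI j))).const_mul _
    · exact ((cF (sP j)).add (cF (sQ j))).const_mul _
  have cd : ∀ j, Continuous (d.wedgeDensity L S j t) := fun j => by
    rw [ed]
    exact (((cY (sR j)).add (cY (sI j))).const_mul _).add
      (((cF (sP j)).add (cF (sQ j))).const_mul _)
  rw [circInt_mul_left (fun _ => (8 : ℝ)) (fun t θ => d.wedgeDensity L S i t θ +
    d.wedgeDensity L S j t θ), circInt_add (cd i) (cd j), hd, hd]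
  linarith

theorem integral_wedgeDensity (s : d.Stream C L) (hC : 0 ≤ C) (j : Fin n) :
    CylIntegrable (d.wedgeDensity L (3 * C * d.hSq) j) ∧
      cylIntegral (d.wedgeDensity L (3 * C * d.hSq) j) ≤
        (4 * π * K ^ 2 * C + 12 * C * K ^ 4) * d.hSq ^ 2 := by
  have hF := d.gradF_bound j
  have hh := d.hSq_nonneg
  have i1 := (s.integrable_gradY j).const_mul (4 * π * K ^ 2)
  have i2 := hF.1.const_mul (3 * C * d.hSq)
  refine ⟨i1.add i2, ?_⟩
  have e : cylIntegral (d.wedgeDensity L (3 * C * d.hSq) j) = _ := cylIntegral_add i1 i2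
  rw [e, cylIntegral_const_mul, cylIntegral_const_mul]
  have h1 := mul_le_mul_of_nonneg_left (s.integral_gradY_le j)
    (by positivity : 0 ≤ 4 * π * K ^ 2)
  have h2 := mul_le_mul_of_nonneg_left hF.2 (by positivity : 0 ≤ 3 * C * d.hSq)
  exact (add_le_add h1 h2).trans (le_of_eq (by ring))

theorem integral_wedge_sq_le (s : d.Stream C L) (hs : d.hSq ≤ 1) (hC : 0 ≤ C) (i j : Fin n) :
    cylIntegral (fun t θ => d.wedge L i j t θ ^ 2) ≤
      32 * π * (4 * π * K ^ 2 * C + 12 * C * K ^ 4) * d.hSq ^ 2 := by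
  obtain ⟨i1, b1⟩ := s.integral_wedgeDensity hC i
  obtain ⟨i2, b2⟩ := s.integral_wedgeDensity hC j
  have h := (((i1.add i2).const_mul 8).of_le_circInt (φ := fun t θ => d.wedge L i j t θ ^ 2)
    ((s.smooth_wedge i j).pow 2).continuous fun t θ => by
      rw [abs_of_nonneg (sq_nonneg _)]; exact s.wedge_sq_le hs hC i j t θ).2
  rw [cylIntegral_const_mul, cylIntegral_add i1 i2] at h
  have := mul_le_mul_of_nonneg_left (add_le_add b1 b2) (by positivity : 0 ≤ 16 * π)
  linarith

theorem hSq_le (s : d.Stream C L) (hs : d.hSq ≤ 1) (hC : 0 ≤ C) :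
    d.hSq ≤ K ^ 2 * n ^ 2 * (32 * π * (4 * π * K ^ 2 * C + 12 * C * K ^ 4)) * d.hSq ^ 2 := by
  have i1 : CylIntegrable (fun t θ => ∑ j, exp (2 * d.γ t) * d.H j t θ ^ 2) :=
    CylIntegrable.sum fun j _ => d.integrable_H j
  have i2 : ∀ i, CylIntegrable (fun t θ => ∑ j, d.wedge L i j t θ ^ 2) := fun i =>
    CylIntegrable.sum fun j _ => s.integrable_wedge_sq i j
  have i3 : CylIntegrable (fun t θ => ∑ i, ∑ j, d.wedge L i j t θ ^ 2) :=
    CylIntegrable.sum fun i _ => i2 i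
  have e1 : d.hSq = cylIntegral (fun t θ => ∑ j, exp (2 * d.γ t) * d.H j t θ ^ 2) :=
    (cylIntegral_sum fun j _ => d.integrable_H j).symm
  have h1 := cylIntegral_mono i1 (i3.const_mul (K ^ 2)) fun t θ => by
    rw [← Finset.mul_sum]
    have h2 := mul_le_mul_of_nonneg_left (d.sum_H_sq_le_wedge (L := L) t θ) (sq_nonneg K)
    have h3 := mul_le_mul_of_nonneg_right (d.exp_two_γ_le t θ)
      (Finset.sum_nonneg fun j _ => sq_nonneg (d.H j t θ) : 0 ≤ ∑ j, d.H j t θ ^ 2)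
    linarith
  rw [cylIntegral_const_mul, cylIntegral_sum fun i _ => i2 i, ← e1] at h1
  refine h1.trans ?_
  rw [mul_assoc, mul_assoc]
  refine mul_le_mul_of_nonneg_left ?_ (sq_nonneg K)
  have h2 : ∀ i, cylIntegral (fun t θ => ∑ j, d.wedge L i j t θ ^ 2) ≤
      n * (32 * π * (4 * π * K ^ 2 * C + 12 * C * K ^ 4) * d.hSq ^ 2) := fun i => by
    rw [cylIntegral_sum fun j _ => s.integrable_wedge_sq i j]
    refine (Finset.sum_le_sum fun j _ => s.integral_wedge_sq_le hs hC i j).trans (le_of_eq ?_)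
    simp
  refine (Finset.sum_le_sum fun i _ => h2 i).trans (le_of_eq ?_)
  simp
  ring

end Stream

theorem eq_zero_of_hSq_eq_zero (d : GapData n K) (h : d.hSq = 0) (j : Fin n) (t θ : ℝ) :
    d.H j t θ = 0 ∧ gradSq (d.P j) t θ = 0 ∧ gradSq (d.Q j) t θ = 0 := by
  have hj : cylIntegral (fun t θ => exp (2 * d.γ t) * d.H j t θ ^ 2) = 0 :=
    le_antisymm ((d.integral_H_le j).trans h.le) (d.integral_H_nonneg j)
  have h1 := (d.smooth_expγ.mul ((d.smooth_H j).pow 2)).eq_zero_of_cylIntegral_eq_zero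
    (fun t θ => by positivity) (d.integrable_H j) hj t θ
  have hn : ∀ t θ, 0 ≤ d.wF t * (gradSq (d.P j) t θ + gradSq (d.Q j) t θ) := fun t θ =>
    mul_nonneg (d.wF_pos t).le (add_nonneg (gradSq_nonneg _ _) (gradSq_nonneg _ _))
  obtain ⟨i2, b2⟩ := d.gradF_bound j
  rw [h, mul_zero] at b2
  have h2 := (d.smooth_wF.mul ((d.smooth_P j).gradSq.add (d.smooth_Q j).gradSq)
    ).eq_zero_of_cylIntegral_eq_zero hn i2 (le_antisymm b2 (cylIntegral_nonneg hn)) t θ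
  have h3 := (mul_eq_zero.1 h2).resolve_left (d.wF_pos t).ne'
  have h4 := gradSq_nonneg (p := d.P j) t θ
  have h5 := gradSq_nonneg (p := d.Q j) t θ
  refine ⟨?_, by linarith, by linarith⟩
  exact pow_eq_zero_iff two_ne_zero |>.1 ((mul_eq_zero.1 h1).resolve_left (exp_pos _).ne')

/-- The gap phenomenon: small weighted mean curvature forces vanishing mean curvature and constant
`e^{-mz} ∂_z f`. -/
theorem exists_gap (n : ℕ) (K : ℝ) (hK : 1 ≤ K) : ∃ ε > 0, ∀ d : GapData n K, d.hSq ≤ ε →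
    ∀ j t θ, d.H j t θ = 0 ∧ gradSq (d.P j) t θ = 0 ∧ gradSq (d.Q j) t θ = 0 := by
  obtain ⟨ε, hε, C, hC, h⟩ := exists_stream n K hK
  have hC0 : 0 ≤ C := by linarith
  set D := K ^ 2 * n ^ 2 * (32 * π * (4 * π * K ^ 2 * C + 12 * C * K ^ 4))
  have hD : 0 ≤ D := by positivity
  refine ⟨min ε (min 1 (1 / (D + 1))), by positivity, fun d hd => ?_⟩
  obtain ⟨L, s⟩ := h d (hd.trans (min_le_left _ _))
  have hd1 := hd.trans ((min_le_right _ _).trans (min_le_left _ _))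
  have hd2 := hd.trans ((min_le_right _ _).trans (min_le_right _ _))
  have h1 := s.hSq_le hd1 hC0
  have h0 := d.hSq_nonneg
  refine d.eq_zero_of_hSq_eq_zero (le_antisymm ?_ h0)
  by_contra! hpos
  rw [le_div_iff₀ (by positivity)] at hd2
  have h2 : d.hSq * 1 ≤ d.hSq * (D * d.hSq) := by linarith
  have := le_of_mul_le_mul_left h2 hpos
  linarith

end GapData

theorem GapData.pt_eq_mul {K : ℝ} (d : GapData n K) {j : Fin n} {t θ : ℝ}
    (hP : gradSq (d.P j) t θ = 0) (hQ : gradSq (d.Q j) t θ = 0) :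
    pt (d.a j) t θ = d.m * d.a j t θ ∧ pt (d.b j) t θ = d.m * d.b j t θ := by
  have hb := (d.smooth_b j).neg
  have h1 : pt (d.P j) t θ = 0 := by
    unfold gradSq at hP
    nlinarith [sq_nonneg (pt (d.P j) t θ), sq_nonneg (pth (d.P j) t θ)]
  have h2 : pt (d.Q j) t θ = 0 := by
    unfold gradSq at hQ
    nlinarith [sq_nonneg (pt (d.Q j) t θ), sq_nonneg (pth (d.Q j) t θ)]
  have e : pt (fun t θ => -d.b j t θ) t θ = -pt (d.b j) t θ :=
    ((d.smooth_b j).hasDerivAt_pt t θ).neg.deriv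
  set x : ℝ → ℝ → ℝ := fun t θ => pt (d.a j) t θ - d.m * d.a j t θ with hx
  set y : ℝ → ℝ → ℝ := fun t θ => pt (fun t θ => -d.b j t θ) t θ - d.m * -d.b j t θ with hy
  have h3 : rotRe (-d.m) x y t θ = 0 := by
    rw [← h1, P, pt_rotRe (d.smooth_a j) hb]
    simp only [rotRe, hx, hy]
    push_cast
    ring
  have h4 : rotIm (-d.m) x y t θ = 0 := by
    rw [← h2, Q, pt_rotIm (d.smooth_a j) hb]
    simp only [rotIm, hx, hy]
    push_cast
    ring
  have h5 := rot_inv_re d.m x y t θ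
  have h6 := rot_inv_im d.m x y t θ
  rw [h3, h4] at h5 h6
  simp only [hx, hy, e] at h5 h6
  constructor <;> linarith

section Inner

variable {V : Type*} [NormedAddCommGroup V] [InnerProductSpace ℝ V] {φ ψ : ℝ → ℝ → V}

protected theorem SmoothPer.inner (hφ : SmoothPer φ) (hψ : SmoothPer ψ) :
    SmoothPer (fun t θ => ⟪φ t θ, ψ t θ⟫_ℝ) :=
  ⟨hφ.smooth.inner ℝ hψ.smooth, fun t θ => by simp only [hφ.per, hψ.per]⟩

theorem SmoothPer.pt_inner (hφ : SmoothPer φ) (hψ : SmoothPer ψ) (t θ : ℝ) :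
    _root_.pt (fun t θ => ⟪φ t θ, ψ t θ⟫_ℝ) t θ =
      ⟪φ t θ, _root_.pt ψ t θ⟫_ℝ + ⟪_root_.pt φ t θ, ψ t θ⟫_ℝ :=
  ((hφ.hasDerivAt_pt t θ).inner ℝ (hψ.hasDerivAt_pt t θ)).deriv

theorem SmoothPer.pth_inner (hφ : SmoothPer φ) (hψ : SmoothPer ψ) (t θ : ℝ) :
    _root_.pth (fun t θ => ⟪φ t θ, ψ t θ⟫_ℝ) t θ =
      ⟪φ t θ, _root_.pth ψ t θ⟫_ℝ + ⟪_root_.pth φ t θ, ψ t θ⟫_ℝ :=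
  ((hφ.hasDerivAt_pth t θ).inner ℝ (hψ.hasDerivAt_pth t θ)).deriv

end Inner

section Conformal

variable {f : ℝ → ℝ → EuclideanSpace ℝ (Fin n)} {u : ℝ → ℝ → ℝ}

namespace ConfImm

theorem smoothPer_f (h : ConfImm f u univ) : SmoothPer f := ⟨h.smooth_f, h.periodic_f⟩

theorem smoothPer_u (h : ConfImm f u univ) : SmoothPer u := ⟨h.smooth_u, h.periodic_u⟩

theorem smoothPer_exp (h : ConfImm f u univ) (c : ℝ) : SmoothPer (fun t θ => exp (c * u t θ)) :=
  ((SmoothPer.const c).mul h.smoothPer_u).comp (g := exp) Real.contDiff_exp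

theorem pt_exp_mul (h : ConfImm f u univ) (c t θ : ℝ) :
    pt (fun t θ => exp (c * u t θ)) t θ = c * pt u t θ * exp (c * u t θ) :=
  (((h.smoothPer_u.hasDerivAt_pt t θ).const_mul c).exp.congr_deriv (by ring)).deriv

theorem pth_exp_mul (h : ConfImm f u univ) (c t θ : ℝ) :
    pth (fun t θ => exp (c * u t θ)) t θ = c * pth u t θ * exp (c * u t θ) :=
  (((h.smoothPer_u.hasDerivAt_pth t θ).const_mul c).exp.congr_deriv (by ring)).deriv

theorem inner_tt (h : ConfImm f u univ) (t θ : ℝ) :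
    ⟪pt f t θ, pt f t θ⟫_ℝ = exp (2 * u t θ) := by
  rw [real_inner_self_eq_norm_sq, h.conf_t t (mem_univ t)]

theorem inner_θθ (h : ConfImm f u univ) (t θ : ℝ) :
    ⟪pth f t θ, pth f t θ⟫_ℝ = exp (2 * u t θ) := by
  rw [real_inner_self_eq_norm_sq, h.conf_th t (mem_univ t)]

theorem inner_tθ (h : ConfImm f u univ) (t θ : ℝ) : ⟪pt f t θ, pth f t θ⟫_ℝ = 0 :=
  h.conf_orth t (mem_univ t) θ

theorem inner_pt_pt_pt (h : ConfImm f u univ) (t θ : ℝ) :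
    ⟪pt (pt f) t θ, pt f t θ⟫_ℝ = pt u t θ * exp (2 * u t θ) := by
  have h1 := h.smoothPer_f.pt.pt_inner h.smoothPer_f.pt t θ
  simp only [h.inner_tt] at h1
  rw [h.pt_exp_mul, real_inner_comm] at h1
  linarith

theorem inner_pth_pt_pt (h : ConfImm f u univ) (t θ : ℝ) :
    ⟪pth (pt f) t θ, pt f t θ⟫_ℝ = pth u t θ * exp (2 * u t θ) := by
  have h1 := h.smoothPer_f.pt.pth_inner h.smoothPer_f.pt t θ
  simp only [h.inner_tt] at h1
  rw [h.pth_exp_mul, real_inner_comm] at h1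
  linarith

theorem inner_pth_pt_pth (h : ConfImm f u univ) (t θ : ℝ) :
    ⟪pth (pt f) t θ, pth f t θ⟫_ℝ = pt u t θ * exp (2 * u t θ) := by
  have h1 := h.smoothPer_f.pth.pt_inner h.smoothPer_f.pth t θ
  simp only [h.inner_θθ] at h1
  rw [h.pt_exp_mul, real_inner_comm, h.smoothPer_f.pt_pth] at h1
  linarith

theorem inner_pth_pth_pth (h : ConfImm f u univ) (t θ : ℝ) :
    ⟪pth (pth f) t θ, pth f t θ⟫_ℝ = pth u t θ * exp (2 * u t θ) := by
  have h1 := h.smoothPer_f.pth.pth_inner h.smoothPer_f.pth t θ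
  simp only [h.inner_θθ] at h1
  rw [h.pth_exp_mul, real_inner_comm] at h1
  linarith

theorem inner_pt_pt_pth (h : ConfImm f u univ) (t θ : ℝ) :
    ⟪pt (pt f) t θ, pth f t θ⟫_ℝ = -(pth u t θ * exp (2 * u t θ)) := by
  have h1 := h.smoothPer_f.pt.pt_inner h.smoothPer_f.pth t θ
  have e : pt (fun _ _ => (0 : ℝ)) t θ = 0 := deriv_const _ _
  simp only [h.inner_tθ] at h1
  rw [e, h.smoothPer_f.pt_pth, real_inner_comm, h.inner_pth_pt_pt] at h1
  linarith

theorem inner_pth_pth_pt (h : ConfImm f u univ) (t θ : ℝ) :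
    ⟪pth (pth f) t θ, pt f t θ⟫_ℝ = -(pt u t θ * exp (2 * u t θ)) := by
  have h1 := h.smoothPer_f.pt.pth_inner h.smoothPer_f.pth t θ
  have e : pth (fun _ _ => (0 : ℝ)) t θ = 0 := deriv_const _ _
  simp only [h.inner_tθ] at h1
  rw [e, real_inner_comm, h.inner_pth_pt_pth] at h1
  linarith

theorem inner_Att_pt (h : ConfImm f u univ) (t θ : ℝ) : ⟪Att f u t θ, pt f t θ⟫_ℝ = 0 := by
  simp only [Att, inner_add_left, inner_sub_left, real_inner_smul_left, h.inner_pt_pt_pt,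
    h.inner_tt, real_inner_comm (pt f t θ) (pth f t θ), h.inner_tθ]
  ring

theorem inner_Att_pth (h : ConfImm f u univ) (t θ : ℝ) : ⟪Att f u t θ, pth f t θ⟫_ℝ = 0 := by
  simp only [Att, inner_add_left, inner_sub_left, real_inner_smul_left, h.inner_pt_pt_pth,
    h.inner_θθ, h.inner_tθ]
  ring

theorem Atth_eq (h : ConfImm f u univ) (t θ : ℝ) :
    Atth f u t θ = pth (pt f) t θ - pth u t θ • pt f t θ - pt u t θ • pth f t θ := by
  rw [Atth, h.smoothPer_f.pt_pth]

theorem inner_Atth_pt (h : ConfImm f u univ) (t θ : ℝ) : ⟪Atth f u t θ, pt f t θ⟫_ℝ = 0 := by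
  simp only [h.Atth_eq, inner_sub_left, real_inner_smul_left, h.inner_pth_pt_pt,
    h.inner_tt, real_inner_comm (pt f t θ) (pth f t θ), h.inner_tθ]
  ring

theorem inner_Atth_pth (h : ConfImm f u univ) (t θ : ℝ) : ⟪Atth f u t θ, pth f t θ⟫_ℝ = 0 := by
  simp only [h.Atth_eq, inner_sub_left, real_inner_smul_left, h.inner_pth_pt_pth,
    h.inner_θθ, h.inner_tθ]
  ring

theorem inner_Athth_pt (h : ConfImm f u univ) (t θ : ℝ) : ⟪Athth f u t θ, pt f t θ⟫_ℝ = 0 := by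
  simp only [Athth, inner_add_left, inner_sub_left, real_inner_smul_left, h.inner_pth_pth_pt,
    h.inner_tt, real_inner_comm (pt f t θ) (pth f t θ), h.inner_tθ]
  ring

theorem inner_Athth_pth (h : ConfImm f u univ) (t θ : ℝ) : ⟪Athth f u t θ, pth f t θ⟫_ℝ = 0 := by
  simp only [Athth, inner_add_left, inner_sub_left, real_inner_smul_left, h.inner_pth_pth_pth,
    h.inner_θθ, h.inner_tθ]
  ring

theorem Hmc_eq (f : ℝ → ℝ → EuclideanSpace ℝ (Fin n)) (u : ℝ → ℝ → ℝ) (t θ : ℝ) :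
    Hmc f u t θ = exp (-(2 * u t θ)) • (Att f u t θ + Athth f u t θ) := by
  rw [Hmc, Att, Athth]
  congr 1
  abel

theorem inner_Hmc_pt (h : ConfImm f u univ) (t θ : ℝ) : ⟪Hmc f u t θ, pt f t θ⟫_ℝ = 0 := by
  rw [Hmc_eq, real_inner_smul_left, inner_add_left, h.inner_Att_pt, h.inner_Athth_pt]
  simp

theorem inner_Hmc_pth (h : ConfImm f u univ) (t θ : ℝ) : ⟪Hmc f u t θ, pth f t θ⟫_ℝ = 0 := by
  rw [Hmc_eq, real_inner_smul_left, inner_add_left, h.inner_Att_pth, h.inner_Athth_pth]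
  simp

/-- The Gauss equation. -/
theorem laplacian_u (h : ConfImm f u univ) (t θ : ℝ) :
    (pt (pt u) t θ + pth (pth u) t θ) * exp (2 * u t θ) =
      ‖Atth f u t θ‖ ^ 2 - ⟪Att f u t θ, Athth f u t θ⟫_ℝ := by
  have sf := h.smoothPer_f
  have su := h.smoothPer_u
  have h1 := sf.pt.pth.pth_inner sf.pt t θ
  have h2 := sf.pth.pth.pt_inner sf.pt t θ
  simp only [h.inner_pth_pt_pt] at h1
  simp only [h.inner_pth_pth_pt] at h2
  have e1 : pth (fun t θ => pth u t θ * exp (2 * u t θ)) t θ =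
      pth (pth u) t θ * exp (2 * u t θ) + pth u t θ * (2 * pth u t θ * exp (2 * u t θ)) := by
    rw [SmoothPer.pth_mul su.pth (h.smoothPer_exp 2), h.pth_exp_mul]
  have e2 : pt (fun t θ => -(pt u t θ * exp (2 * u t θ))) t θ =
      -(pt (pt u) t θ * exp (2 * u t θ) + pt u t θ * (2 * pt u t θ * exp (2 * u t θ))) := by
    have := ((su.pt.mul (h.smoothPer_exp 2)).hasDerivAt_pt t θ).neg.deriv
    rw [SmoothPer.pt_mul su.pt (h.smoothPer_exp 2), h.pt_exp_mul] at this
    exact this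
  have e3 : pt (pth (pth f)) t θ = pth (pth (pt f)) t θ := by
    rw [sf.pth.pt_pth, sf.pt_pth_fun]
  rw [e1] at h1
  rw [e2, e3] at h2
  have t1 : pth (pt f) t θ = Atth f u t θ + (pth u t θ • pt f t θ + pt u t θ • pth f t θ) := by
    rw [h.Atth_eq]; abel
  have t2 : pt (pt f) t θ = Att f u t θ + (pt u t θ • pt f t θ - pth u t θ • pth f t θ) := by
    rw [Att]; abel
  have t3 : pth (pth f) t θ = Athth f u t θ - (pt u t θ • pt f t θ - pth u t θ • pth f t θ) := by
    rw [Athth]; abel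
  have h3 : ⟪pth (pt f) t θ, pth (pt f) t θ⟫_ℝ = ‖Atth f u t θ‖ ^ 2 +
      (pth u t θ ^ 2 + pt u t θ ^ 2) * exp (2 * u t θ) := by
    rw [t1]
    simp only [inner_add_left, inner_add_right, real_inner_smul_left, real_inner_smul_right,
      h.inner_Atth_pt, h.inner_Atth_pth, real_inner_comm (Atth f u t θ), h.inner_tt, h.inner_θθ,
      h.inner_tθ, real_inner_comm (pt f t θ) (pth f t θ),
      real_inner_self_eq_norm_sq (Atth f u t θ)]
    ring
  have h4 : ⟪pth (pth f) t θ, pt (pt f) t θ⟫_ℝ = ⟪Att f u t θ, Athth f u t θ⟫_ℝ -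
      (pth u t θ ^ 2 + pt u t θ ^ 2) * exp (2 * u t θ) := by
    rw [t2, t3]
    simp only [inner_add_right, inner_sub_left, inner_sub_right, real_inner_smul_left,
      real_inner_smul_right, h.inner_Athth_pt, h.inner_Athth_pth,
      real_inner_comm (Att f u t θ) (pt f t θ), real_inner_comm (Att f u t θ) (pth f t θ),
      h.inner_Att_pt, h.inner_Att_pth, h.inner_tt, h.inner_θθ,
      h.inner_tθ, real_inner_comm (pt f t θ) (pth f t θ),
      real_inner_comm (Att f u t θ) (Athth f u t θ)]
    ring
  linarith

theorem smoothPer_Att (h : ConfImm f u univ) : SmoothPer (Att f u) :=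
  (h.smoothPer_f.pt.pt.sub (h.smoothPer_u.pt.smul h.smoothPer_f.pt)).add
    (h.smoothPer_u.pth.smul h.smoothPer_f.pth)

theorem smoothPer_Atth (h : ConfImm f u univ) : SmoothPer (Atth f u) :=
  (h.smoothPer_f.pth.pt.sub (h.smoothPer_u.pth.smul h.smoothPer_f.pt)).sub
    (h.smoothPer_u.pt.smul h.smoothPer_f.pth)

theorem smoothPer_Athth (h : ConfImm f u univ) : SmoothPer (Athth f u) :=
  (h.smoothPer_f.pth.pth.add (h.smoothPer_u.pt.smul h.smoothPer_f.pt)).sub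
    (h.smoothPer_u.pth.smul h.smoothPer_f.pth)

theorem smoothPer_exp_neg (h : ConfImm f u univ) : SmoothPer (fun t θ => exp (-(2 * u t θ))) := by
  simpa only [neg_mul] using h.smoothPer_exp (-2)

theorem smoothPer_Hmc (h : ConfImm f u univ) : SmoothPer (Hmc f u) :=
  h.smoothPer_exp_neg.smul (h.smoothPer_f.pt.pt.add h.smoothPer_f.pth.pth)

theorem Adens_eq (f : ℝ → ℝ → EuclideanSpace ℝ (Fin n)) (u : ℝ → ℝ → ℝ) (t θ : ℝ) :
    Adens f u t θ = exp (-(2 * u t θ)) *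
      (‖Att f u t θ‖ ^ 2 + 2 * ‖Atth f u t θ‖ ^ 2 + ‖Athth f u t θ‖ ^ 2) := by
  unfold Adens Asq
  have : exp (-(4 * u t θ)) * exp (2 * u t θ) = exp (-(2 * u t θ)) := by
    rw [← Real.exp_add]; ring_nf
  rw [← this]
  ring

theorem Adens_nonneg (f : ℝ → ℝ → EuclideanSpace ℝ (Fin n)) (u : ℝ → ℝ → ℝ) (t θ : ℝ) :
    0 ≤ Adens f u t θ := by
  rw [Adens_eq]; positivity

theorem smoothPer_Adens (h : ConfImm f u univ) : SmoothPer (Adens f u) := by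
  have e : Adens f u = fun t θ => exp (-(2 * u t θ)) *
      (⟪Att f u t θ, Att f u t θ⟫_ℝ + 2 * ⟪Atth f u t θ, Atth f u t θ⟫_ℝ +
        ⟪Athth f u t θ, Athth f u t θ⟫_ℝ) := by
    funext t θ
    simp only [Adens_eq, real_inner_self_eq_norm_sq]
  rw [e]
  exact h.smoothPer_exp_neg.mul (((h.smoothPer_Att.inner h.smoothPer_Att).add
    ((SmoothPer.const 2).mul (h.smoothPer_Atth.inner h.smoothPer_Atth))).add
    (h.smoothPer_Athth.inner h.smoothPer_Athth))

theorem abs_laplacian_u_le (h : ConfImm f u univ) (t θ : ℝ) :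
    |pt (pt u) t θ + pth (pth u) t θ| ≤ Adens f u t θ / 2 := by
  have h1 : pt (pt u) t θ + pth (pth u) t θ = exp (-(2 * u t θ)) *
      (‖Atth f u t θ‖ ^ 2 - ⟪Att f u t θ, Athth f u t θ⟫_ℝ) := by
    rw [← h.laplacian_u, mul_comm, mul_assoc, ← Real.exp_add]
    simp
  have h2 := abs_real_inner_le_norm (Att f u t θ) (Athth f u t θ)
  rw [h1, Adens_eq, abs_mul, abs_of_pos (exp_pos _), mul_div_assoc]
  refine mul_le_mul_of_nonneg_left ?_ (exp_pos _).le
  rw [abs_le] at h2 ⊢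
  constructor <;> nlinarith [sq_nonneg (‖Att f u t θ‖ - ‖Athth f u t θ‖),
    sq_nonneg (‖Atth f u t θ‖)]

theorem exp_mul_norm_Hmc_sq_le (f : ℝ → ℝ → EuclideanSpace ℝ (Fin n)) (u : ℝ → ℝ → ℝ) (t θ : ℝ) :
    exp (2 * u t θ) * ‖Hmc f u t θ‖ ^ 2 ≤ 2 * Adens f u t θ := by
  have e : exp (2 * u t θ) * exp (-(2 * u t θ)) = 1 := by rw [← Real.exp_add]; simp
  rw [Hmc_eq, norm_smul, Adens_eq, mul_pow, Real.norm_of_nonneg (exp_pos _).le]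
  have h1 := pow_le_pow_left₀ (norm_nonneg _) (norm_add_le (Att f u t θ) (Athth f u t θ)) 2
  calc _ = exp (-(2 * u t θ)) * ‖Att f u t θ + Athth f u t θ‖ ^ 2 := by
        linear_combination exp (-(2 * u t θ)) * ‖Att f u t θ + Athth f u t θ‖ ^ 2 * e
    _ ≤ exp (-(2 * u t θ)) * (2 *
        (‖Att f u t θ‖ ^ 2 + 2 * ‖Atth f u t θ‖ ^ 2 + ‖Athth f u t θ‖ ^ 2)) := by
        refine mul_le_mul_of_nonneg_left ?_ (exp_pos _).le
        nlinarith [sq_nonneg (‖Att f u t θ‖ - ‖Athth f u t θ‖), sq_nonneg (‖Atth f u t θ‖)]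
    _ = _ := by ring

end ConfImm

end Conformal

theorem restrict_univ_prod_Icc_eq_cylMeasure :
    (volume : Measure (ℝ × ℝ)).restrict (univ ×ˢ Icc 0 (2 * π)) = cylMeasure := by
  rw [Measure.volume_eq_prod, ← Measure.prod_restrict, Measure.restrict_univ, cylMeasure,
    Measure.restrict_congr_set Ioc_ae_eq_Icc]

theorem CylIntegrable.exists_circInt_lt {φ : ℝ → ℝ → ℝ} (hi : CylIntegrable φ) {c : ℝ}
    (hc : 0 < c) : ∃ t, circInt φ t < c := by
  by_contra! h
  have h1 : Integrable (fun _ : ℝ => c) := by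
    refine Integrable.mono' hi.integrable_circInt aestronglyMeasurable_const
      (Eventually.of_forall fun t => ?_)
    rw [Real.norm_of_nonneg hc.le]
    exact h t
  rw [integrable_const_iff] at h1
  rcases h1 with h1 | h1
  · exact hc.ne' h1
  · exact absurd h1.measure_univ_lt_top (by simp)

section Conformal

variable {f : ℝ → ℝ → EuclideanSpace ℝ (Fin n)} {u : ℝ → ℝ → ℝ}

namespace ConfImm

/-- Parallel transport of the conformal frame around a circle. -/
theorem four_mul_sin_sq_le (h : ConfImm f u univ) (t : ℝ) :
    4 * sin (circInt (pt u) t / 2) ^ 2 ≤ 2 * π * circInt (Adens f u) t := by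
  have sf := h.smoothPer_f
  have su := h.smoothPer_u
  have cu := su.pt.continuous_right t
  set φ : ℝ → ℝ := fun θ => ∫ s in (0 : ℝ)..θ, pt u t s with hφ
  have dφ : ∀ θ, HasDerivAt φ (pt u t θ) θ := fun θ => (cu.integral_hasStrictDerivAt 0 θ).hasDerivAt
  have cφ : Continuous φ := continuous_iff_continuousAt.2 fun θ => (dφ θ).continuousAt
  set p : ℝ → EuclideanSpace ℝ (Fin n) := fun θ =>
    exp (-u t θ) • (cos (φ θ) • pt f t θ - sin (φ θ) • pth f t θ) with hp
  set q : ℝ → EuclideanSpace ℝ (Fin n) := fun θ =>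
    exp (-u t θ) • (cos (φ θ) • Atth f u t θ - sin (φ θ) • Athth f u t θ) with hq
  have dp : ∀ θ, HasDerivAt p (q θ) θ := fun θ => by
    have h1 := ((su.hasDerivAt_pth t θ).neg.exp).smul
      (((dφ θ).cos.smul (sf.pt.hasDerivAt_pth t θ)).sub
        ((dφ θ).sin.smul (sf.pth.hasDerivAt_pth t θ)))
    refine h1.congr_deriv ?_
    simp only [hq, h.Atth_eq, Athth, Pi.sub_apply, Pi.smul_apply', Pi.neg_apply]
    module
  have cq : Continuous q := by
    have c1 := su.continuous_right t
    have c2 := h.smoothPer_Atth.continuous_right t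
    have c3 := h.smoothPer_Athth.continuous_right t
    fun_prop
  have hqA : ∀ θ, ‖q θ‖ ^ 2 ≤ Adens f u t θ := fun θ => by
    have e : exp (-u t θ) ^ 2 = exp (-(2 * u t θ)) := by
      rw [← Real.exp_nat_mul]; push_cast; ring_nf
    simp only [hq]
    rw [Adens_eq, norm_smul, mul_pow, Real.norm_of_nonneg (exp_pos _).le, e]
    refine mul_le_mul_of_nonneg_left ?_ (exp_pos _).le
    have h1 := pow_le_pow_left₀ (norm_nonneg _)
      (norm_sub_le (cos (φ θ) • Atth f u t θ) (sin (φ θ) • Athth f u t θ)) 2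
    refine h1.trans ?_
    rw [norm_smul, norm_smul, Real.norm_eq_abs, Real.norm_eq_abs]
    have h2 := sin_sq_add_cos_sq (φ θ)
    rw [← sq_abs (sin _), ← sq_abs (cos _)] at h2
    have h3 : (|cos (φ θ)| * ‖Atth f u t θ‖ + |sin (φ θ)| * ‖Athth f u t θ‖) ^ 2 +
        (|sin (φ θ)| * ‖Atth f u t θ‖ - |cos (φ θ)| * ‖Athth f u t θ‖) ^ 2 =
        ‖Atth f u t θ‖ ^ 2 + ‖Athth f u t θ‖ ^ 2 := by
      linear_combination (‖Atth f u t θ‖ ^ 2 + ‖Athth f u t θ‖ ^ 2) * h2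
    nlinarith [sq_nonneg (|sin (φ θ)| * ‖Atth f u t θ‖ - |cos (φ θ)| * ‖Athth f u t θ‖),
      sq_nonneg ‖Att f u t θ‖, sq_nonneg ‖Atth f u t θ‖]
  have h1 : ‖p (2 * π) - p 0‖ ^ 2 ≤ 2 * π * circInt (Adens f u) t := by
    have e1 : circInt (fun _ θ => q θ) t = p (2 * π) - p 0 :=
      intervalIntegral.integral_eq_sub_of_hasDerivAt (fun θ _ => dp θ) (cq.intervalIntegrable _ _)
    rw [← e1]
    have h2 := pow_le_pow_left₀ (norm_nonneg _) (norm_circInt_le (fun _ θ => q θ) t) 2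
    refine h2.trans ((circInt_sq_le (φ := fun _ θ => ‖q θ‖) cq.norm).trans ?_)
    refine mul_le_mul_of_nonneg_left ?_ (by positivity)
    exact circInt_mono (cq.norm.pow 2) (h.smoothPer_Adens.continuous_right t) fun θ _ => hqA θ
  have e2 : ‖p (2 * π) - p 0‖ ^ 2 = 4 * sin (circInt (pt u) t / 2) ^ 2 := by
    have hφ0 : φ 0 = 0 := by simp [hφ]
    have hφ1 : φ (2 * π) = circInt (pt u) t := rfl
    have p1 : u t (2 * π) = u t 0 := by simpa using su.per t 0
    have p2 : pt f t (2 * π) = pt f t 0 := by simpa using sf.pt.per t 0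
    have p3 : pth f t (2 * π) = pth f t 0 := by simpa using sf.pth.per t 0
    have e3 : p (2 * π) - p 0 = exp (-u t 0) •
        ((cos (circInt (pt u) t) - 1) • pt f t 0 - sin (circInt (pt u) t) • pth f t 0) := by
      simp only [hp, hφ0, hφ1, p1, p2, p3, cos_zero, sin_zero]
      module
    have e4 : exp (-u t 0) ^ 2 * exp (2 * u t 0) = 1 := by
      rw [← Real.exp_nat_mul, ← Real.exp_add]; push_cast; ring_nf; simp
    have e5 : cos (circInt (pt u) t) = 1 - 2 * sin (circInt (pt u) t / 2) ^ 2 := by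
      have := cos_two_mul' (circInt (pt u) t / 2)
      have h3 := sin_sq_add_cos_sq (circInt (pt u) t / 2)
      rw [mul_div_cancel₀ _ two_ne_zero] at this
      linarith
    rw [e3, norm_smul, mul_pow, Real.norm_of_nonneg (exp_pos _).le, ← real_inner_self_eq_norm_sq]
    simp only [inner_sub_left, inner_sub_right, real_inner_smul_left, real_inner_smul_right,
      h.inner_tt, h.inner_θθ, h.inner_tθ, real_inner_comm (pt f t 0) (pth f t 0)]
    have h3 := sin_sq_add_cos_sq (circInt (pt u) t)
    linear_combination ((cos (circInt (pt u) t) - 1) ^ 2 + sin (circInt (pt u) t) ^ 2) * e4 +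
      h3 - 2 * e5
  linarith

/-- The mean of `∂_t u` over circles is uniformly close to an integer. -/
theorem exists_rate (h : ConfImm f u univ) (hi : CylIntegrable (Adens f u))
    (hA : cylIntegral (Adens f u) ≤ 1 / 4) :
    ∃ m : ℤ, ∀ t, |circInt (pt u) t / (2 * π) - m| ≤ 1 / (8 * π) := by
  have hπ := Real.pi_pos
  have su := h.smoothPer_u
  obtain ⟨t₀, ht₀⟩ := hi.exists_circInt_lt (c := 1 / (32 * π ^ 3)) (by positivity)
  set α : ℝ → ℝ := fun t => circInt (pt u) t / (2 * π) with hα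
  have dα : ∀ t, HasDerivAt α (circInt (pt (pt u)) t / (2 * π)) t := fun t =>
    (su.pt.hasDerivAt_circInt t).div_const _
  have cα : Continuous (fun t => circInt (pt (pt u)) t / (2 * π)) :=
    (continuous_circInt su.pt.pt.continuous).div_const _
  have hle : ∀ t, |circInt (pt (pt u)) t / (2 * π)| ≤ circInt (Adens f u) t / (4 * π) := fun t => by
    have e : circInt (pt (pt u)) t = circInt (fun t θ => pt (pt u) t θ + pth (pth u) t θ) t := by
      rw [circInt_add (su.pt.pt.continuous_right t) (su.pth.pth.continuous_right t),
        su.pth.circInt_pth, add_zero]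
    have h1 : |circInt (pt (pt u)) t| ≤ circInt (Adens f u) t / 2 := by
      rw [e]
      refine (norm_circInt_le (fun t θ => pt (pt u) t θ + pth (pth u) t θ) t).trans ?_
      have h2 := circInt_mul_left (fun _ => (2⁻¹ : ℝ)) (Adens f u) t
      rw [div_eq_inv_mul, ← h2]
      refine circInt_mono ((su.pt.pt.add su.pth.pth).continuous_right t).norm
        ((h.smoothPer_Adens.continuous_right t).const_mul _) fun θ _ => ?_
      rw [← div_eq_inv_mul]
      exact h.abs_laplacian_u_le t θ
    rw [abs_div, abs_of_pos (by positivity : 0 < 2 * π), div_le_div_iff₀ (by positivity)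
      (by positivity)]
    nlinarith
  have iα : Integrable (fun t => circInt (pt (pt u)) t / (2 * π)) :=
    Integrable.mono' (hi.integrable_circInt.div_const (4 * π)) cα.aestronglyMeasurable
      (Eventually.of_forall hle)
  have hosc : ∀ t, |α t - α t₀| ≤ 1 / (16 * π) := fun t => by
    refine (abs_sub_le_integral_abs_deriv dα cα iα t₀ t).trans ?_
    refine (integral_mono iα.abs (hi.integrable_circInt.div_const (4 * π)) hle).trans ?_
    rw [integral_div, ← hi.integral_eq, div_le_div_iff₀ (by positivity) (by positivity)]
    nlinarith
  refine ⟨round (α t₀), fun t => ?_⟩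
  have hr := abs_sub_round (α t₀)
  have h1 := h.four_mul_sin_sq_le t₀
  have e1 : circInt (pt u) t₀ / 2 = π * (α t₀ - round (α t₀)) + round (α t₀) * π := by
    simp only [hα]; field_simp; ring
  have h2 : |sin (circInt (pt u) t₀ / 2)| = |sin (π * (α t₀ - round (α t₀)))| := by
    rw [e1, sin_add_int_mul_pi, abs_mul]
    simp
  have h3 : 2 * |α t₀ - round (α t₀)| ≤ |sin (π * (α t₀ - round (α t₀)))| := by
    have := Real.mul_abs_le_abs_sin (x := π * (α t₀ - round (α t₀))) (by
      rw [abs_mul, abs_of_pos hπ]; nlinarith)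
    rw [abs_mul, abs_of_pos hπ] at this
    refine le_trans (le_of_eq ?_) this
    field_simp
  have h4 : (2 * |α t₀ - round (α t₀)|) ^ 2 ≤ (1 / (8 * π)) ^ 2 := by
    have h5 := pow_le_pow_left₀ (by positivity) h3 2
    rw [← h2, sq_abs] at h5
    have h6 := mul_lt_mul_of_pos_left ht₀ (by positivity : 0 < 2 * π)
    have e2 : 2 * π * (1 / (32 * π ^ 3)) = 4 * (1 / (8 * π)) ^ 2 := by field_simp; norm_num
    linarith
  have h5 := abs_le_of_sq_le_sq h4 (by positivity)
  have h6 : |α t - round (α t₀)| ≤ |α t - α t₀| + |α t₀ - round (α t₀)| := abs_sub_le _ _ _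
  have h7 := hosc t
  have e3 : 1 / (8 * π) = 2 * (1 / (16 * π)) := by field_simp; norm_num
  rw [abs_of_nonneg (by positivity)] at h5
  show |α t - round (α t₀)| ≤ _
  linarith

end ConfImm

end Conformal

section Coord

variable {φ : ℝ → ℝ → EuclideanSpace ℝ (Fin n)}

theorem SmoothPer.coord (h : SmoothPer φ) (j : Fin n) : SmoothPer (fun t θ => φ t θ j) :=
  h.comp (g := EuclideanSpace.proj (𝕜 := ℝ) j) (EuclideanSpace.proj (𝕜 := ℝ) j).contDiff

theorem SmoothPer.pt_coord (h : SmoothPer φ) (j : Fin n) (t θ : ℝ) :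
    pt (fun t θ => φ t θ j) t θ = pt φ t θ j :=
  ((EuclideanSpace.proj (𝕜 := ℝ) j).hasFDerivAt.comp_hasDerivAt t (h.hasDerivAt_pt t θ)).deriv

theorem SmoothPer.pth_coord (h : SmoothPer φ) (j : Fin n) (t θ : ℝ) :
    pth (fun t θ => φ t θ j) t θ = pth φ t θ j :=
  ((EuclideanSpace.proj (𝕜 := ℝ) j).hasFDerivAt.comp_hasDerivAt θ (h.hasDerivAt_pth t θ)).deriv

theorem EuclideanSpace.real_inner_eq_sum_mul (x y : EuclideanSpace ℝ (Fin n)) :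
    ⟪x, y⟫_ℝ = ∑ j, x j * y j := by
  simp [PiLp.inner_apply, mul_comm]

theorem EuclideanSpace.apply_sq_le_norm_sq (x : EuclideanSpace ℝ (Fin n)) (j : Fin n) :
    x j ^ 2 ≤ ‖x‖ ^ 2 := by
  rw [EuclideanSpace.real_norm_sq_eq]
  exact Finset.single_le_sum (f := fun i => x i ^ 2) (fun i _ => sq_nonneg _) (Finset.mem_univ j)

end Coord

/-- The nonlinear part of the `t`-component of the Willmore current. -/
def willmoreFluxT (f : ℝ → ℝ → EuclideanSpace ℝ (Fin n)) (u : ℝ → ℝ → ℝ) (t θ : ℝ) :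
    EuclideanSpace ℝ (Fin n) :=
  (4 : ℝ) • (exp (-(2 * u t θ)) • (⟪Hmc f u t θ, Att f u t θ⟫_ℝ • pt f t θ +
    ⟪Hmc f u t θ, Atth f u t θ⟫_ℝ • pth f t θ)) - ‖Hmc f u t θ‖ ^ 2 • pt f t θ

/-- The nonlinear part of the `θ`-component of the Willmore current. -/
def willmoreFluxΘ (f : ℝ → ℝ → EuclideanSpace ℝ (Fin n)) (u : ℝ → ℝ → ℝ) (t θ : ℝ) :
    EuclideanSpace ℝ (Fin n) :=
  (4 : ℝ) • (exp (-(2 * u t θ)) • (⟪Hmc f u t θ, Atth f u t θ⟫_ℝ • pt f t θ +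
    ⟪Hmc f u t θ, Athth f u t θ⟫_ℝ • pth f t θ)) - ‖Hmc f u t θ‖ ^ 2 • pth f t θ

namespace ConfImm

variable {f : ℝ → ℝ → EuclideanSpace ℝ (Fin n)} {u : ℝ → ℝ → ℝ}

theorem smoothPer_norm_sq_Hmc (h : ConfImm f u univ) :
    SmoothPer (fun t θ => ‖Hmc f u t θ‖ ^ 2) := by
  simpa only [real_inner_self_eq_norm_sq] using h.smoothPer_Hmc.inner h.smoothPer_Hmc

theorem willmoreOp_eq (h : ConfImm f u univ) (t θ : ℝ) :
    willmoreOp f u t θ = (2 : ℝ) • (pt (pt (Hmc f u)) t θ + pth (pth (Hmc f u)) t θ) +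
      pt (willmoreFluxT f u) t θ + pth (willmoreFluxΘ f u) t θ := by
  have sf := h.smoothPer_f
  have sH := h.smoothPer_Hmc
  have s1 : SmoothPer (fun a b => Real.exp (-(2 * u a b)) • (⟪Hmc f u a b, Att f u a b⟫_ℝ • pt f a b +
      ⟪Hmc f u a b, Atth f u a b⟫_ℝ • pth f a b)) :=
    h.smoothPer_exp_neg.smul (((sH.inner h.smoothPer_Att).smul sf.pt).add
      ((sH.inner h.smoothPer_Atth).smul sf.pth))
  have s2 : SmoothPer (fun a b => Real.exp (-(2 * u a b)) • (⟪Hmc f u a b, Atth f u a b⟫_ℝ • pt f a b +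
      ⟪Hmc f u a b, Athth f u a b⟫_ℝ • pth f a b)) :=
    h.smoothPer_exp_neg.smul (((sH.inner h.smoothPer_Atth).smul sf.pt).add
      ((sH.inner h.smoothPer_Athth).smul sf.pth))
  have s3 := h.smoothPer_norm_sq_Hmc.smul sf.pt
  have s4 := h.smoothPer_norm_sq_Hmc.smul sf.pth
  have e1 : pt (willmoreFluxT f u) t θ = _ :=
    (((s1.hasDerivAt_pt t θ).const_smul (4 : ℝ)).sub (s3.hasDerivAt_pt t θ)).deriv
  have e2 : pth (willmoreFluxΘ f u) t θ = _ :=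
    (((s2.hasDerivAt_pth t θ).const_smul (4 : ℝ)).sub (s4.hasDerivAt_pth t θ)).deriv
  rw [e1, e2, willmoreOp]
  abel

theorem smoothPer_willmoreFluxT (h : ConfImm f u univ) : SmoothPer (willmoreFluxT f u) :=
  ((SmoothPer.const (4 : ℝ)).smul (h.smoothPer_exp_neg.smul
    (((h.smoothPer_Hmc.inner h.smoothPer_Att).smul h.smoothPer_f.pt).add
      ((h.smoothPer_Hmc.inner h.smoothPer_Atth).smul h.smoothPer_f.pth)))).sub
    (h.smoothPer_norm_sq_Hmc.smul h.smoothPer_f.pt)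

theorem smoothPer_willmoreFluxΘ (h : ConfImm f u univ) : SmoothPer (willmoreFluxΘ f u) :=
  ((SmoothPer.const (4 : ℝ)).smul (h.smoothPer_exp_neg.smul
    (((h.smoothPer_Hmc.inner h.smoothPer_Atth).smul h.smoothPer_f.pt).add
      ((h.smoothPer_Hmc.inner h.smoothPer_Athth).smul h.smoothPer_f.pth)))).sub
    (h.smoothPer_norm_sq_Hmc.smul h.smoothPer_f.pth)

theorem inner_Hmc_Att (h : ConfImm f u univ) (t θ : ℝ) :
    ⟪Hmc f u t θ, Att f u t θ⟫_ℝ = ⟪Hmc f u t θ, pt (pt f) t θ⟫_ℝ := by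
  simp [Att, inner_add_right, inner_sub_right, inner_smul_right, h.inner_Hmc_pt, h.inner_Hmc_pth]

theorem inner_Hmc_Atth (h : ConfImm f u univ) (t θ : ℝ) :
    ⟪Hmc f u t θ, Atth f u t θ⟫_ℝ = ⟪Hmc f u t θ, pth (pt f) t θ⟫_ℝ := by
  simp [h.Atth_eq, inner_sub_right, inner_smul_right, h.inner_Hmc_pt, h.inner_Hmc_pth]

theorem inner_Hmc_Athth (h : ConfImm f u univ) (t θ : ℝ) :
    ⟪Hmc f u t θ, Athth f u t θ⟫_ℝ = ⟪Hmc f u t θ, pth (pth f) t θ⟫_ℝ := by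
  simp [Athth, inner_add_right, inner_sub_right, inner_smul_right, h.inner_Hmc_pt, h.inner_Hmc_pth]

theorem norm_Hmc_sq (f : ℝ → ℝ → EuclideanSpace ℝ (Fin n)) (u : ℝ → ℝ → ℝ) (t θ : ℝ) :
    ‖Hmc f u t θ‖ ^ 2 = exp (-(2 * u t θ)) *
      (⟪Hmc f u t θ, Att f u t θ⟫_ℝ + ⟪Hmc f u t θ, Athth f u t θ⟫_ℝ) := by
  rw [← real_inner_self_eq_norm_sq, ← inner_add_right, ← real_inner_smul_right, ← Hmc_eq]

theorem willmoreFluxT_eq (f : ℝ → ℝ → EuclideanSpace ℝ (Fin n)) (u : ℝ → ℝ → ℝ) (t θ : ℝ) :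
    willmoreFluxT f u t θ = (exp (-(2 * u t θ)) *
      (3 * ⟪Hmc f u t θ, Att f u t θ⟫_ℝ - ⟪Hmc f u t θ, Athth f u t θ⟫_ℝ)) • pt f t θ +
      (exp (-(2 * u t θ)) * (4 * ⟪Hmc f u t θ, Atth f u t θ⟫_ℝ)) • pth f t θ := by
  rw [willmoreFluxT, norm_Hmc_sq]
  module

theorem willmoreFluxΘ_eq (f : ℝ → ℝ → EuclideanSpace ℝ (Fin n)) (u : ℝ → ℝ → ℝ) (t θ : ℝ) :
    willmoreFluxΘ f u t θ = (exp (-(2 * u t θ)) * (4 * ⟪Hmc f u t θ, Atth f u t θ⟫_ℝ)) • pt f t θ +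
      (exp (-(2 * u t θ)) *
      (3 * ⟪Hmc f u t θ, Athth f u t θ⟫_ℝ - ⟪Hmc f u t θ, Att f u t θ⟫_ℝ)) • pth f t θ := by
  rw [willmoreFluxΘ, norm_Hmc_sq]
  module

theorem norm_smul_pt_add_smul_pth_sq (h : ConfImm f u univ) (x y t θ : ℝ) :
    ‖x • pt f t θ + y • pth f t θ‖ ^ 2 = exp (2 * u t θ) * (x ^ 2 + y ^ 2) := by
  rw [← real_inner_self_eq_norm_sq]
  simp only [inner_add_left, inner_add_right, real_inner_smul_left, real_inner_smul_right,
    h.inner_tt, h.inner_θθ, h.inner_tθ, real_inner_comm (pt f t θ) (pth f t θ)]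
  ring

theorem willmoreFlux_sq_le (h : ConfImm f u univ) (j : Fin n) (t θ : ℝ) :
    willmoreFluxT f u t θ j ^ 2 + willmoreFluxΘ f u t θ j ^ 2 ≤ 32 * exp (-(2 * u t θ)) *
      (⟪Hmc f u t θ, Att f u t θ⟫_ℝ ^ 2 + ⟪Hmc f u t θ, Atth f u t θ⟫_ℝ ^ 2 +
        ⟪Hmc f u t θ, Athth f u t θ⟫_ℝ ^ 2) := by
  refine (add_le_add (EuclideanSpace.apply_sq_le_norm_sq _ j)
    (EuclideanSpace.apply_sq_le_norm_sq _ j)).trans ?_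
  rw [willmoreFluxT_eq, willmoreFluxΘ_eq, h.norm_smul_pt_add_smul_pth_sq,
    h.norm_smul_pt_add_smul_pth_sq]
  generalize ⟪Hmc f u t θ, Att f u t θ⟫_ℝ = x
  generalize ⟪Hmc f u t θ, Atth f u t θ⟫_ℝ = y
  generalize ⟪Hmc f u t θ, Athth f u t θ⟫_ℝ = z
  have e : exp (2 * u t θ) * exp (-(2 * u t θ)) = 1 := by rw [← Real.exp_add]; simp
  have hE := exp_pos (-(2 * u t θ))
  have e2 : exp (2 * u t θ) * ((exp (-(2 * u t θ)) * (3 * x - z)) ^ 2 +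
      (exp (-(2 * u t θ)) * (4 * y)) ^ 2) + exp (2 * u t θ) * ((exp (-(2 * u t θ)) * (4 * y)) ^ 2 +
      (exp (-(2 * u t θ)) * (3 * z - x)) ^ 2) =
      exp (-(2 * u t θ)) * ((3 * x - z) ^ 2 + 32 * y ^ 2 + (3 * z - x) ^ 2) := by
    linear_combination exp (-(2 * u t θ)) * ((3 * x - z) ^ 2 + 32 * y ^ 2 + (3 * z - x) ^ 2) * e
  rw [e2, mul_assoc (32 : ℝ), mul_left_comm (32 : ℝ)]
  refine mul_le_mul_of_nonneg_left ?_ hE.le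
  nlinarith [sq_nonneg (x + z), sq_nonneg x, sq_nonneg z]

end ConfImm

theorem ConfImm.exp_mul_norm_Hmc_sq_le_of_le {f : ℝ → ℝ → EuclideanSpace ℝ (Fin n)}
    {u : ℝ → ℝ → ℝ} {t θ x K : ℝ} (hx : exp x ≤ K * exp (u t θ)) :
    exp (2 * x) * ‖Hmc f u t θ‖ ^ 2 ≤ 2 * K ^ 2 * Adens f u t θ := by
  have h1 := pow_le_pow_left₀ (exp_pos x).le hx 2
  rw [mul_pow, ← Real.exp_nat_mul, ← Real.exp_nat_mul] at h1
  push_cast at h1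
  have h2 := mul_le_mul_of_nonneg_right h1 (sq_nonneg ‖Hmc f u t θ‖)
  have h3 := mul_le_mul_of_nonneg_left (ConfImm.exp_mul_norm_Hmc_sq_le f u t θ) (sq_nonneg K)
  linarith

namespace ConfWillmore

variable {f : ℝ → ℝ → EuclideanSpace ℝ (Fin n)} {u : ℝ → ℝ → ℝ}

/-- The analytic data attached to a conformal Willmore immersion of the cylinder with bounded
conformal gradient and finite energy. -/
def gapData (h : ConfWillmore f u univ) {β : ℝ} (hβ : 0 < β) (hu : ∀ t θ, gradNorm u t θ ≤ β)
    (hi : CylIntegrable (Adens f u)) (m : ℤ)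
    (hm : ∀ t, |circInt (pt u) t / (2 * π) - m| ≤ 1 / (8 * π)) :
    GapData n (exp (2 * π * β) + β + 32) :=
  have hπ := Real.pi_pos
  have hc := h.toConfImm
  have sf := hc.smoothPer_f
  have su := hc.smoothPer_u
  have sH := hc.smoothPer_Hmc
  have sγ : ContDiff ℝ ∞ (fun t => circInt u t / (2 * π)) := su.contDiff_circInt.div_const _
  have hE := exp_pos (2 * π * β)
  have dγ : ∀ t, HasDerivAt (fun t => circInt u t / (2 * π)) (circInt (pt u) t / (2 * π)) t :=
    fun t => (su.hasDerivAt_circInt t).div_const _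
  have hut : ∀ t θ, |pt u t θ| ≤ β := fun t θ => (abs_le_sqrt
    (by nlinarith [sq_nonneg (pth u t θ)])).trans (hu t θ)
  have huθ : ∀ t θ, |pth u t θ| ≤ β := fun t θ => (abs_le_sqrt
    (by nlinarith [sq_nonneg (pt u t θ)])).trans (hu t θ)
  have hmβ : |(m : ℝ)| ≤ β + 1 := by
    have h1 : |circInt (pt u) 0| ≤ 2 * π * β := by
      rw [← circInt_const β 0]
      exact (norm_circInt_le (pt u) 0).trans (circInt_mono (su.pt.continuous_right 0).norm
        continuous_const fun θ _ => hut 0 θ)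
    have h2 : |circInt (pt u) 0 / (2 * π)| ≤ β := by
      rw [abs_div, abs_of_pos (by positivity : 0 < 2 * π), div_le_iff₀ (by positivity)]
      linarith
    have h3 := hm 0
    have h4 : 1 / (8 * π) ≤ 1 := by
      rw [div_le_one (by positivity)]; nlinarith [Real.pi_gt_three]
    have h5 := abs_sub_abs_le_abs_sub (m : ℝ) (circInt (pt u) 0 / (2 * π))
    rw [abs_sub_comm] at h5
    linarith
  have hosc : ∀ t θ, |u t θ - circInt u t / (2 * π)| ≤ 2 * π * β := fun t θ => by
    have sk := su.sub (SmoothPer.of_left sγ)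
    have e : circInt (fun t θ => u t θ - circInt u t / (2 * π)) t = 0 := by
      rw [circInt_sub (ψ := fun t _ => circInt u t / (2 * π)) (su.continuous_right t)
        continuous_const]
      simp only [circInt, intervalIntegral.integral_const, smul_eq_mul]
      field_simp; ring
    refine (sk.abs_le_circInt_abs_pth e θ).trans ?_
    rw [← circInt_const β t]
    refine circInt_mono (sk.pth.continuous_right t).abs continuous_const fun θ _ => ?_
    have : pth (fun t θ => u t θ - circInt u t / (2 * π)) t θ = pth u t θ :=
      ((su.hasDerivAt_pth t θ).sub_const _).deriv
    rw [this]
    exact huθ t θ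
  have hexp : ∀ x y : ℝ, |x - y| ≤ 2 * π * β → exp x ≤ (exp (2 * π * β) + β + 32) * exp y :=
    fun x y hxy => by
      have h1 : exp x ≤ exp (2 * π * β) * exp y := by
        rw [← Real.exp_add]; exact exp_le_exp.2 (by linarith [le_abs_self (x - y)])
      exact h1.trans (mul_le_mul_of_nonneg_right (by linarith) (exp_pos _).le)
  have hee : ∀ t θ, exp (2 * u t θ) * exp (-(2 * u t θ)) = 1 := fun t θ => by
    rw [← Real.exp_add]; simp
  have hHf : ∀ (φ : ℝ → ℝ → EuclideanSpace ℝ (Fin n)) t θ,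
      ⟪Hmc f u t θ, φ t θ⟫_ℝ = ∑ l, Hmc f u t θ l * φ t θ l := fun φ t θ =>
    EuclideanSpace.real_inner_eq_sum_mul _ _
  { m := m
    a := fun j t θ => pt f t θ j
    b := fun j t θ => pth f t θ j
    H := fun j t θ => Hmc f u t θ j
    Wt := fun j t θ => willmoreFluxT f u t θ j
    Wθ := fun j t θ => willmoreFluxΘ f u t θ j
    u := u
    γ := fun t => circInt u t / (2 * π)
    one_le_K := by linarith
    smooth_a := sf.pt.coord
    smooth_b := sf.pth.coord
    smooth_H := sH.coord
    smooth_Wt := hc.smoothPer_willmoreFluxT.coord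
    smooth_Wθ := hc.smoothPer_willmoreFluxΘ.coord
    smooth_u := su
    smooth_γ := sγ
    abs_m_le := by linarith
    abs_pt_u_le := fun t θ => (hut t θ).trans (by linarith)
    abs_pth_u_le := fun t θ => (huθ t θ).trans (by linarith)
    deriv_γ := fun t => by rw [(dγ t).deriv]; exact hm t
    exp_u_le := fun t θ => hexp _ _ (hosc t θ)
    exp_γ_le := fun t θ => hexp _ _ (by rw [abs_sub_comm]; exact hosc t θ)
    pt_a := fun j t θ => by
      rw [sf.pt.pt_coord, sf.pth.pth_coord]
      simp only [Hmc, PiLp.smul_apply, PiLp.add_apply, smul_eq_mul]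
      linear_combination -(pt (pt f) t θ j + pth (pth f) t θ j) * hee t θ
    pt_b := fun j t θ => by rw [sf.pth.pt_coord, sf.pt.pth_coord, sf.pt_pth]
    sum_a_sq := fun t θ => by
      rw [← EuclideanSpace.real_norm_sq_eq]; exact hc.conf_t t (mem_univ t) θ
    sum_b_sq := fun t θ => by
      rw [← EuclideanSpace.real_norm_sq_eq]; exact hc.conf_th t (mem_univ t) θ
    sum_ab := fun t θ => by
      rw [← EuclideanSpace.real_inner_eq_sum_mul]; exact hc.inner_tθ t θ
    sum_Ha := fun t θ => by rw [← hHf]; exact hc.inner_Hmc_pt t θ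
    sum_Hb := fun t θ => by rw [← hHf]; exact hc.inner_Hmc_pth t θ
    circInt_b := fun j t => by
      have := (sf.coord j).circInt_pth t
      simpa only [funext fun t => funext fun θ => sf.pth_coord j t θ] using this
    div_eq := fun j t θ => by
      have e1 : pt (fun t θ => Hmc f u t θ j) = fun t θ => pt (Hmc f u) t θ j :=
        funext fun t => funext fun θ => sH.pt_coord j t θ
      have e2 : pth (fun t θ => Hmc f u t θ j) = fun t θ => pth (Hmc f u) t θ j :=
        funext fun t => funext fun θ => sH.pth_coord j t θ
      have e3 := congrArg (fun x : EuclideanSpace ℝ (Fin n) => x j)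
        ((hc.willmoreOp_eq t θ).symm.trans (h.willmore t (mem_univ t) θ))
      simp only [PiLp.smul_apply, PiLp.add_apply, PiLp.zero_apply, smul_eq_mul] at e3
      rw [e1, e2, sH.pt.pt_coord, sH.pth.pth_coord, hc.smoothPer_willmoreFluxT.pt_coord,
        hc.smoothPer_willmoreFluxΘ.pth_coord]
      linarith
    W_le := fun j t θ => by
      simp only [sf.pt.pt_coord, sf.pt.pth_coord, sf.pth.pth_coord]
      rw [← hHf (pt (pt f)), ← hHf (pth (pt f)), ← hHf (pth (pth f)), ← hc.inner_Hmc_Att,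
        ← hc.inner_Hmc_Atth, ← hc.inner_Hmc_Athth]
      refine (hc.willmoreFlux_sq_le j t θ).trans (mul_le_mul_of_nonneg_right
        (mul_le_mul_of_nonneg_right (by linarith) (exp_pos _).le) (by positivity))
    W_antisymm := fun i j t θ => by
      simp only [ConfImm.willmoreFluxT_eq, ConfImm.willmoreFluxΘ_eq, PiLp.smul_apply,
        PiLp.add_apply, smul_eq_mul]
      ring
    integrable_H := fun j => by
      refine (hi.const_mul (2 * (exp (2 * π * β) + β + 32) ^ 2)).mono
        (((SmoothPer.of_left (sγ.const_smul (2 : ℝ)).exp).mul ((sH.coord j).pow 2)).continuous)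
        fun t θ => ?_
      have h1 := EuclideanSpace.apply_sq_le_norm_sq (Hmc f u t θ) j
      have h2 := ConfImm.exp_mul_norm_Hmc_sq_le_of_le (f := f)
        (hexp (circInt u t / (2 * π)) (u t θ) (by rw [abs_sub_comm]; exact hosc t θ))
      rw [abs_of_nonneg (by positivity)]
      exact (mul_le_mul_of_nonneg_left h1 (exp_pos _).le).trans h2 }

theorem hSq_gapData_le (h : ConfWillmore f u univ) {β : ℝ} (hβ : 0 < β)
    (hu : ∀ t θ, gradNorm u t θ ≤ β) (hi : CylIntegrable (Adens f u)) (m : ℤ)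
    (hm : ∀ t, |circInt (pt u) t / (2 * π) - m| ≤ 1 / (8 * π)) :
    (h.gapData hβ hu hi m hm).hSq ≤
      2 * (exp (2 * π * β) + β + 32) ^ 2 * cylIntegral (Adens f u) := by
  set d := h.gapData hβ hu hi m hm with hd
  rw [GapData.hSq, ← cylIntegral_sum fun j _ => d.integrable_H j, ← cylIntegral_const_mul]
  refine cylIntegral_mono (CylIntegrable.sum fun j _ => d.integrable_H j) (hi.const_mul _)
    fun t θ => ?_
  rw [← Finset.mul_sum]
  have e : ∑ j, d.H j t θ ^ 2 = ‖Hmc f u t θ‖ ^ 2 := (EuclideanSpace.real_norm_sq_eq (Hmc f u t θ)).symm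
  rw [e]
  exact ConfImm.exp_mul_norm_Hmc_sq_le_of_le (d.exp_γ_le t θ)

end ConfWillmore

theorem ConfImm.secondFundamentalForm_eq_zero {f : ℝ → ℝ → EuclideanSpace ℝ (Fin n)}
    {u : ℝ → ℝ → ℝ} (h : ConfImm f u univ) {m t θ : ℝ} (hH : Hmc f u t θ = 0)
    (ht : pt (pt f) t θ = m • pt f t θ) (hθ : pth (pt f) t θ = m • pth f t θ) :
    Att f u t θ = 0 ∧ Atth f u t θ = 0 ∧ Athth f u t θ = 0 := by
  have hE := (exp_pos (2 * u t θ)).ne'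
  have e1 : pt u t θ = m := by
    have := h.inner_pt_pt_pt t θ
    rw [ht, real_inner_smul_left, h.inner_tt] at this
    exact (mul_right_cancel₀ hE this).symm
  have e2 : pth u t θ = 0 := by
    have := h.inner_pth_pt_pt t θ
    rw [hθ, real_inner_smul_left, real_inner_comm, h.inner_tθ, mul_zero] at this
    exact (mul_eq_zero.1 this.symm).resolve_right hE
  have e3 : pth (pth f) t θ = -(m • pt f t θ) := by
    have := (smul_eq_zero.1 hH).resolve_left (exp_pos _).ne'
    rw [ht] at this
    exact eq_neg_of_add_eq_zero_right this
  refine ⟨?_, ?_, ?_⟩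
  · rw [Att, ht, e1, e2]; simp
  · rw [h.Atth_eq, hθ, e1, e2]; simp
  · rw [Athth, e3, e1, e2]; simp

/-- **Corollary 6.2** (gap theorem on the infinite cylinder). -/
theorem gap_theorem_cylinder (n : ℕ) (β : ℝ) (hβ : 0 < β) :
    ∃ τ > (0 : ℝ), ∀ (f : ℝ → ℝ → EuclideanSpace ℝ (Fin n)) (u : ℝ → ℝ → ℝ),
      ConfWillmore f u Set.univ →
      (∃ b < β, ∀ t θ : ℝ, gradNorm u t θ ≤ b) →
      MeasureTheory.IntegrableOn (fun p : ℝ × ℝ => Adens f u p.1 p.2)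
        ((Set.univ : Set ℝ) ×ˢ Set.Icc (0 : ℝ) (2 * π)) volume →
      Real.sqrt (∫ p in (Set.univ : Set ℝ) ×ˢ Set.Icc (0 : ℝ) (2 * π),
          Adens f u p.1 p.2) < τ →
      ∀ t θ : ℝ, Att f u t θ = 0 ∧ Atth f u t θ = 0 ∧ Athth f u t θ = 0 := by
  set K := exp (2 * π * β) + β + 32 with hK
  have hK1 : 1 ≤ K := by linarith [exp_pos (2 * π * β)]
  obtain ⟨ε, hε, hgap⟩ := GapData.exists_gap n K hK1
  refine ⟨min (1 / 2) (√(ε / (2 * K ^ 2))), by positivity, ?_⟩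
  rintro f u h ⟨b, hb, hu⟩ hi hlt t θ
  rw [restrict_univ_prod_Icc_eq_cylMeasure] at hlt
  rw [IntegrableOn, restrict_univ_prod_Icc_eq_cylMeasure] at hi
  replace hi : CylIntegrable (Adens f u) := hi
  have hA := cylIntegral_nonneg fun t θ => ConfImm.Adens_nonneg f u t θ
  change √(cylIntegral (Adens f u)) < _ at hlt
  have hA1 : cylIntegral (Adens f u) ≤ 1 / 4 := by
    have := (Real.sqrt_le_left (by norm_num)).1 (hlt.le.trans (min_le_left _ _))
    linarith
  have hA2 : cylIntegral (Adens f u) ≤ ε / (2 * K ^ 2) :=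
    (Real.sqrt_le_sqrt_iff (by positivity)).1 (hlt.le.trans (min_le_right _ _))
  obtain ⟨m, hm⟩ := h.toConfImm.exists_rate hi hA1
  have hu' : ∀ t θ, gradNorm u t θ ≤ β := fun t θ => (hu t θ).trans hb.le
  set d := h.gapData hβ hu' hi m hm with hd
  have hsq : d.hSq ≤ ε := by
    refine (h.hSq_gapData_le hβ hu' hi m hm).trans ?_
    rw [le_div_iff₀ (by positivity)] at hA2
    linarith
  have hz := fun j => hgap d hsq j t θ
  have hp := fun j => d.pt_eq_mul (hz j).2.1 (hz j).2.2
  have sf := h.toConfImm.smoothPer_f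
  refine h.toConfImm.secondFundamentalForm_eq_zero (m := m) ?_ ?_ ?_
  · ext j
    exact (hz j).1
  · ext j
    rw [← sf.pt.pt_coord j]
    exact (hp j).1
  · ext j
    rw [← sf.pt_pth, ← sf.pth.pt_coord j]
    exact (hp j).2
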